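/- There exist ε > 0 and C > 0, depending only on Ω, such that for every λ > 0 and every Dirichlet eigenfunction φ of Ω with eigenvalue λ² there is a function F : ℂ → ℂ, holomorphic on the strip S_ε = {t ∈ ℂ : |Im t| < ε}, with F(t + ℓ) = F(t) for all t ∈ S_ε and F(s) = ⟨∇φ(q(s)), ν(s)⟩ for all real s (so F extends the boundary normal derivative holomorphically), and the set {t ∈ ℂ : 0 ≤ Re t < ℓ, |Im t| ≤ ε/2, F(t) = 0} is finite and has cardinality at most C·λ. -/

import Mathlib

open MeasureTheory Real
open scoped RealInnerProductSpace

noncomputable section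

abbrev E2 : Type := EuclideanSpace ℝ (Fin 2)

/-- The Euclidean Laplacian `∂²/∂x₁² + ∂²/∂x₂²` on `ℝ²`. -/
def lap (φ : E2 → ℝ) (x : E2) : ℝ :=
  ∑ i : Fin 2,
    fderiv ℝ (fun y => fderiv ℝ φ y (EuclideanSpace.single i 1)) x (EuclideanSpace.single i 1)

/-- A bounded open connected planar domain. -/
structure IsPlaneDomain (Ω : Set E2) : Prop where
  isOpen : IsOpen Ω
  isBounded : Bornology.IsBounded Ω
  isConnected : IsConnected Ω

/-- An arc-length parametrization `q` of the boundary of `Ω` (periodic with period `len`,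
injective on `[0, len)`, unit speed, image equal to the frontier of `Ω`), together with the
unit normal `ν` along the boundary, pointing into `Ω`. -/
structure BoundaryParam (Ω : Set E2) where
  len : ℝ
  len_pos : 0 < len
  q : ℝ → E2
  qd : ℝ → E2
  hasDerivAt : ∀ s, HasDerivAt q (qd s) s
  periodic : Function.Periodic q len
  injOn : Set.InjOn q (Set.Ico 0 len)
  unitSpeed : ∀ s, ‖qd s‖ = 1
  range_eq : Set.range q = frontier Ω
  ν : ℝ → E2
  ν_unit : ∀ s, ‖ν s‖ = 1
  ν_orth : ∀ s, ⟪ν s, qd s⟫ = 0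
  ν_inward : ∀ s, ∃ δ > 0, ∀ t ∈ Set.Ioo (0 : ℝ) δ, q s + t • ν s ∈ Ω

/-- The boundary parametrization is real-analytic. -/
def BoundaryParam.IsAnalytic {Ω : Set E2} (B : BoundaryParam Ω) : Prop :=
  AnalyticOnNhd ℝ B.q Set.univ

/-- `φ` is a Dirichlet eigenfunction of `Ω` with eigenvalue `lam²`: it is real-analytic on an
open neighborhood of the closure of `Ω`, not identically zero on `Ω`, satisfies
`Δφ = -lam² φ` on `Ω` and vanishes along the boundary. -/
structure IsDirichletEigenfunction {Ω : Set E2} (B : BoundaryParam Ω) (lam : ℝ)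
    (φ : E2 → ℝ) : Prop where
  analytic : ∃ U : Set E2, IsOpen U ∧ closure Ω ⊆ U ∧ AnalyticOnNhd ℝ φ U
  nontrivial : ∃ x ∈ Ω, φ x ≠ 0
  eigen : ∀ x ∈ Ω, lap φ x = -lam ^ 2 * φ x
  dirichlet : ∀ s : ℝ, φ (B.q s) = 0

open Filter Topology

/-- Partial derivative in the real direction. -/
def dRe (u : ℂ → ℝ) (z : ℂ) : ℝ := fderiv ℝ u z 1

/-- Partial derivative in the imaginary direction. -/
def dIm (u : ℂ → ℝ) (z : ℂ) : ℝ := fderiv ℝ u z Complex.I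

/-- The function `u` has pure second partial derivatives at `z` whose sum is `L`. -/
def HasLap (u : ℂ → ℝ) (z : ℂ) (L : ℝ) : Prop :=
  ∃ a b : ℝ, a + b = L ∧
    (∃ v : ℝ → ℝ, (∀ᶠ x in 𝓝 z.re, HasDerivAt (fun x => u ⟨x, z.im⟩) (v x) x) ∧
      HasDerivAt v a z.re) ∧
    (∃ v : ℝ → ℝ, (∀ᶠ y in 𝓝 z.im, HasDerivAt (fun y => u ⟨z.re, y⟩) (v y) y) ∧
      HasDerivAt v b z.im)

lemma HasLap.add {u v : ℂ → ℝ} {z : ℂ} {L M : ℝ} (hu : HasLap u z L) (hv : HasLap v z M) :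
    HasLap (fun w => u w + v w) z (L + M) := by
  obtain ⟨a, b, rfl, ⟨u1, h1, h1'⟩, u2, h2, h2'⟩ := hu
  obtain ⟨a', b', rfl, ⟨v1, k1, k1'⟩, v2, k2, k2'⟩ := hv
  refine ⟨a + a', b + b', by ring, ⟨_, ?_, h1'.add k1'⟩, _, ?_, h2'.add k2'⟩
  · filter_upwards [h1, k1] with x hx kx using hx.add kx
  · filter_upwards [h2, k2] with x hx kx using hx.add kx

lemma HasLap.const_mul {u : ℂ → ℝ} {z : ℂ} {L : ℝ} (c : ℝ) (hu : HasLap u z L) :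
    HasLap (fun w => c * u w) z (c * L) := by
  obtain ⟨a, b, rfl, ⟨u1, h1, h1'⟩, u2, h2, h2'⟩ := hu
  refine ⟨c * a, c * b, by ring, ⟨_, ?_, h1'.const_mul c⟩, _, ?_, h2'.const_mul c⟩
  · filter_upwards [h1] with x hx using hx.const_mul c
  · filter_upwards [h2] with x hx using hx.const_mul c

lemma HasLap.sub {u v : ℂ → ℝ} {z : ℂ} {L M : ℝ} (hu : HasLap u z L) (hv : HasLap v z M) :
    HasLap (fun w => u w - v w) z (L - M) := by
  have := hu.add (hv.const_mul (-1))
  convert this using 1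
  · ext; ring
  · ring

lemma HasLap.swap {u : ℂ → ℝ} {z : ℂ} {L : ℝ} (hu : HasLap u ⟨z.im, z.re⟩ L) :
    HasLap (fun w => u ⟨w.im, w.re⟩) z L := by
  obtain ⟨a, b, rfl, h1, h2⟩ := hu
  exact ⟨b, a, by ring, h2, h1⟩

/-- Translation by a complex number together with an optional reflection in the real part. -/
lemma HasLap.comp_affine {u : ℂ → ℝ} {z : ℂ} {L σ c : ℝ} (hσ : σ * σ = 1)
    (hu : HasLap u ⟨c + σ * z.re, z.im⟩ L) :
    HasLap (fun w => u ⟨c + σ * w.re, w.im⟩) z L := by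
  obtain ⟨a, b, rfl, ⟨v, h1, h1'⟩, h2⟩ := hu
  have hd : ∀ x : ℝ, HasDerivAt (fun x : ℝ => c + σ * x) σ x := fun x => by
    simpa using ((hasDerivAt_id x).const_mul σ).const_add c
  refine ⟨a, b, rfl, ⟨fun x => σ * v (c + σ * x), ?_, ?_⟩, h2⟩
  · have : Tendsto (fun x : ℝ => c + σ * x) (𝓝 z.re) (𝓝 (c + σ * z.re)) :=
      (hd _).continuousAt
    filter_upwards [this.eventually h1] with x hx
    have := hx.comp x (hd x)
    rwa [mul_comm] at this
  · have := (h1'.comp z.re (hd _)).const_mul σ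
    exact this.congr_deriv (by linear_combination a * hσ)

lemma hasLap_poly (A B C D E : ℝ) (y0 : ℝ) (z : ℂ) :
    HasLap (fun w => A * (w.im - y0) ^ 2 + B * w.re ^ 2 + C * w.re + D * w.im + E) z
      (2 * A + 2 * B) := by
  refine ⟨2 * B, 2 * A, by ring, ⟨fun x => 2 * B * x + C, .of_forall fun x => ?_, ?_⟩,
    fun y => 2 * A * (y - y0) + D, .of_forall fun y => ?_, ?_⟩
  · have := ((((hasDerivAt_id x).pow 2).const_mul B).add
      ((hasDerivAt_id x).const_mul C)).const_add (A * (z.im - y0) ^ 2)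
    have := this.add_const (D * z.im + E)
    refine (this.congr_deriv (by simp; ring)).congr_of_eventuallyEq (.of_forall fun t => ?_)
    simp; ring
  · simpa using ((hasDerivAt_id z.re).const_mul (2 * B)).add_const C
  · have := (((((hasDerivAt_id y).sub_const y0).pow 2).const_mul A).add
      ((hasDerivAt_id y).const_mul D)).const_add (B * z.re ^ 2 + C * z.re + E)
    refine (this.congr_deriv (by simp; ring)).congr_of_eventuallyEq (.of_forall fun t => ?_)
    simp; ring
  · simpa using (((hasDerivAt_id z.im).sub_const y0).const_mul (2 * A)).add_const D

lemma not_deriv_deriv_pos_of_isLocalMax {f v : ℝ → ℝ} {x a : ℝ} (hf : IsLocalMax f x)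
    (h : ∀ᶠ y in 𝓝 x, HasDerivAt f (v y) y) (hv : HasDerivAt v a x) : a ≤ 0 := by
  by_contra! ha
  have hd : deriv f =ᶠ[𝓝 x] v := h.mono fun y hy => hy.deriv
  have h2 : deriv (deriv f) x = a := by rw [hd.deriv_eq, hv.deriv]
  have hmin : IsLocalMin f x := isLocalMin_of_deriv_deriv_pos (by rw [h2]; exact ha)
    hf.deriv_eq_zero h.self_of_nhds.continuousAt
  have hc : f =ᶠ[𝓝 x] fun _ => f x := by
    filter_upwards [hf, hmin] with y h1 h2 using le_antisymm h1 h2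
  have : deriv f =ᶠ[𝓝 x] fun _ => 0 := by
    refine hc.deriv.trans ?_
    simp
  rw [this.deriv_eq] at h2
  simp at h2
  exact ha.ne h2

lemma tendsto_mk_re (z : ℂ) : Tendsto (fun x : ℝ => (⟨x, z.im⟩ : ℂ)) (𝓝 z.re) (𝓝 z) := by
  have : Continuous (fun x : ℝ => (⟨x, z.im⟩ : ℂ)) :=
    Complex.equivRealProdCLM.symm.continuous.comp (by fun_prop : Continuous fun x : ℝ => (x, z.im))
  exact this.tendsto' _ _ rfl

lemma tendsto_mk_im (z : ℂ) : Tendsto (fun y : ℝ => (⟨z.re, y⟩ : ℂ)) (𝓝 z.im) (𝓝 z) := by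
  have : Continuous (fun y : ℝ => (⟨z.re, y⟩ : ℂ)) :=
    Complex.equivRealProdCLM.symm.continuous.comp (by fun_prop : Continuous fun x : ℝ => (z.re, x))
  exact this.tendsto' _ _ rfl

/-- Weak maximum principle for strict subsolutions. -/
lemma le_zero_of_hasLap_pos {K : Set ℂ} (hK : IsCompact K) {w : ℂ → ℝ} (hw : ContinuousOn w K)
    (hlap : ∀ z ∈ interior K, ∃ L > 0, HasLap w z L) (hb : ∀ z ∈ K, z ∉ interior K → w z ≤ 0) :
    ∀ z ∈ K, w z ≤ 0 := by
  intro z hz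
  obtain ⟨m, hm, hmax⟩ := hK.exists_isMaxOn ⟨z, hz⟩ hw
  refine (hmax hz).trans ?_
  by_cases hi : m ∈ interior K
  · exfalso
    obtain ⟨L, hL, a, b, rfl, ⟨v1, h1, h1'⟩, v2, h2, h2'⟩ := hlap m hi
    have hK' : K ∈ 𝓝 m := mem_interior_iff_mem_nhds.1 hi
    have e1 : IsLocalMax (fun x => w ⟨x, m.im⟩) m.re :=
      (tendsto_mk_re m).eventually (Filter.eventually_of_mem hK' fun x hx => hmax hx)
    have e2 : IsLocalMax (fun y => w ⟨m.re, y⟩) m.im :=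
      (tendsto_mk_im m).eventually (Filter.eventually_of_mem hK' fun x hx => hmax hx)
    have := not_deriv_deriv_pos_of_isLocalMax e1 h1 h1'
    have := not_deriv_deriv_pos_of_isLocalMax e2 h2 h2'
    linarith
  · exact hb m hm hi

lemma mem_interior_reProdIm {a b c d : ℝ} {z : ℂ} :
    z ∈ interior (Set.Icc a b ×ℂ Set.Icc c d) ↔ (a < z.re ∧ z.re < b) ∧ c < z.im ∧ z.im < d := by
  rw [Complex.interior_reProdIm, interior_Icc, interior_Icc]
  rfl

/-- Barrier estimate on a rectangle for a function vanishing on its left side. -/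
lemma abs_le_barrier {d a b y0 N f : ℝ} (hd : 0 < d) {g : ℂ → ℝ} (hN : 0 ≤ N) (hf : 0 ≤ f)
    (hy0 : a ≤ y0 ∧ y0 ≤ b)
    (hg : ContinuousOn g (Set.Icc 0 d ×ℂ Set.Icc a b))
    (hlap : ∀ z : ℂ, 0 < z.re → z.re < d → a < z.im → z.im < b → ∃ L, HasLap g z L ∧ |L| ≤ f)
    (hgN : ∀ z ∈ Set.Icc 0 d ×ℂ Set.Icc a b, |g z| ≤ N)
    (h0 : ∀ z ∈ Set.Icc 0 d ×ℂ Set.Icc a b, z.re = 0 → g z = 0)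
    (ha : d ≤ |a - y0| ∨ ∀ z ∈ Set.Icc 0 d ×ℂ Set.Icc a b, z.im = a → g z = 0)
    (hb : d ≤ |b - y0| ∨ ∀ z ∈ Set.Icc 0 d ×ℂ Set.Icc a b, z.im = b → g z = 0)
    {x : ℝ} (hx0 : 0 ≤ x) (hxd : x ≤ d) :
    |g ⟨x, y0⟩| ≤ (2 * N / d + f * d / 2) * x := by
  -- signed version with a strict supersolution
  have key : ∀ σ : ℝ, |σ| = 1 → ∀ κ > 0, σ * g ⟨x, y0⟩ ≤ (2 * N / d + (f + κ) * d / 2) * x := by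
    intro σ hσ κ hκ
    set A : ℝ := N / d ^ 2 with hA
    have hA0 : 0 ≤ A := by positivity
    set bar : ℂ → ℝ := fun w => A * (w.im - y0) ^ 2 + (-A - (f + κ) / 2) * w.re ^ 2
      + (2 * d * A + (f + κ) / 2 * d) * w.re + 0 * w.im + 0 with hbar
    have hbar' : ∀ w, bar w = A * ((w.im - y0) ^ 2 + w.re * (2 * d - w.re))
        + (f + κ) / 2 * (w.re * (d - w.re)) := fun w => by simp only [hbar]; ring
    have hbar0 : ∀ w ∈ Set.Icc 0 d ×ℂ Set.Icc a b, 0 ≤ bar w := by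
      rintro w ⟨⟨h1, h2⟩, -⟩
      have h1 : 0 ≤ w.re := h1
      have h2 : w.re ≤ d := h2
      rw [hbar']
      have : 0 ≤ 2 * d - w.re := by linarith
      have : 0 ≤ d - w.re := by linarith
      positivity
    have hAd : A * d ^ 2 = N := by rw [hA]; field_simp
    have hbarN : ∀ w ∈ Set.Icc 0 d ×ℂ Set.Icc a b, d ≤ |w.im - y0| ∨ w.re = d → N ≤ bar w := by
      rintro w ⟨⟨h1, h2⟩, -⟩ h
      have h1 : 0 ≤ w.re := h1
      have h2 : w.re ≤ d := h2
      rw [hbar']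
      have e2 : 0 ≤ (f + κ) / 2 * (w.re * (d - w.re)) := by
        have : 0 ≤ d - w.re := by linarith
        positivity
      rcases h with h | h
      · have : d ^ 2 ≤ (w.im - y0) ^ 2 := by
          rw [← sq_abs (w.im - y0)]; gcongr
        have e3 : 0 ≤ w.re * (2 * d - w.re) := mul_nonneg h1 (by linarith)
        nlinarith
      · have e3 : d ^ 2 ≤ (w.im - y0) ^ 2 + w.re * (2 * d - w.re) := by
          rw [h]; nlinarith [sq_nonneg (w.im - y0)]
        nlinarith
    have hle1 : ∀ w ∈ Set.Icc 0 d ×ℂ Set.Icc a b, σ * g w ≤ |g w| := fun w _ => by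
      calc σ * g w ≤ |σ * g w| := le_abs_self _
        _ = |g w| := by rw [abs_mul, hσ, one_mul]
    have hmain := le_zero_of_hasLap_pos (K := Set.Icc 0 d ×ℂ Set.Icc a b)
      (w := fun w => σ * g w - bar w)
      (isCompact_Icc.reProdIm isCompact_Icc)
      ((continuousOn_const.mul hg).sub (by
        simp only [hbar]; fun_prop)) (by
        intro z hz
        obtain ⟨⟨h1, h2⟩, h3, h4⟩ := mem_interior_reProdIm.1 hz
        obtain ⟨L, hL, hLf⟩ := hlap z h1 h2 h3 h4
        refine ⟨_, ?_, (hL.const_mul σ).sub (hasLap_poly _ _ _ _ _ _ _)⟩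
        have : |σ * L| ≤ f := by rw [abs_mul, hσ, one_mul]; exact hLf
        have := (abs_le.1 this).1
        linarith) (by
        intro z hz hni
        have hz' := hz
        obtain ⟨⟨h1, h2⟩, h3, h4⟩ := hz'
        have h1 : 0 ≤ z.re := h1
        have h2 : z.re ≤ d := h2
        have h3 : a ≤ z.im := h3
        have h4 : z.im ≤ b := h4
        have hz0 := hbar0 z hz
        have hzero : g z = 0 → σ * g z - bar z ≤ 0 := fun h => by rw [h]; linarith
        have hbig : (d ≤ |z.im - y0| ∨ z.re = d) → σ * g z - bar z ≤ 0 := fun h => by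
          have := hbarN z hz h
          have := hle1 z hz
          have := hgN z hz
          linarith
        by_cases c1 : z.re = 0
        · exact hzero (h0 z hz c1)
        by_cases c2 : z.re = d
        · exact hbig (.inr c2)
        by_cases c3 : z.im = a
        · rcases ha with h | h
          · exact hbig (.inl (by rw [c3]; exact h))
          · exact hzero (h z hz c3)
        by_cases c4 : z.im = b
        · rcases hb with h | h
          · exact hbig (.inl (by rw [c4]; exact h))
          · exact hzero (h z hz c4)
        exact absurd (mem_interior_reProdIm.2 ⟨⟨lt_of_le_of_ne h1 (Ne.symm c1),
          lt_of_le_of_ne h2 c2⟩, lt_of_le_of_ne h3 (Ne.symm c3), lt_of_le_of_ne h4 c4⟩) hni)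
      ⟨x, y0⟩ ⟨⟨hx0, hxd⟩, hy0⟩
    have e := hbar' ⟨x, y0⟩
    simp only [sub_self] at e
    have hAd' : 2 * N / d = 2 * d * A := by rw [hA]; field_simp
    rw [hAd']
    have : σ * g ⟨x, y0⟩ ≤ bar ⟨x, y0⟩ := by simpa using hmain
    rw [e] at this
    nlinarith [mul_nonneg hA0 (sq_nonneg x), mul_nonneg (by positivity : 0 ≤ (f + κ) / 2) (sq_nonneg x)]
  have key2 : ∀ σ : ℝ, |σ| = 1 → σ * g ⟨x, y0⟩ ≤ (2 * N / d + f * d / 2) * x := by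
    intro σ hσ
    have h := key σ hσ
    refine le_of_forall_pos_le_add fun ε hε => ?_
    have := h (ε / (d * d + 1)) (by positivity)
    refine this.trans ?_
    have e : (2 * N / d + (f + ε / (d * d + 1)) * d / 2) * x
      = (2 * N / d + f * d / 2) * x + ε / (d * d + 1) * (d * x / 2) := by ring
    rw [e]
    have : ε / (d * d + 1) * (d * x / 2) ≤ ε / (d * d + 1) * (d * d + 1) := by
      gcongr
      nlinarith
    rw [div_mul_cancel₀ _ (by positivity)] at this
    linarith
  rw [abs_le]
  have h1 := key2 1 (by simp)
  have h2 := key2 (-1) (by simp)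
  constructor <;> linarith

lemma analyticAt_dRe {u : ℂ → ℝ} {z : ℂ} (hu : AnalyticAt ℝ u z) : AnalyticAt ℝ (dRe u) z :=
  ((ContinuousLinearMap.apply ℝ ℝ (1 : ℂ)).analyticAt _).comp hu.fderiv

lemma analyticAt_dIm {u : ℂ → ℝ} {z : ℂ} (hu : AnalyticAt ℝ u z) : AnalyticAt ℝ (dIm u) z :=
  ((ContinuousLinearMap.apply ℝ ℝ Complex.I).analyticAt _).comp hu.fderiv

lemma analyticAt_dRe_iterate {u : ℂ → ℝ} {z : ℂ} (hu : AnalyticAt ℝ u z) (k : ℕ) :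
    AnalyticAt ℝ (dRe^[k] u) z := by
  induction k with
  | zero => exact hu
  | succ k ih => rw [Function.iterate_succ_apply']; exact analyticAt_dRe ih

lemma hasDerivAt_mk_re (x y : ℝ) : HasDerivAt (fun x : ℝ => (⟨x, y⟩ : ℂ)) 1 x := by
  have h : (fun x : ℝ => (⟨x, y⟩ : ℂ)) = fun x : ℝ => (x : ℂ) + y * Complex.I := by
    ext x; exact Complex.mk_eq_add_mul_I x y
  rw [h]
  exact (Complex.ofRealCLM.hasDerivAt (x := x)).add_const _

lemma hasDerivAt_mk_im (x y : ℝ) : HasDerivAt (fun y : ℝ => (⟨x, y⟩ : ℂ)) Complex.I y := by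
  have h : (fun y : ℝ => (⟨x, y⟩ : ℂ)) = fun y : ℝ => (x : ℂ) + y * Complex.I := by
    ext y; exact Complex.mk_eq_add_mul_I x y
  rw [h]
  simpa using ((Complex.ofRealCLM.hasDerivAt (x := y)).mul_const Complex.I).const_add (x : ℂ)

lemma hasDerivAt_re_slice {u : ℂ → ℝ} {x y : ℝ} (hu : DifferentiableAt ℝ u ⟨x, y⟩) :
    HasDerivAt (fun x : ℝ => u ⟨x, y⟩) (dRe u ⟨x, y⟩) x :=
  hu.hasFDerivAt.comp_hasDerivAt x (hasDerivAt_mk_re x y)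

lemma hasDerivAt_im_slice {u : ℂ → ℝ} {x y : ℝ} (hu : DifferentiableAt ℝ u ⟨x, y⟩) :
    HasDerivAt (fun y : ℝ => u ⟨x, y⟩) (dIm u ⟨x, y⟩) y :=
  hu.hasFDerivAt.comp_hasDerivAt y (hasDerivAt_mk_im x y)

lemma hasLap_of_analyticAt {u : ℂ → ℝ} {z : ℂ} (hu : AnalyticAt ℝ u z) :
    HasLap u z (dRe (dRe u) z + dIm (dIm u) z) := by
  refine ⟨_, _, rfl, ⟨fun x => dRe u ⟨x, z.im⟩, ?_, ?_⟩, fun y => dIm u ⟨z.re, y⟩, ?_, ?_⟩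
  · filter_upwards [(tendsto_mk_re z).eventually hu.eventually_analyticAt] with x hx
    exact hasDerivAt_re_slice hx.differentiableAt
  · exact hasDerivAt_re_slice (analyticAt_dRe hu).differentiableAt
  · filter_upwards [(tendsto_mk_im z).eventually hu.eventually_analyticAt] with y hy
    exact hasDerivAt_im_slice hy.differentiableAt
  · exact hasDerivAt_im_slice (analyticAt_dIm hu).differentiableAt

lemma dRe_dIm_eq {u : ℂ → ℝ} {z : ℂ} (hu : AnalyticAt ℝ u z) :
    dRe (dIm u) z = dIm (dRe u) z := by
  have h1 : ∀ v : ℂ, HasFDerivAt (fun w => fderiv ℝ u w v)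
      ((ContinuousLinearMap.apply ℝ ℝ v).comp (fderiv ℝ (fderiv ℝ u) z)) z := fun v =>
    (ContinuousLinearMap.apply ℝ ℝ v).hasFDerivAt.comp z hu.fderiv.differentiableAt.hasFDerivAt
  have e1 : dRe (dIm u) z = fderiv ℝ (fderiv ℝ u) z 1 Complex.I := by
    unfold dRe
    exact congrArg (fun L => L 1) (h1 Complex.I).fderiv
  have e2 : dIm (dRe u) z = fderiv ℝ (fderiv ℝ u) z Complex.I 1 := by
    unfold dIm
    exact congrArg (fun L => L Complex.I) (h1 1).fderiv
  rw [e1, e2]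
  exact (hu.contDiffAt (n := ⊤)).isSymmSndFDerivAt (by simp) 1 Complex.I

lemma dRe_congr {u v : ℂ → ℝ} {z : ℂ} (h : u =ᶠ[𝓝 z] v) : dRe u z = dRe v z := by
  unfold dRe; rw [h.fderiv_eq]

lemma dIm_congr {u v : ℂ → ℝ} {z : ℂ} (h : u =ᶠ[𝓝 z] v) : dIm u z = dIm v z := by
  unfold dIm; rw [h.fderiv_eq]

lemma dRe_add {u v : ℂ → ℝ} {z : ℂ} (hu : DifferentiableAt ℝ u z) (hv : DifferentiableAt ℝ v z) :
    dRe (fun w => u w + v w) z = dRe u z + dRe v z := by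
  unfold dRe; rw [fderiv_fun_add hu hv]; rfl

/-- The Laplacian in terms of iterated partial derivatives. -/
def lapC (u : ℂ → ℝ) (z : ℂ) : ℝ := dRe (dRe u) z + dIm (dIm u) z

lemma lapC_dRe {u : ℂ → ℝ} {z : ℂ} (hu : AnalyticAt ℝ u z) :
    lapC (dRe u) z = dRe (lapC u) z := by
  unfold lapC
  rw [dRe_add (analyticAt_dRe (analyticAt_dRe hu)).differentiableAt
    (analyticAt_dIm (analyticAt_dIm hu)).differentiableAt]
  congr 1
  rw [dRe_dIm_eq (analyticAt_dIm hu)]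
  apply dIm_congr
  filter_upwards [hu.eventually_analyticAt] with w hw
  exact (dRe_dIm_eq hw).symm

lemma lapC_dRe_iterate {u : ℂ → ℝ} {O : Set ℂ} (hO : IsOpen O) (hu : AnalyticOnNhd ℝ u O) (k : ℕ) :
    ∀ z ∈ O, lapC (dRe^[k] u) z = dRe^[k] (lapC u) z := by
  induction k with
  | zero => intro z _; rfl
  | succ k ih =>
    intro z hz
    rw [Function.iterate_succ_apply', Function.iterate_succ_apply',
      lapC_dRe (analyticAt_dRe_iterate (hu z hz) k)]
    exact dRe_congr (Filter.eventually_of_mem (hO.mem_nhds hz) ih)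

lemma dRe_iterate_congr {u v : ℂ → ℝ} {O : Set ℂ} (hO : IsOpen O) (h : Set.EqOn u v O) (k : ℕ) :
    Set.EqOn (dRe^[k] u) (dRe^[k] v) O := by
  induction k with
  | zero => exact h
  | succ k ih =>
    intro z hz
    rw [Function.iterate_succ_apply', Function.iterate_succ_apply']
    exact dRe_congr (Filter.eventually_of_mem (hO.mem_nhds hz) ih)

lemma dIm_dRe_iterate {u : ℂ → ℝ} {O : Set ℂ} (hO : IsOpen O) (hu : AnalyticOnNhd ℝ u O) (k : ℕ) :
    ∀ z ∈ O, dIm (dRe^[k] u) z = dRe^[k] (dIm u) z := by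
  induction k with
  | zero => intro z _; rfl
  | succ k ih =>
    intro z hz
    rw [Function.iterate_succ_apply', Function.iterate_succ_apply',
      ← dRe_dIm_eq (analyticAt_dRe_iterate (hu z hz) k)]
    exact dRe_congr (Filter.eventually_of_mem (hO.mem_nhds hz) ih)

lemma abs_le_of_forall_abs_le_mul {g : ℝ → ℝ} {c B d : ℝ} (hd : 0 < d) (hg : HasDerivAt g c 0)
    (h0 : g 0 = 0) (h : ∀ x, 0 ≤ x → x ≤ d → |g x| ≤ B * x) : |c| ≤ B := by
  have ht := (hasDerivAt_iff_tendsto_slope.1 hg).mono_left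
    (nhdsWithin_mono 0 (fun x (hx : 0 < x) => ne_of_gt hx) : 𝓝[>] (0 : ℝ) ≤ _)
  refine le_of_tendsto ht.abs ?_
  filter_upwards [Ioc_mem_nhdsGT hd] with x hx
  rw [slope_def_field, h0, sub_zero, sub_zero, abs_div, abs_of_pos hx.1, div_le_iff₀ hx.1]
  exact h x hx.1.le hx.2

/-- Gradient estimate in the real direction, up to horizontal boundary pieces where `u = 0`. -/
lemma abs_dRe_le {d a b N f : ℝ} (hd : 0 < d) {u : ℂ → ℝ} {z0 : ℂ} (hN : 0 ≤ N) (hf : 0 ≤ f)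
    (hy0 : a ≤ z0.im ∧ z0.im ≤ b)
    (hu : AnalyticOnNhd ℝ u (Set.Icc (z0.re - d) (z0.re + d) ×ℂ Set.Icc a b))
    (hlap : ∀ z : ℂ, z0.re - d < z.re → z.re < z0.re + d → a < z.im → z.im < b → |lapC u z| ≤ f)
    (huN : ∀ z ∈ Set.Icc (z0.re - d) (z0.re + d) ×ℂ Set.Icc a b, |u z| ≤ N)
    (ha : d ≤ |a - z0.im| ∨
      ∀ z ∈ Set.Icc (z0.re - d) (z0.re + d) ×ℂ Set.Icc a b, z.im = a → u z = 0)
    (hb : d ≤ |b - z0.im| ∨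
      ∀ z ∈ Set.Icc (z0.re - d) (z0.re + d) ×ℂ Set.Icc a b, z.im = b → u z = 0) :
    |dRe u z0| ≤ 2 * N / d + f * d / 2 := by
  set R := Set.Icc (z0.re - d) (z0.re + d) ×ℂ Set.Icc a b with hR
  set g : ℂ → ℝ := fun w => (1 / 2) * (u ⟨z0.re + 1 * w.re, w.im⟩ - u ⟨z0.re + (-1) * w.re, w.im⟩)
    with hgdef
  have hm1 : ∀ w ∈ Set.Icc 0 d ×ℂ Set.Icc a b, (⟨z0.re + 1 * w.re, w.im⟩ : ℂ) ∈ R := by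
    rintro w ⟨⟨h1, h2⟩, h3⟩
    have h1 : 0 ≤ w.re := h1
    have h2 : w.re ≤ d := h2
    exact ⟨⟨by simp only; linarith, by simp only; linarith⟩, h3⟩
  have hm2 : ∀ w ∈ Set.Icc 0 d ×ℂ Set.Icc a b, (⟨z0.re + (-1) * w.re, w.im⟩ : ℂ) ∈ R := by
    rintro w ⟨⟨h1, h2⟩, h3⟩
    have h1 : 0 ≤ w.re := h1
    have h2 : w.re ≤ d := h2
    exact ⟨⟨by simp only; linarith, by simp only; linarith⟩, h3⟩
  have hcm : ∀ σ : ℝ, Continuous (fun w : ℂ => (⟨z0.re + σ * w.re, w.im⟩ : ℂ)) := fun σ =>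
    Complex.equivRealProdCLM.symm.continuous.comp
      (by fun_prop : Continuous fun w : ℂ => (z0.re + σ * w.re, w.im))
  have hbar := fun x (hx0 : 0 ≤ x) (hxd : x ≤ d) => abs_le_barrier (g := g) hd hN hf hy0
    (continuousOn_const.mul ((hu.continuousOn.comp (hcm 1).continuousOn hm1).sub
      (hu.continuousOn.comp (hcm (-1)).continuousOn hm2)))
    (by
      intro z h1 h2 h3 h4
      have i1 := hm1 z ⟨⟨h1.le, h2.le⟩, h3.le, h4.le⟩
      have i2 := hm2 z ⟨⟨h1.le, h2.le⟩, h3.le, h4.le⟩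
      refine ⟨_, (((hasLap_of_analyticAt (hu _ i1)).comp_affine (by norm_num)).sub
        ((hasLap_of_analyticAt (hu _ i2)).comp_affine (by norm_num))).const_mul (1 / 2), ?_⟩
      have l1 := hlap ⟨z0.re + 1 * z.re, z.im⟩ (by simp only; linarith) (by simp only; linarith) h3 h4
      have l2 := hlap ⟨z0.re + (-1) * z.re, z.im⟩ (by simp only; linarith) (by simp only; linarith)
        h3 h4
      unfold lapC at l1 l2
      rw [abs_le] at l1 l2 ⊢
      constructor <;> linarith [l1.1, l1.2, l2.1, l2.2])
    (by
      intro z hz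
      have l1 := huN _ (hm1 z hz)
      have l2 := huN _ (hm2 z hz)
      simp only [hgdef]
      rw [abs_le] at l1 l2 ⊢
      constructor <;> linarith [l1.1, l1.2, l2.1, l2.2])
    (by intro z _ h; simp [hgdef, h])
    (ha.imp_right fun h z hz hz' => by
      simp only [hgdef]
      rw [h _ (hm1 z hz) hz', h _ (hm2 z hz) hz']; ring)
    (hb.imp_right fun h z hz hz' => by
      simp only [hgdef]
      rw [h _ (hm1 z hz) hz', h _ (hm2 z hz) hz']; ring)
    hx0 hxd
  have hz0 : z0 ∈ R := ⟨⟨by linarith, by linarith⟩, hy0⟩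
  have hD : HasDerivAt (fun x : ℝ => u ⟨x, z0.im⟩) (dRe u z0) z0.re :=
    hasDerivAt_re_slice (hu z0 hz0).differentiableAt
  have hd1 : ∀ σ : ℝ, HasDerivAt (fun x : ℝ => u ⟨z0.re + σ * x, z0.im⟩) (dRe u z0 * σ) 0 := by
    intro σ
    have h1 : HasDerivAt (fun x : ℝ => z0.re + σ * x) σ 0 := by
      simpa using ((hasDerivAt_id (0 : ℝ)).const_mul σ).const_add z0.re
    exact HasDerivAt.comp (h₂ := fun x : ℝ => u ⟨x, z0.im⟩) 0 (by simpa using hD) h1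
  refine abs_le_of_forall_abs_le_mul (g := fun x => g ⟨x, z0.im⟩) hd ?_ (by simp [hgdef]) hbar
  exact (((hd1 1).sub (hd1 (-1))).const_mul (1 / 2)).congr_deriv (by ring)

/-- Linear growth of `u` away from a horizontal boundary piece where `u = 0`. -/
lemma abs_le_mul_im {d N f : ℝ} (hd : 0 < d) {u : ℂ → ℝ} {s : ℝ} (hN : 0 ≤ N) (hf : 0 ≤ f)
    (hu : AnalyticOnNhd ℝ u (Set.Icc (s - d) (s + d) ×ℂ Set.Icc 0 d))
    (hlap : ∀ z : ℂ, s - d < z.re → z.re < s + d → 0 < z.im → z.im < d → |lapC u z| ≤ f)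
    (huN : ∀ z ∈ Set.Icc (s - d) (s + d) ×ℂ Set.Icc 0 d, |u z| ≤ N)
    (h0 : ∀ z ∈ Set.Icc (s - d) (s + d) ×ℂ Set.Icc 0 d, z.im = 0 → u z = 0)
    {y : ℝ} (hy0 : 0 ≤ y) (hyd : y ≤ d) :
    |u ⟨s, y⟩| ≤ (2 * N / d + f * d / 2) * y := by
  have hcm : Continuous (fun w : ℂ => (⟨w.im, w.re⟩ : ℂ)) :=
    Complex.equivRealProdCLM.symm.continuous.comp
      (by fun_prop : Continuous fun w : ℂ => (w.im, w.re))
  refine abs_le_barrier (g := fun w => u ⟨w.im, w.re⟩) (a := s - d) (b := s + d) hd hN hf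
    ⟨by linarith, by linarith⟩
    (hu.continuousOn.comp hcm.continuousOn fun w hw => ⟨hw.2, hw.1⟩) ?_
    (fun z hz => huN _ ⟨hz.2, hz.1⟩) (fun z hz h => h0 _ ⟨hz.2, hz.1⟩ h)
    (.inl (by simp [abs_of_pos hd])) (.inl (by simp [abs_of_pos hd])) hy0 hyd
  intro z h1 h2 h3 h4
  exact ⟨_, (hasLap_of_analyticAt (hu ⟨z.im, z.re⟩
    ⟨⟨h3.le, h4.le⟩, h1.le, h2.le⟩)).swap, hlap ⟨z.im, z.re⟩ h3 h4 h1 h2⟩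

lemma abs_dIm_le {d N f : ℝ} (hd : 0 < d) {u : ℂ → ℝ} {s : ℝ} (hN : 0 ≤ N) (hf : 0 ≤ f)
    (hu : AnalyticOnNhd ℝ u (Set.Icc (s - d) (s + d) ×ℂ Set.Icc 0 d))
    (hlap : ∀ z : ℂ, s - d < z.re → z.re < s + d → 0 < z.im → z.im < d → |lapC u z| ≤ f)
    (huN : ∀ z ∈ Set.Icc (s - d) (s + d) ×ℂ Set.Icc 0 d, |u z| ≤ N)
    (h0 : ∀ z ∈ Set.Icc (s - d) (s + d) ×ℂ Set.Icc 0 d, z.im = 0 → u z = 0) :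
    |dIm u s| ≤ 2 * N / d + f * d / 2 := by
  have hm : (⟨s, 0⟩ : ℂ) ∈ Set.Icc (s - d) (s + d) ×ℂ Set.Icc 0 d :=
    ⟨⟨by simp only; linarith, by simp only; linarith⟩, ⟨le_rfl, hd.le⟩⟩
  exact abs_le_of_forall_abs_le_mul (g := fun y => u ⟨s, y⟩) hd
    (hasDerivAt_im_slice (hu _ hm).differentiableAt) (h0 _ hm rfl)
    fun y h1 h2 => abs_le_mul_im hd hN hf hu hlap huN h0 h1 h2

lemma dRe_iterate_eq_iteratedDeriv {y : ℝ} (k : ℕ) : ∀ {u : ℂ → ℝ},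
    (∀ x : ℝ, AnalyticAt ℝ u ⟨x, y⟩) → ∀ x : ℝ,
    dRe^[k] u ⟨x, y⟩ = iteratedDeriv k (fun x : ℝ => u ⟨x, y⟩) x := by
  induction k with
  | zero => intro u _ x; simp
  | succ k ih =>
    intro u hu x
    rw [Function.iterate_succ_apply, iteratedDeriv_succ', ih fun x => analyticAt_dRe (hu x)]
    congr 1
    ext t
    exact (hasDerivAt_re_slice (hu t).differentiableAt).deriv.symm

lemma contDiff_re_slice {u : ℂ → ℝ} {y : ℝ} (hu : ∀ x : ℝ, AnalyticAt ℝ u ⟨x, y⟩) (n : ℕ) :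
    ContDiff ℝ n (fun x : ℝ => u ⟨x, y⟩) := by
  have h : (fun x : ℝ => (⟨x, y⟩ : ℂ)) = fun x : ℝ => (x : ℂ) + y * Complex.I := by
    ext x; exact Complex.mk_eq_add_mul_I x y
  have hc : ContDiff ℝ n (fun x : ℝ => (⟨x, y⟩ : ℂ)) := by
    rw [h]; exact Complex.ofRealCLM.contDiff.add contDiff_const
  rw [contDiff_iff_contDiffAt]
  intro x
  exact ((hu x).contDiffAt.of_le le_top).comp x hc.contDiffAt

lemma dRe_iterate_mul {u v : ℂ → ℝ} {y : ℝ} (hu : ∀ x : ℝ, AnalyticAt ℝ u ⟨x, y⟩)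
    (hv : ∀ x : ℝ, AnalyticAt ℝ v ⟨x, y⟩) (k : ℕ) (x : ℝ) :
    dRe^[k] (fun z => u z * v z) ⟨x, y⟩ = ∑ i ∈ Finset.range (k + 1),
      (k.choose i : ℝ) * dRe^[i] u ⟨x, y⟩ * dRe^[k - i] v ⟨x, y⟩ := by
  rw [dRe_iterate_eq_iteratedDeriv (u := fun z => u z * v z) k fun x => (hu x).fun_mul (hv x)]
  rw [iteratedDeriv_fun_mul (contDiff_re_slice hu k).contDiffAt (contDiff_re_slice hv k).contDiffAt]
  refine Finset.sum_congr rfl fun i _ => ?_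
  rw [dRe_iterate_eq_iteratedDeriv _ hu, dRe_iterate_eq_iteratedDeriv _ hv]

lemma dRe_iterate_const_mul {u : ℂ → ℝ} {y : ℝ} (hu : ∀ x : ℝ, AnalyticAt ℝ u ⟨x, y⟩) (c : ℝ)
    (k : ℕ) (x : ℝ) : dRe^[k] (fun z => c * u z) ⟨x, y⟩ = c * dRe^[k] u ⟨x, y⟩ := by
  rw [dRe_iterate_eq_iteratedDeriv (u := fun z => c * u z) k
      fun x => analyticAt_const.fun_mul (hu x),
    dRe_iterate_eq_iteratedDeriv k hu, iteratedDeriv_const_mul_field]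

lemma leibniz_sum_le {A M r B : ℝ} (hA : 0 ≤ A) (hM : 0 ≤ M) (hr : 0 < r) (hB : 0 < B) {k : ℕ}
    (hk : 2 * k ≤ r * B) :
    ∑ i ∈ Finset.range (k + 1), (k.choose i : ℝ) * (A * i.factorial / r ^ i) * (M * B ^ (k - i))
      ≤ 2 * A * (M * B ^ k) := by
  have hterm : ∀ i ∈ Finset.range (k + 1),
      (k.choose i : ℝ) * (A * i.factorial / r ^ i) * (M * B ^ (k - i))
        ≤ A * (M * B ^ k) * (1 / 2) ^ i := by
    intro i hi
    have hik : i ≤ k := Nat.lt_succ_iff.1 (Finset.mem_range.1 hi)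
    have h1 : (k.choose i : ℝ) * i.factorial ≤ (k : ℝ) ^ i := by
      have := Nat.descFactorial_le_pow k i
      rw [Nat.descFactorial_eq_factorial_mul_choose] at this
      rw [mul_comm]
      exact_mod_cast this
    have h2 : (k : ℝ) ^ i ≤ (r * B / 2) ^ i := by
      gcongr; linarith
    calc (k.choose i : ℝ) * (A * i.factorial / r ^ i) * (M * B ^ (k - i))
        = ((k.choose i : ℝ) * i.factorial) * (A * (M * B ^ (k - i)) / r ^ i) := by ring
      _ ≤ (r * B / 2) ^ i * (A * (M * B ^ (k - i)) / r ^ i) := by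
          gcongr; exact h1.trans h2
      _ = A * (M * (B ^ i * B ^ (k - i))) * (1 / 2) ^ i := by
          rw [div_pow, mul_pow, div_pow, one_pow]
          field_simp
      _ = _ := by rw [← pow_add, Nat.add_sub_cancel' hik]
  refine (Finset.sum_le_sum hterm).trans ?_
  rw [← Finset.mul_sum]
  have : ∑ i ∈ Finset.range (k + 1), (1 / 2 : ℝ) ^ i ≤ 2 := sum_geometric_two_le _
  nlinarith [mul_nonneg hA (mul_nonneg hM (pow_nonneg hB.le k))]

/-- A solution of `Δψ = -λ²ρψ` in the half-strip `0 ≤ Im z ≤ δ`, real-analytic up to the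
boundary, bounded by `M` and vanishing on the real axis, together with analyticity bounds on the
coefficient `ρ`. -/
structure HalfStripSolution (δ M lam A r : ℝ) (ρ ψ : ℂ → ℝ) : Prop where
  analytic : ∀ z : ℂ, 0 ≤ z.im → z.im ≤ δ → AnalyticAt ℝ ψ z
  coeff_analytic : ∀ z : ℂ, 0 ≤ z.im → z.im ≤ δ → AnalyticAt ℝ ρ z
  coeff_le : ∀ (j : ℕ) (z : ℂ), 0 ≤ z.im → z.im ≤ δ → |dRe^[j] ρ z| ≤ A * j.factorial / r ^ j
  lap_eq : ∀ z : ℂ, 0 < z.im → z.im < δ → lapC ψ z = -lam ^ 2 * (ρ z * ψ z)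
  bound : ∀ z : ℂ, 0 ≤ z.im → z.im ≤ δ → |ψ z| ≤ M
  zero : ∀ z : ℂ, z.im = 0 → ψ z = 0

namespace HalfStripSolution

variable {δ M lam A r : ℝ} {ρ ψ : ℂ → ℝ}

lemma iterate_zero (h : HalfStripSolution δ M lam A r ρ ψ) (hδ : 0 < δ) (k : ℕ) (z : ℂ)
    (hz : z.im = 0) : dRe^[k] ψ z = 0 := by
  have : z = ⟨z.re, 0⟩ := Complex.ext rfl hz
  rw [this, dRe_iterate_eq_iteratedDeriv k fun x => h.analytic _ le_rfl hδ.le]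
  have : (fun x : ℝ => ψ ⟨x, 0⟩) = fun _ => 0 := by
    ext x; exact h.zero _ rfl
  rw [this]
  simp

lemma lap_iterate_le (h : HalfStripSolution δ M lam A r ρ ψ) (hM : 0 ≤ M) (hA : 0 ≤ A)
    (hr : 0 < r) {B : ℝ} (hB : 0 < B) {k : ℕ} (hk : 2 * k ≤ r * B) {z : ℂ} (hz : 0 < z.im)
    (hz' : z.im < δ) (hb : ∀ i ≤ k, |dRe^[i] ψ z| ≤ M * B ^ i) :
    |lapC (dRe^[k] ψ) z| ≤ lam ^ 2 * (2 * A * (M * B ^ k)) := by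
  set O : Set ℂ := {z | 0 < z.im} ∩ {z | z.im < δ} with hOdef
  have hO : IsOpen O :=
    (isOpen_lt continuous_const Complex.continuous_im).inter
      (isOpen_lt Complex.continuous_im continuous_const)
  rw [lapC_dRe_iterate hO (fun w hw => h.analytic w hw.1.le hw.2.le) k z ⟨hz, hz'⟩,
    dRe_iterate_congr hO (fun w hw => h.lap_eq w hw.1 hw.2) k ⟨hz, hz'⟩]
  have hψ : ∀ x : ℝ, AnalyticAt ℝ ψ ⟨x, z.im⟩ := fun x => h.analytic _ hz.le hz'.le
  have hρ : ∀ x : ℝ, AnalyticAt ℝ ρ ⟨x, z.im⟩ := fun x => h.coeff_analytic _ hz.le hz'.le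
  have e : z = ⟨z.re, z.im⟩ := rfl
  rw [e, dRe_iterate_const_mul (u := fun w => ρ w * ψ w)
      (fun x => (hρ x).fun_mul (hψ x)), dRe_iterate_mul hρ hψ, abs_mul, abs_neg,
    abs_of_nonneg (sq_nonneg lam), ← e]
  gcongr
  refine (Finset.abs_sum_le_sum_abs _ _).trans (le_trans (Finset.sum_le_sum fun i hi => ?_)
    (leibniz_sum_le hA hM hr hB hk))
  rw [abs_mul, abs_mul, Nat.abs_cast]
  gcongr
  · exact h.coeff_le i z hz.le hz'.le
  · exact hb (k - i) (Nat.sub_le _ _)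

/-- The two estimates feeding the gradient bound at order `k`. -/
lemma iterate_bounds (h : HalfStripSolution δ M lam A r ρ ψ) (hM : 0 ≤ M) (hA : 0 ≤ A)
    (hr : 0 < r) (hlam : 0 < lam) {K : ℝ} (hK : 0 < K) (hKr : 2 * δ ≤ r * K) {k : ℕ} {θ : ℝ}
    (hθ : 0 < θ) (hθδ : θ ≤ δ)
    (ih : ∀ i ≤ k, ∀ θ, 0 < θ → θ ≤ δ → ∀ z : ℂ, 0 ≤ z.im → z.im ≤ δ - θ →
      |dRe^[i] ψ z| ≤ M * (K * (lam + i / θ)) ^ i) {z : ℂ} (hz : 0 ≤ z.im)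
    (hz' : z.im ≤ δ - θ + 1 / (lam + (k + 1) / θ)) :
    |dRe^[k] ψ z| ≤ M * (K * (lam + (k + 1) / θ)) ^ k ∧
      (0 < z.im → |lapC (dRe^[k] ψ) z| ≤
        lam ^ 2 * (2 * A * (M * (K * (lam + (k + 1) / θ)) ^ k))) := by
  set Λ : ℝ := lam + (k + 1) / θ with hΛ
  have hΛ0 : 0 < Λ := by positivity
  set θ' : ℝ := θ - 1 / Λ with hθ'
  have hΛθ : k + 1 < Λ * θ := by
    rw [hΛ, add_mul, div_mul_cancel₀ _ hθ.ne']
    nlinarith [mul_pos hlam hθ]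
  have e1 : Λ * θ' = Λ * θ - 1 := by rw [hθ']; field_simp
  have hθ'0 : 0 < θ' := by
    have : 0 < Λ * θ' := by
      rw [e1]; have : (0 : ℝ) ≤ k := Nat.cast_nonneg k
      linarith
    exact pos_of_mul_pos_right this hΛ0.le
  have hθ'δ : θ' ≤ δ := by
    have : 0 < 1 / Λ := by positivity
    rw [hθ']; linarith
  have hle : ∀ i ≤ k, |dRe^[i] ψ z| ≤ M * (K * Λ) ^ i := by
    intro i hi
    refine (ih i hi θ' hθ'0 hθ'δ z hz (by rw [hθ']; linarith)).trans ?_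
    gcongr
    -- now compare the two widths
    have hik : (i : ℝ) ≤ k := by exact_mod_cast hi
    rw [hΛ]
    gcongr lam + ?_
    rw [div_le_div_iff₀ hθ'0 hθ]
    have e2 : θ' * (k + 1) = θ * (k + 1) - (k + 1) / Λ := by rw [hθ']; ring
    have e3 : (k + 1) / Λ ≤ θ := by
      rw [div_le_iff₀ hΛ0]; linarith
    nlinarith
  refine ⟨hle k le_rfl, fun hz0 => ?_⟩
  refine h.lap_iterate_le hM hA hr (by positivity) ?_ hz0 ?_ hle
  · have : r * (K * Λ) = (r * K) * Λ := by ring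
    rw [this]
    have : 2 * δ * Λ ≤ r * K * Λ := by gcongr
    nlinarith
  · have : z.im ≤ δ - θ' := by rw [hθ']; linarith
    linarith

lemma gradient_arith {N Λ lam A K : ℝ} (hN : 0 ≤ N) (hΛ : 0 < Λ) (hlam : 0 < lam) (hl : lam ≤ Λ)
    (hA : 0 ≤ A) (hK : 2 + A ≤ K) :
    2 * N / (1 / Λ) + lam ^ 2 * (2 * A * N) * (1 / Λ) / 2 ≤ N * (K * Λ) := by
  have h1 : lam ^ 2 * (1 / Λ) ≤ Λ := by
    rw [mul_one_div, div_le_iff₀ hΛ]; nlinarith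
  have e1 : 2 * N / (1 / Λ) = 2 * N * Λ := by field_simp
  have e2 : lam ^ 2 * (2 * A * N) * (1 / Λ) / 2 = (A * N) * (lam ^ 2 * (1 / Λ)) := by ring
  rw [e1, e2]
  have h2 : A * N * (lam ^ 2 * (1 / Λ)) ≤ A * N * Λ := by gcongr
  have h3 : (2 + A) * (N * Λ) ≤ K * (N * Λ) := by gcongr
  nlinarith

/-- Analytic estimates for tangential derivatives, uniform in the spectral parameter. -/
theorem iterate_le (h : HalfStripSolution δ M lam A r ρ ψ) (hM : 0 ≤ M) (hA : 0 ≤ A)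
    (hr : 0 < r) (hlam : 0 < lam) {K : ℝ} (hK : 2 + A ≤ K) (hKr : 2 * δ ≤ r * K) (k : ℕ) :
    ∀ θ, 0 < θ → θ ≤ δ → ∀ z : ℂ, 0 ≤ z.im → z.im ≤ δ - θ →
      |dRe^[k] ψ z| ≤ M * (K * (lam + k / θ)) ^ k := by
  induction k using Nat.strong_induction_on with
  | _ k ih =>
  rcases k with _ | k
  · intro θ hθ _ z hz hz'
    simpa using h.bound z hz (by linarith)
  intro θ hθ hθδ z hz hz'
  have hK0 : 0 < K := by linarith
  set Λ : ℝ := lam + (k + 1) / θ with hΛ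
  have hΛ0 : 0 < Λ := by positivity
  set d : ℝ := 1 / Λ with hd
  have hd0 : 0 < d := by positivity
  have hb := fun (w : ℂ) (hw : 0 ≤ w.im) (hw' : w.im ≤ δ - θ + d) =>
    h.iterate_bounds hM hA hr hlam hK0 hKr hθ hθδ (fun i hi => ih i (Nat.lt_succ_of_le hi)) hw hw'
  have hdθ : d ≤ θ := by
    rw [hd, div_le_iff₀ hΛ0, hΛ, mul_add, mul_div_cancel₀ _ hθ.ne']
    have : (0 : ℝ) ≤ k := Nat.cast_nonneg k
    nlinarith [mul_pos hlam hθ]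
  set N : ℝ := M * (K * Λ) ^ k with hN
  have hN0 : 0 ≤ N := by positivity
  rw [Function.iterate_succ_apply']
  have hmem : ∀ w ∈ Set.Icc (z.re - d) (z.re + d) ×ℂ Set.Icc (max 0 (z.im - d)) (z.im + d),
      0 ≤ w.im ∧ w.im ≤ δ - θ + d := fun w hw => by
    have h1 : max 0 (z.im - d) ≤ w.im := hw.2.1
    have h2 : w.im ≤ z.im + d := hw.2.2
    exact ⟨(le_max_left _ _).trans h1, by linarith⟩
  have := abs_dRe_le (u := dRe^[k] ψ) (z0 := z) (d := d) (a := max 0 (z.im - d)) (b := z.im + d)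
    (N := N) (f := lam ^ 2 * (2 * A * N)) hd0 hN0 (by positivity)
    ⟨max_le hz (by linarith), by linarith⟩
    (fun w hw => analyticAt_dRe_iterate
      (h.analytic w (hmem w hw).1 (by linarith [(hmem w hw).2])) k)
    (fun w h1 h2 h3 h4 => by
      have h3' : 0 < w.im := (le_max_left _ _).trans_lt h3
      exact (hb w h3'.le (by linarith)).2 h3')
    (fun w hw => (hb w (hmem w hw).1 (hmem w hw).2).1)
    (by
      by_cases hc : d ≤ z.im
      · left
        rw [max_eq_right (by linarith)]
        simp [abs_of_pos hd0]
      · right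
        intro w hw hwi
        rw [max_eq_left (by linarith)] at hwi
        exact h.iterate_zero (by linarith) k w hwi)
    (.inl (by simp [abs_of_pos hd0]))
  refine this.trans ((gradient_arith hN0 hΛ0 hlam (by rw [hΛ]; simp; positivity) hA hK).trans ?_)
  rw [hN, hΛ, pow_succ]
  push_cast
  exact le_of_eq (by ring)

/-- Bounds for the tangential derivatives of the normal derivative on the real axis. -/
theorem iterate_dIm_le (h : HalfStripSolution δ M lam A r ρ ψ) (hδ : 0 < δ) (hM : 0 ≤ M)
    (hA : 0 ≤ A) (hr : 0 < r) (hlam : 0 < lam) {K : ℝ} (hK : 2 + A ≤ K) (hKr : 2 * δ ≤ r * K)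
    (k : ℕ) (s : ℝ) :
    |dRe^[k] (dIm ψ) s| ≤ M * (K * (lam + (k + 1) / δ)) ^ (k + 1) := by
  have hK0 : 0 < K := by linarith
  set Λ : ℝ := lam + (k + 1) / δ with hΛ
  have hΛ0 : 0 < Λ := by positivity
  set d : ℝ := 1 / Λ with hd
  have hd0 : 0 < d := by positivity
  have hb := fun (w : ℂ) (hw : 0 ≤ w.im) (hw' : w.im ≤ δ - δ + d) =>
    h.iterate_bounds hM hA hr hlam hK0 hKr hδ le_rfl
      (fun i (_ : i ≤ k) => h.iterate_le hM hA hr hlam hK hKr i) hw hw'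
  have hdδ : d ≤ δ := by
    rw [hd, div_le_iff₀ hΛ0, hΛ, mul_add, mul_div_cancel₀ _ hδ.ne']
    have : (0 : ℝ) ≤ k := Nat.cast_nonneg k
    nlinarith [mul_pos hlam hδ]
  set N : ℝ := M * (K * Λ) ^ k with hN
  have hN0 : 0 ≤ N := by positivity
  rw [← dIm_dRe_iterate (isOpen_analyticAt ℝ ψ) (fun z hz => hz) k s
    (h.analytic s (by simp) (by simpa using hδ.le))]
  have := abs_dIm_le (u := dRe^[k] ψ) (s := s) (d := d)
    (N := N) (f := lam ^ 2 * (2 * A * N)) hd0 hN0 (by positivity)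
    (fun w hw => analyticAt_dRe_iterate
      (h.analytic w hw.2.1 (le_trans hw.2.2 hdδ)) k)
    (fun w h1 h2 h3 h4 => (hb w h3.le (by linarith)).2 h3)
    (fun w hw => (hb w hw.2.1 (by have : w.im ≤ d := hw.2.2
                                  linarith)).1)
    (fun w hw hw0 => h.iterate_zero hδ k w hw0)
  refine this.trans ((gradient_arith hN0 hΛ0 hlam (by rw [hΛ]; simp; positivity) hA hK).trans ?_)
  rw [hN, pow_succ]
  exact le_of_eq (by ring)

/-- Cauchy-type bounds for the normal derivative, with constant exponential in `lam`. -/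
theorem iteratedDeriv_dIm_le (h : HalfStripSolution δ M lam A r ρ ψ) (hδ : 0 < δ) (hM : 0 ≤ M)
    (hA : 0 ≤ A) (hr : 0 < r) (hlam : 0 < lam) {K : ℝ} (hK : 2 + A ≤ K) (hKr : 2 * δ ≤ r * K)
    (k : ℕ) (s : ℝ) :
    |dRe^[k] (dIm ψ) s| ≤ (M * exp (δ * lam) * (2 * exp 1 * K / δ)) * k.factorial /
      (δ / (2 * exp 1 * K)) ^ k := by
  refine (h.iterate_dIm_le hδ hM hA hr hlam hK hKr k s).trans ?_
  have hK0 : 0 < K := by linarith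
  have h1 : (δ * lam + (k + 1)) ^ (k + 1) ≤ (k + 1).factorial * exp (δ * lam + (k + 1)) := by
    have := Real.pow_div_factorial_le_exp (δ * lam + (k + 1)) (by positivity) (k + 1)
    rw [div_le_iff₀ (by positivity)] at this
    linarith
  have h2 : exp (δ * lam + (k + 1)) = exp (δ * lam) * exp 1 ^ (k + 1) := by
    rw [Real.exp_add, ← Real.exp_nat_mul]; push_cast; simp
  have h3 : ((k + 1 : ℕ) : ℝ) ≤ 2 ^ (k + 1) := by exact_mod_cast (Nat.lt_two_pow_self).le
  have e1 : K * (lam + (k + 1) / δ) = (K / δ) * (δ * lam + (k + 1)) := by field_simp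
  rw [e1, mul_pow]
  calc M * ((K / δ) ^ (k + 1) * (δ * lam + (k + 1)) ^ (k + 1))
      ≤ M * ((K / δ) ^ (k + 1) * (((2 : ℝ) ^ (k + 1) * k.factorial) *
          (exp (δ * lam) * exp 1 ^ (k + 1)))) := by
        rw [← h2]
        gcongr
        refine h1.trans ?_
        gcongr
        rw [Nat.factorial_succ]; push_cast at h3 ⊢
        gcongr
    _ = _ := by
        rw [div_pow, div_pow, mul_pow, mul_pow]
        field_simp
        ring

end HalfStripSolution

lemma iteratedDeriv_comp_ofReal {U : Set ℂ} (hU : IsOpen U) (k : ℕ) : ∀ {g : ℂ → ℂ},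
    DifferentiableOn ℂ g U → ∀ x : ℝ, (x : ℂ) ∈ U →
    iteratedDeriv k (fun x : ℝ => g x) x = iteratedDeriv k g x := by
  induction k with
  | zero => intro g _ x _; simp
  | succ k ih =>
    intro g hg x hx
    rw [iteratedDeriv_succ', iteratedDeriv_succ', ← ih (hg.deriv hU) x hx]
    apply Filter.EventuallyEq.iteratedDeriv_eq
    have : ∀ᶠ y : ℝ in 𝓝 x, (y : ℂ) ∈ U :=
      Complex.continuous_ofReal.continuousAt.eventually (hU.mem_nhds hx)
    filter_upwards [this] with y hy
    exact ((hg.differentiableAt (hU.mem_nhds hy)).hasDerivAt.comp_ofReal).deriv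

lemma differentiableOn_tsum_pow {a : ℕ → ℂ} {C r : ℝ} (c : ℂ) (hr : 0 < r)
    (ha : ∀ n, ‖a n‖ ≤ C / r ^ n) :
    DifferentiableOn ℂ (fun z => ∑' n, a n * (z - c) ^ n) (Metric.ball c r) := by
  intro z hz
  have hz' : ‖z - c‖ < r := by simpa [dist_eq_norm] using hz
  obtain ⟨ρ, h1, h2⟩ := exists_between hz'
  have hρ : 0 ≤ ρ := (norm_nonneg _).trans h1.le
  have hC : 0 ≤ C := by simpa using (norm_nonneg _).trans (ha 0)
  have : DifferentiableOn ℂ (fun z => ∑' n, a n * (z - c) ^ n) (Metric.ball c ρ) := by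
    refine Complex.differentiableOn_tsum_of_summable_norm (u := fun n => C * (ρ / r) ^ n)
      ((summable_geometric_of_lt_one (by positivity) ((div_lt_one hr).2 h2)).mul_left C)
      (fun n => by fun_prop) Metric.isOpen_ball fun n w hw => ?_
    have hw' : ‖w - c‖ < ρ := by simpa [dist_eq_norm] using hw
    rw [norm_mul, norm_pow, div_pow, mul_div_assoc', mul_comm C, ← mul_div_assoc', mul_comm]
    gcongr
    exact ha n
  exact (this.differentiableAt (Metric.isOpen_ball.mem_nhds
    (by simpa [dist_eq_norm] using h1))).differentiableWithinAt

/-- A real-analytic function on the line extends holomorphically near each point. -/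
lemma AnalyticAt.exists_holomorphic_extension {f : ℝ → ℂ} {s : ℝ} (hf : AnalyticAt ℝ f s) :
    ∃ ρ > 0, ∃ g : ℂ → ℂ, DifferentiableOn ℂ g (Metric.ball (s : ℂ) ρ) ∧
      ∀ x : ℝ, |x - s| < ρ → f x = g x := by
  obtain ⟨p, R, hp⟩ := hf
  obtain ⟨ρ, hρ0, hρR⟩ := ENNReal.lt_iff_exists_nnreal_btwn.1 hp.r_pos
  have hρ : 0 < (ρ : ℝ) := by exact_mod_cast hρ0
  obtain ⟨C, hC, hb⟩ := p.norm_mul_pow_le_of_lt_radius (hρR.trans_le hp.r_le)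
  refine ⟨ρ, hρ, fun z => ∑' n, p.coeff n * (z - s) ^ n,
    differentiableOn_tsum_pow (C := C) _ hρ fun n => ?_, fun x hx => ?_⟩
  · rw [le_div_iff₀ (by positivity), FormalMultilinearSeries.norm_apply_eq_norm_coef.symm]
    exact hb n
  · have hx' : x - s ∈ Metric.eball (0 : ℝ) R := by
      rw [Metric.mem_eball, edist_zero_right]
      refine lt_trans ?_ hρR
      rw [enorm_eq_nnnorm]
      exact_mod_cast (show ‖x - s‖ < ρ from hx)
    have := hp.hasSum hx'
    rw [show s + (x - s) = x by ring] at this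
    rw [← this.tsum_eq]
    congr 1
    ext n
    rw [FormalMultilinearSeries.apply_eq_pow_smul_coeff, Complex.real_smul, mul_comm]
    push_cast
    rfl

/-- The Taylor series, on its disc of convergence, extends the function. -/
lemma eqOn_taylor_ofReal {f : ℝ → ℂ} {A r : ℝ} (hr : 0 < r) (hf : ∀ s, AnalyticAt ℝ f s)
    (hA : ∀ (k : ℕ) s, ‖iteratedDeriv k f s‖ ≤ A * k.factorial / r ^ k) (s x : ℝ)
    (hx : |x - s| < r) :
    f x = ∑' n, (iteratedDeriv n f s / n.factorial) * ((x : ℂ) - s) ^ n := by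
  have hP := differentiableOn_tsum_pow (a := fun n => iteratedDeriv n f s / n.factorial)
    (C := A) (s : ℂ) hr fun n => by
      rw [norm_div, Complex.norm_natCast, div_le_iff₀ (by positivity)]
      refine (hA n s).trans (le_of_eq (by ring))
  set P : ℂ → ℂ := fun z => ∑' n, (iteratedDeriv n f s / n.factorial) * (z - s) ^ n with hPdef
  obtain ⟨ρ, hρ, g, hg, hfg⟩ := (hf s).exists_holomorphic_extension
  have hnear : f =ᶠ[𝓝 s] fun x : ℝ => P x := by
    filter_upwards [Metric.ball_mem_nhds s hρ] with y hy
    have hy' : |y - s| < ρ := hy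
    have hyb : (y : ℂ) ∈ Metric.ball (s : ℂ) ρ := by
      rw [Metric.mem_ball, Complex.dist_eq, ← Complex.ofReal_sub, Complex.norm_real]; exact hy'
    rw [hfg y hy', ← (Complex.hasSum_taylorSeries_on_ball hg hyb).tsum_eq, hPdef]
    refine tsum_congr fun n => ?_
    rw [← iteratedDeriv_comp_ofReal Metric.isOpen_ball n hg s (Metric.mem_ball_self hρ)]
    have : iteratedDeriv n (fun x : ℝ => g x) s = iteratedDeriv n f s := by
      apply Filter.EventuallyEq.iteratedDeriv_eq
      filter_upwards [Metric.ball_mem_nhds s hρ] with t ht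
      exact (hfg t ht).symm
    rw [this, smul_eq_mul, smul_eq_mul]
    ring
  have hPan : AnalyticOnNhd ℝ (fun x : ℝ => P x) (Metric.ball s r) := by
    intro y hy
    have hyb : (y : ℂ) ∈ Metric.ball (s : ℂ) r := by
      rw [Metric.mem_ball, Complex.dist_eq, ← Complex.ofReal_sub, Complex.norm_real]; exact hy
    have h1 : AnalyticAt ℂ P y := hP.analyticAt (Metric.isOpen_ball.mem_nhds hyb)
    exact (h1.restrictScalars (𝕜 := ℝ)).comp (Complex.ofRealCLM.analyticAt y)
  exact (AnalyticOnNhd.eqOn_of_preconnected_of_eventuallyEq (fun y _ => hf y) hPan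
    (convex_ball s r).isPreconnected (Metric.mem_ball_self hr) hnear) hx

/-- A function on the real line satisfying uniform Cauchy bounds extends to a strip. -/
theorem exists_strip_extension {f : ℝ → ℂ} {A r : ℝ} (hr : 0 < r) (hf : ∀ s, AnalyticAt ℝ f s)
    (hA : ∀ (k : ℕ) s, ‖iteratedDeriv k f s‖ ≤ A * k.factorial / r ^ k) :
    ∃ F : ℂ → ℂ, DifferentiableOn ℂ F {t | |t.im| < r} ∧ (∀ s : ℝ, F s = f s) ∧
      (∀ t : ℂ, |t.im| ≤ r / 2 → ‖F t‖ ≤ 2 * A) ∧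
      ∀ l : ℝ, Function.Periodic f l → ∀ t : ℂ, F (t + l) = F t := by
  set a : ℝ → ℕ → ℂ := fun s n => iteratedDeriv n f s / n.factorial with ha
  have hab : ∀ s n, ‖a s n‖ ≤ A / r ^ n := fun s n => by
    rw [ha, norm_div, Complex.norm_natCast, div_le_iff₀ (by positivity)]
    exact (hA n s).trans (le_of_eq (by ring))
  have hA0 : 0 ≤ A := by simpa using (norm_nonneg _).trans (hab 0 0)
  refine ⟨fun t => ∑' n, a t.re n * (t - t.re) ^ n, ?_, fun s => ?_, fun t ht => ?_,
    fun l hl t => ?_⟩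
  · intro t ht
    have ht' : |t.im| < r := ht
    set s := t.re with hs
    have hP := differentiableOn_tsum_pow (s : ℂ) hr (hab s)
    set P : ℂ → ℂ := fun z => ∑' n, a s n * (z - s) ^ n with hPdef
    have htb : t ∈ Metric.ball (s : ℂ) r := by
      rw [Metric.mem_ball, Complex.dist_eq, hs]
      have : t - (t.re : ℂ) = t.im * Complex.I := by
        rw [sub_eq_iff_eq_add, add_comm]; exact (Complex.re_add_im t).symm
      rw [this]; simpa using ht'
    have hev : (fun t : ℂ => ∑' n, a t.re n * (t - t.re) ^ n) =ᶠ[𝓝 t] P := by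
      have hO : IsOpen {w : ℂ | |w.im| < r - |w.re - s|} := isOpen_lt
        (by fun_prop) (by fun_prop)
      filter_upwards [hO.mem_nhds (show |t.im| < r - |t.re - s| by simpa [hs] using ht')]
        with w hw
      have hw' : |w.im| < r - |w.re - s| := hw
      have hwre : |w.re - s| < r := by linarith [abs_nonneg w.im]
      have hsub : Metric.ball (w.re : ℂ) (r - |w.re - s|) ⊆ Metric.ball (s : ℂ) r := by
        refine Metric.ball_subset_ball' ?_
        rw [Complex.dist_eq, ← Complex.ofReal_sub, Complex.norm_real, Real.norm_eq_abs]
        linarith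
      have hwb : w ∈ Metric.ball (w.re : ℂ) (r - |w.re - s|) := by
        rw [Metric.mem_ball, Complex.dist_eq]
        have : w - (w.re : ℂ) = w.im * Complex.I := by
          rw [sub_eq_iff_eq_add, add_comm]; exact (Complex.re_add_im w).symm
        rw [this]; simpa using hw'
      have h1 := (Complex.hasSum_taylorSeries_on_ball (hP.mono hsub) hwb).tsum_eq
      rw [← h1]
      refine tsum_congr fun n => ?_
      have hwmem : (w.re : ℂ) ∈ Metric.ball (s : ℂ) r := by
        rw [Metric.mem_ball, Complex.dist_eq, ← Complex.ofReal_sub, Complex.norm_real]; exact hwre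
      rw [← iteratedDeriv_comp_ofReal Metric.isOpen_ball n hP w.re hwmem]
      have : iteratedDeriv n (fun x : ℝ => P x) w.re = iteratedDeriv n f w.re := by
        apply Filter.EventuallyEq.iteratedDeriv_eq
        filter_upwards [Metric.isOpen_ball.mem_nhds (show w.re ∈ Metric.ball s r from hwre)]
          with y hy
        exact (eqOn_taylor_ofReal hr hf hA s y hy).symm
      rw [this, smul_eq_mul, smul_eq_mul, ha]
      ring
    exact ((hP.differentiableAt (Metric.isOpen_ball.mem_nhds htb)).congr_of_eventuallyEq
      hev).differentiableWithinAt
  · simp only [Complex.ofReal_re, sub_self]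
    rw [tsum_eq_single 0 (fun n hn => by simp [hn])]
    simp [ha]
  · have hsub : t - (t.re : ℂ) = t.im * Complex.I := by
      rw [sub_eq_iff_eq_add, add_comm]; exact (Complex.re_add_im t).symm
    have hterm : ∀ n, ‖a t.re n * (t - t.re) ^ n‖ ≤ A * (1 / 2) ^ n := fun n => by
      rw [norm_mul, norm_pow, hsub]
      calc ‖a t.re n‖ * ‖(t.im : ℂ) * Complex.I‖ ^ n ≤ (A / r ^ n) * (r / 2) ^ n := by
            gcongr
            · exact hab _ _
            · simpa using ht
        _ = A * (1 / 2) ^ n := by rw [div_pow, div_pow]; field_simp; simp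
    have := tsum_of_norm_bounded (hasSum_geometric_two.mul_left A) hterm
    linarith
  · have : ∀ n, iteratedDeriv n f (t.re + l) = iteratedDeriv n f t.re := fun n => by
      have h1 := congrFun (iteratedDeriv_comp_add_const n f l) t.re
      have h2 : (fun z => f (z + l)) = f := funext hl
      simp only [h2] at h1
      exact h1.symm
    simp only [ha, Complex.add_re, Complex.ofReal_re, this]
    refine tsum_congr fun n => ?_
    push_cast
    ring

lemma mem_ball_ofReal {x s ρ : ℝ} : (x : ℂ) ∈ Metric.ball (s : ℂ) ρ ↔ |x - s| < ρ := by
  rw [Metric.mem_ball, Complex.dist_eq, ← Complex.ofReal_sub, Complex.norm_real, Real.norm_eq_abs]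

/-- A periodic real-analytic function satisfies uniform Cauchy bounds. -/
lemma exists_cauchy_bounds {f : ℝ → ℂ} {l : ℝ} (hl : 0 < l) (hf : ∀ s, AnalyticAt ℝ f s)
    (hp : Function.Periodic f l) :
    ∃ A r : ℝ, 0 < r ∧ ∀ (k : ℕ) s, ‖iteratedDeriv k f s‖ ≤ A * k.factorial / r ^ k := by
  have hloc : ∃ A r : ℝ, 0 < r ∧ ∀ s ∈ Set.Icc 0 l, ∀ k : ℕ,
      ‖iteratedDeriv k f s‖ ≤ A * k.factorial / r ^ k := by
    refine isCompact_Icc.induction_on (p := fun S : Set ℝ => ∃ A r : ℝ, 0 < r ∧ ∀ s ∈ S, ∀ k : ℕ,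
      ‖iteratedDeriv k f s‖ ≤ A * k.factorial / r ^ k) ⟨0, 1, one_pos, by simp⟩ ?_ ?_ ?_
    · rintro S T hST ⟨A, r, hr, h⟩
      exact ⟨A, r, hr, fun s hs => h s (hST hs)⟩
    · rintro S T ⟨A, r, hr, h⟩ ⟨A', r', hr', h'⟩
      have key : ∀ {a b x y : ℝ} (k : ℕ), 0 ≤ a * k.factorial / x ^ k → a ≤ b → 0 < y → y ≤ x →
          a * k.factorial / x ^ k ≤ b * k.factorial / y ^ k := by
        intro a b x y k h0 hab hy hyx
        have hx : 0 < x := hy.trans_le hyx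
        have hk : (0 : ℝ) < k.factorial := by positivity
        have ha : 0 ≤ a := by
          by_contra hneg
          push Not at hneg
          have : a * k.factorial / x ^ k < 0 :=
            div_neg_of_neg_of_pos (mul_neg_of_neg_of_pos hneg hk) (by positivity)
          linarith
        have hb : 0 ≤ b := ha.trans hab
        gcongr
      refine ⟨max A A', min r r', lt_min hr hr', fun s hs k => ?_⟩
      rcases hs with hs | hs
      · exact (h s hs k).trans (key k ((norm_nonneg _).trans (h s hs k)) (le_max_left _ _)
          (lt_min hr hr') (min_le_left _ _))
      · exact (h' s hs k).trans (key k ((norm_nonneg _).trans (h' s hs k)) (le_max_right _ _)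
          (lt_min hr hr') (min_le_right _ _))
    · intro s _
      obtain ⟨ρ, hρ, g, hg, hfg⟩ := (hf s).exists_holomorphic_extension
      have hsub : Metric.closedBall (s : ℂ) (ρ / 2) ⊆ Metric.ball (s : ℂ) ρ :=
        Metric.closedBall_subset_ball (by linarith)
      obtain ⟨C, hC⟩ := (isCompact_closedBall (s : ℂ) (ρ / 2)).exists_bound_of_continuousOn
        (hg.continuousOn.mono hsub)
      refine ⟨Metric.ball s (ρ / 4), mem_nhdsWithin_of_mem_nhds (Metric.ball_mem_nhds _ (by linarith)),
        C, ρ / 4, by linarith, fun x hx k => ?_⟩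
      have hx' : |x - s| < ρ / 4 := hx
      have hxb : (x : ℂ) ∈ Metric.ball (s : ℂ) (ρ / 4) := mem_ball_ofReal.2 hx'
      have hcb : Metric.closedBall (x : ℂ) (ρ / 4) ⊆ Metric.closedBall (s : ℂ) (ρ / 2) := by
        refine Metric.closedBall_subset_closedBall' ?_
        rw [Metric.mem_ball] at hxb
        linarith
      have e : iteratedDeriv k f x = iteratedDeriv k g x := by
        rw [← iteratedDeriv_comp_ofReal Metric.isOpen_ball k hg x (mem_ball_ofReal.2 (by linarith))]
        apply Filter.EventuallyEq.iteratedDeriv_eq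
        filter_upwards [Metric.isOpen_ball.mem_nhds (show x ∈ Metric.ball s ρ from
          Metric.ball_subset_ball (by linarith) hx)] with t ht
        exact hfg t ht
      rw [e]
      refine (Complex.norm_iteratedDeriv_le_of_forall_mem_sphere_norm_le k (by linarith)
        (hg.diffContOnCl_ball (hcb.trans hsub))
        (fun z hz => hC z (hcb (Metric.sphere_subset_closedBall hz)))).trans
        (le_of_eq (by ring))
  obtain ⟨A, r, hr, h⟩ := hloc
  refine ⟨A, r, hr, fun k s => ?_⟩
  obtain ⟨y, hy, he⟩ : ∃ y ∈ Set.Ico 0 l, iteratedDeriv k f s = iteratedDeriv k f y := by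
    have hpk : Function.Periodic (iteratedDeriv k f) l := fun t => by
      have h1 := congrFun (iteratedDeriv_comp_add_const k f l) t
      rw [show (fun z => f (z + l)) = f from funext hp] at h1
      exact h1.symm
    exact hpk.exists_mem_Ico₀ hl s
  rw [he]
  exact h y ⟨hy.1, hy.2.le⟩ k

lemma norm_iteratedDeriv_ofReal {f : ℝ → ℝ} {x : ℝ} (hf : AnalyticAt ℝ f x) (k : ℕ) :
    ‖iteratedDeriv k (fun x => (f x : ℂ)) x‖ = |iteratedDeriv k f x| := by
  rw [← norm_iteratedFDeriv_eq_norm_iteratedDeriv, ← Real.norm_eq_abs,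
    ← norm_iteratedFDeriv_eq_norm_iteratedDeriv]
  exact Complex.ofRealLI.norm_iteratedFDeriv_comp_left (f := f) (n := k) hf.contDiffAt le_rfl

lemma isOpen_strip (r : ℝ) : IsOpen {t : ℂ | |t.im| < r} :=
  isOpen_lt (by fun_prop) continuous_const

lemma closedBall_subset_strip {t : ℂ} {d r : ℝ} (h : |t.im| + d < r) :
    Metric.closedBall t d ⊆ {t : ℂ | |t.im| < r} := by
  intro w hw
  rw [Metric.mem_closedBall, Complex.dist_eq] at hw
  have h1 := Complex.abs_im_le_norm (w - t)
  rw [Complex.sub_im] at h1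
  have h2 : |w.im| ≤ |w.im - t.im| + |t.im| := by
    simpa using abs_add_le (w.im - t.im) t.im
  show |w.im| < r
  linarith

lemma norm_deriv_le_of_strip {F : ℂ → ℂ} {r B d : ℝ} (hF : DifferentiableOn ℂ F {t | |t.im| < r})
    (hB : ∀ t : ℂ, |t.im| < r → ‖F t‖ ≤ B) (hd : 0 < d) {t : ℂ} (ht : |t.im| + d < r) :
    ‖deriv F t‖ ≤ B / d :=
  Complex.norm_deriv_le_of_forall_mem_sphere_norm_le hd
    (hF.diffContOnCl_ball (closedBall_subset_strip ht))
    fun _ hz => hB _ (closedBall_subset_strip ht (Metric.sphere_subset_closedBall hz))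

lemma analyticAt_norm_sq {D : ℂ → ℂ} {z : ℂ} (hD : AnalyticAt ℂ D z) :
    AnalyticAt ℝ (fun z => ‖D z‖ ^ 2) z := by
  have h := hD.restrictScalars (𝕜 := ℝ)
  have h1 : AnalyticAt ℝ (fun z => (D z).re) z := (Complex.reCLM.analyticAt _).comp h
  have h2 : AnalyticAt ℝ (fun z => (D z).im) z := (Complex.imCLM.analyticAt _).comp h
  have : (fun z => ‖D z‖ ^ 2) = fun z => (D z).re * (D z).re + (D z).im * (D z).im := by
    ext w; rw [← Complex.normSq_eq_norm_sq, Complex.normSq_apply]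
  rw [this]
  exact (h1.mul h1).add (h2.mul h2)

/-- Derivative bounds for the squared modulus of a bounded holomorphic function on a strip. -/
lemma abs_dRe_iterate_norm_sq_le {D : ℂ → ℂ} {r B d : ℝ}
    (hD : DifferentiableOn ℂ D {t | |t.im| < r}) (hB : ∀ t : ℂ, |t.im| < r → ‖D t‖ ≤ B)
    (hd : 0 < d) {z : ℂ} (hz : |z.im| + d < r) (j : ℕ) :
    |dRe^[j] (fun z => ‖D z‖ ^ 2) z| ≤ B ^ 2 * j.factorial / d ^ j := by
  obtain ⟨x, y⟩ := z
  have hy : |y| + d < r := hz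
  have hB0 : 0 ≤ B := (norm_nonneg _).trans (hB ⟨x, y⟩ (by show |y| < r; linarith))
  have han : ∀ x : ℝ, AnalyticAt ℝ (fun z => ‖D z‖ ^ 2) (⟨x, y⟩ : ℂ) := fun x =>
    analyticAt_norm_sq (hD.analyticAt ((isOpen_strip r).mem_nhds
      (show |y| < r by linarith)))
  rw [dRe_iterate_eq_iteratedDeriv j han]
  have hslice : ∀ x : ℝ, AnalyticAt ℝ (fun x : ℝ => ‖D ⟨x, y⟩‖ ^ 2) x := fun x => by
    have h2 : AnalyticAt ℝ (fun x : ℝ => (⟨x, y⟩ : ℂ)) x := by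
      have : (fun x : ℝ => (⟨x, y⟩ : ℂ)) = fun x : ℝ => (x : ℂ) + y * Complex.I := by
        ext x; exact Complex.mk_eq_add_mul_I x y
      rw [this]
      exact (Complex.ofRealCLM.analyticAt x).add analyticAt_const
    exact (han x).fun_comp (f := fun x : ℝ => (⟨x, y⟩ : ℂ)) h2
  rw [← norm_iteratedDeriv_ofReal (hslice x)]
  set G : ℂ → ℂ := fun t => D (t + y * Complex.I) *
    (starRingEnd ℂ) (D ((starRingEnd ℂ) (t - y * Complex.I))) with hG
  have him1 : ∀ t : ℂ, |t.im| + |y| < r → |(t + y * Complex.I).im| < r := fun t ht => by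
    have : (t + y * Complex.I).im = t.im + y := by simp
    rw [this]; exact (abs_add_le _ _).trans_lt ht
  have him2 : ∀ t : ℂ, |t.im| + |y| < r → |((starRingEnd ℂ) (t - y * Complex.I)).im| < r :=
    fun t ht => by
      have : ((starRingEnd ℂ) (t - y * Complex.I)).im = -(t.im - y) := by simp; ring
      rw [this, abs_neg]; exact (abs_sub _ _).trans_lt ht
  have hGd : DifferentiableOn ℂ G {t | |t.im| < r - |y|} := by
    intro t ht
    have ht' : |t.im| + |y| < r := by have : |t.im| < r - |y| := ht; linarith
    have h1 : DifferentiableAt ℂ D (t + y * Complex.I) :=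
      hD.differentiableAt ((isOpen_strip r).mem_nhds (him1 t ht'))
    have h2 : DifferentiableAt ℂ D ((starRingEnd ℂ) (t - y * Complex.I)) :=
      hD.differentiableAt ((isOpen_strip r).mem_nhds (him2 t ht'))
    have h3 := h2.conj_conj
    rw [Complex.conj_conj] at h3
    refine DifferentiableAt.differentiableWithinAt (DifferentiableAt.fun_mul ?_ ?_)
    · exact h1.comp t (by fun_prop)
    · exact DifferentiableAt.comp (g := (starRingEnd ℂ) ∘ D ∘ (starRingEnd ℂ))
        (f := fun t => t - y * Complex.I) t h3 (by fun_prop)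
  have hGr : (fun x : ℝ => ((‖D ⟨x, y⟩‖ ^ 2 : ℝ) : ℂ)) = fun x : ℝ => G x := by
    ext x
    have e1 : (x : ℂ) + y * Complex.I = ⟨x, y⟩ := (Complex.mk_eq_add_mul_I x y).symm
    have e2 : (starRingEnd ℂ) ((x : ℂ) - y * Complex.I) = ⟨x, y⟩ := by
      rw [← e1]; simp
    rw [hG]
    simp only
    rw [e1, e2, Complex.mul_conj, Complex.normSq_eq_norm_sq]
  rw [hGr, iteratedDeriv_comp_ofReal (isOpen_strip (r - |y|)) j hGd x
    (by show |((x : ℂ)).im| < r - |y|; simp; linarith)]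
  have hcb : Metric.closedBall (x : ℂ) d ⊆ {t | |t.im| < r - |y|} :=
    closedBall_subset_strip (by simp; linarith)
  refine (Complex.norm_iteratedDeriv_le_of_forall_mem_sphere_norm_le j hd
    (hGd.diffContOnCl_ball hcb) (C := B ^ 2) fun w hw => ?_).trans
    (le_of_eq (by ring))
  have hw' : |w.im| + |y| < r := by
    have : |w.im| < r - |y| := hcb (Metric.sphere_subset_closedBall hw)
    linarith
  rw [hG]
  simp only [norm_mul, RCLike.norm_conj]
  rw [sq]
  exact mul_le_mul (hB _ (him1 w hw')) (hB _ (him2 w hw')) (norm_nonneg _) hB0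

section ChainRule

variable {Φ : ℂ → ℝ} {Q : ℂ → ℂ} {z : ℂ}

lemma fderiv_apply_eq (Φ : ℂ → ℝ) (z w : ℂ) :
    fderiv ℝ Φ z w = w.re * dRe Φ z + w.im * dIm Φ z := by
  have : w = w.re • (1 : ℂ) + w.im • Complex.I := by
    simp [Complex.re_add_im]
  conv_lhs => rw [this]
  rw [map_add, map_smul, map_smul]
  rfl

lemma dRe_comp (hΦ : DifferentiableAt ℝ Φ (Q z)) (hQ : DifferentiableAt ℂ Q z) :
    dRe (fun w => Φ (Q w)) z = (deriv Q z).re * dRe Φ (Q z) + (deriv Q z).im * dIm Φ (Q z) := by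
  have h := (hΦ.hasFDerivAt.comp z hQ.hasDerivAt.complexToReal_fderiv).fderiv
  unfold dRe
  rw [show (fun w => Φ (Q w)) = Φ ∘ Q from rfl, h]
  simp [fderiv_apply_eq]

lemma dIm_comp (hΦ : DifferentiableAt ℝ Φ (Q z)) (hQ : DifferentiableAt ℂ Q z) :
    dIm (fun w => Φ (Q w)) z = -(deriv Q z).im * dRe Φ (Q z) + (deriv Q z).re * dIm Φ (Q z) := by
  have h := (hΦ.hasFDerivAt.comp z hQ.hasDerivAt.complexToReal_fderiv).fderiv
  unfold dIm
  rw [show (fun w => Φ (Q w)) = Φ ∘ Q from rfl, h]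
  simp [fderiv_apply_eq]

lemma dRe_mul {u v : ℂ → ℝ} (hu : DifferentiableAt ℝ u z) (hv : DifferentiableAt ℝ v z) :
    dRe (fun w => u w * v w) z = u z * dRe v z + v z * dRe u z := by
  unfold dRe; rw [fderiv_fun_mul hu hv]; rfl

lemma dIm_mul {u v : ℂ → ℝ} (hu : DifferentiableAt ℝ u z) (hv : DifferentiableAt ℝ v z) :
    dIm (fun w => u w * v w) z = u z * dIm v z + v z * dIm u z := by
  unfold dIm; rw [fderiv_fun_mul hu hv]; rfl

lemma dIm_add {u v : ℂ → ℝ} (hu : DifferentiableAt ℝ u z) (hv : DifferentiableAt ℝ v z) :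
    dIm (fun w => u w + v w) z = dIm u z + dIm v z := by
  unfold dIm; rw [fderiv_fun_add hu hv]; rfl

lemma dIm_neg {u : ℂ → ℝ} : dIm (fun w => -u w) z = -dIm u z := by
  unfold dIm; rw [fderiv_fun_neg]; rfl

lemma hasFDerivAt_re_im_deriv (hQ : AnalyticAt ℂ Q z) :
    (HasFDerivAt (fun w => (deriv Q w).re)
      (Complex.reCLM.comp ((deriv (deriv Q) z) • (1 : ℂ →L[ℝ] ℂ))) z) ∧
    (HasFDerivAt (fun w => (deriv Q w).im)
      (Complex.imCLM.comp ((deriv (deriv Q) z) • (1 : ℂ →L[ℝ] ℂ))) z) := by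
  have h := hQ.deriv.differentiableAt.hasDerivAt.complexToReal_fderiv
  exact ⟨Complex.reCLM.hasFDerivAt.comp z h, Complex.imCLM.hasFDerivAt.comp z h⟩

/-- Conformal covariance of the Laplacian. -/
theorem lapC_comp (hΦ : AnalyticAt ℝ Φ (Q z)) (hQ : AnalyticAt ℂ Q z) :
    lapC (fun w => Φ (Q w)) z = ‖deriv Q z‖ ^ 2 * lapC Φ (Q z) := by
  have hev : ∀ᶠ w in 𝓝 z, AnalyticAt ℝ Φ (Q w) ∧ AnalyticAt ℂ Q w :=
    (hQ.continuousAt.eventually hΦ.eventually_analyticAt).and hQ.eventually_analyticAt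
  have e1 : dRe (fun w => Φ (Q w)) =ᶠ[𝓝 z]
      fun w => (deriv Q w).re * dRe Φ (Q w) + (deriv Q w).im * dIm Φ (Q w) := by
    filter_upwards [hev] with w hw
    exact dRe_comp hw.1.differentiableAt hw.2.differentiableAt
  have e2 : dIm (fun w => Φ (Q w)) =ᶠ[𝓝 z]
      fun w => -((deriv Q w).im) * dRe Φ (Q w) + (deriv Q w).re * dIm Φ (Q w) := by
    filter_upwards [hev] with w hw
    exact dIm_comp hw.1.differentiableAt hw.2.differentiableAt
  obtain ⟨ha, hb⟩ := hasFDerivAt_re_im_deriv hQ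
  have hR := (analyticAt_dRe hΦ).differentiableAt
  have hI := (analyticAt_dIm hΦ).differentiableAt
  have hq := hQ.differentiableAt
  have hqr : DifferentiableAt ℝ Q z := hq.restrictScalars ℝ
  have hRQ : DifferentiableAt ℝ (fun w => dRe Φ (Q w)) z := hR.comp z hqr
  have hIQ : DifferentiableAt ℝ (fun w => dIm Φ (Q w)) z := hI.comp z hqr
  have a1 : dRe (fun w => (deriv Q w).re) z = (deriv (deriv Q) z).re := by
    unfold dRe; rw [ha.fderiv]; simp
  have a2 : dIm (fun w => (deriv Q w).re) z = -(deriv (deriv Q) z).im := by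
    unfold dIm; rw [ha.fderiv]; simp
  have b1 : dRe (fun w => (deriv Q w).im) z = (deriv (deriv Q) z).im := by
    unfold dRe; rw [hb.fderiv]; simp
  have b2 : dIm (fun w => (deriv Q w).im) z = (deriv (deriv Q) z).re := by
    unfold dIm; rw [hb.fderiv]; simp
  have hn : ‖deriv Q z‖ ^ 2 = (deriv Q z).re * (deriv Q z).re + (deriv Q z).im * (deriv Q z).im := by
    rw [← Complex.normSq_eq_norm_sq, Complex.normSq_apply]
  unfold lapC
  rw [dRe_congr e1, dIm_congr e2,
    dRe_add (ha.differentiableAt.fun_mul hRQ) (hb.differentiableAt.fun_mul hIQ),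
    dIm_add (hb.differentiableAt.fun_neg.fun_mul hRQ) (ha.differentiableAt.fun_mul hIQ),
    dRe_mul ha.differentiableAt hRQ, dRe_mul hb.differentiableAt hIQ,
    dIm_mul hb.differentiableAt.fun_neg hRQ, dIm_mul ha.differentiableAt hIQ, dIm_neg,
    dRe_comp hR hq, dRe_comp hI hq, dIm_comp hR hq, dIm_comp hI hq, a1, a2, b1, b2, hn]
  ring

end ChainRule

/-- Points of a simple closed curve that are close in the plane have close parameters. -/
lemma exists_param_close {p : ℝ → ℂ} {l : ℝ} (hl : 0 < l) (hc : Continuous p)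
    (hp : Function.Periodic p l) (hi : Set.InjOn p (Set.Ico 0 l)) {η : ℝ} (hη : 0 < η) :
    ∃ κ > 0, ∀ s s' : ℝ, ‖p s - p s'‖ < κ → ∃ k : ℤ, |s - (s' + k * l)| < η := by
  set K : Set (ℝ × ℝ) := (Set.Icc 0 l ×ˢ Set.Icc 0 l) ∩
    ⋂ k : ℤ, {x : ℝ × ℝ | η ≤ |x.1 - (x.2 + k * l)|} with hK
  have hKc : IsCompact K := (isCompact_Icc.prod isCompact_Icc).inter_right
    (isClosed_iInter fun k => isClosed_le (by fun_prop) (by fun_prop))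
  have hpos : ∀ x ∈ K, 0 < ‖p x.1 - p x.2‖ := by
    rintro ⟨a, b⟩ ⟨-, hx⟩
    rw [norm_pos_iff, sub_ne_zero]
    intro hab
    simp only at hab
    rw [← hp.sub_zsmul_eq (toIcoDiv hl 0 a), ← hp.sub_zsmul_eq (x := b) (toIcoDiv hl 0 b),
      self_sub_toIcoDiv_zsmul, self_sub_toIcoDiv_zsmul] at hab
    have h := hi (toIcoMod_mem_Ico' hl a) (toIcoMod_mem_Ico' hl b) hab
    rw [← self_sub_toIcoDiv_zsmul, ← self_sub_toIcoDiv_zsmul, zsmul_eq_mul, zsmul_eq_mul] at h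
    have hx' := Set.mem_iInter.1 hx (toIcoDiv hl 0 a - toIcoDiv hl 0 b)
    simp only [Set.mem_ofPred_eq] at hx'
    rw [show a - (b + ((toIcoDiv hl 0 a - toIcoDiv hl 0 b : ℤ) : ℝ) * l) = 0 by
      push_cast; linarith, abs_zero] at hx'
    linarith
  obtain ⟨κ, hκ, hκK⟩ : ∃ κ > 0, ∀ x ∈ K, κ ≤ ‖p x.1 - p x.2‖ := by
    rcases K.eq_empty_or_nonempty with h | h
    · exact ⟨1, one_pos, by simp [h]⟩
    · obtain ⟨x, hx, hmin⟩ := hKc.exists_isMinOn h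
        (f := fun x => ‖p x.1 - p x.2‖) (by fun_prop)
      exact ⟨_, hpos x hx, fun y hy => hmin hy⟩
  refine ⟨κ, hκ, fun s s' hss => ?_⟩
  by_contra hcon
  push Not at hcon
  have hmem : (toIcoMod hl 0 s, toIcoMod hl 0 s') ∈ K := by
    refine ⟨⟨Set.Ico_subset_Icc_self (toIcoMod_mem_Ico' hl s),
      Set.Ico_subset_Icc_self (toIcoMod_mem_Ico' hl s')⟩, Set.mem_iInter.2 fun k => ?_⟩
    have := hcon (k + toIcoDiv hl 0 s - toIcoDiv hl 0 s')
    simp only [Set.mem_ofPred_eq]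
    rw [← self_sub_toIcoDiv_zsmul, ← self_sub_toIcoDiv_zsmul, zsmul_eq_mul, zsmul_eq_mul]
    push_cast at this
    refine this.trans (le_of_eq ?_)
    congr 1
    ring
  have h := hκK _ hmem
  simp only at h
  rw [← self_sub_toIcoDiv_zsmul, ← self_sub_toIcoDiv_zsmul, hp.sub_zsmul_eq, hp.sub_zsmul_eq] at h
  linarith

/-- A bounded plane domain together with a periodic holomorphic extension `Q` to a strip of a
unit-speed parametrization of its frontier. -/
structure BoundaryStrip (W : Set ℂ) (Q : ℂ → ℂ) (l r B : ℝ) : Prop where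
  isOpen : IsOpen W
  isBounded : Bornology.IsBounded W
  nonempty : W.Nonempty
  l_pos : 0 < l
  r_pos : 0 < r
  holo : DifferentiableOn ℂ Q {t | |t.im| < r}
  bound : ∀ t : ℂ, |t.im| < r → ‖Q t‖ ≤ B
  periodic : ∀ t : ℂ, Q (t + l) = Q t
  norm_deriv : ∀ s : ℝ, ‖deriv Q s‖ = 1
  frontier_eq : frontier W = Set.range fun s : ℝ => Q s

namespace BoundaryStrip

variable {W : Set ℂ} {Q : ℂ → ℂ} {l r B : ℝ}

lemma analyticAt (h : BoundaryStrip W Q l r B) {t : ℂ} (ht : |t.im| < r) : AnalyticAt ℂ Q t :=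
  h.holo.analyticAt ((isOpen_strip r).mem_nhds ht)

lemma B_nonneg (h : BoundaryStrip W Q l r B) : 0 ≤ B :=
  (norm_nonneg _).trans (h.bound 0 (by simpa using h.r_pos))

lemma ofReal_mem (h : BoundaryStrip W Q l r B) (s : ℝ) : Q s ∈ frontier W := by
  rw [h.frontier_eq]; exact ⟨s, rfl⟩

lemma abs_im_le_norm_sub (t : ℂ) (s : ℝ) : |t.im| ≤ ‖t - s‖ := by
  simpa using Complex.abs_im_le_norm (t - s)

lemma continuous_ofReal (h : BoundaryStrip W Q l r B) : Continuous fun s : ℝ => Q s := by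
  rw [continuous_iff_continuousAt]
  intro s
  exact ContinuousAt.comp (f := Complex.ofReal) (g := Q)
    (h.analyticAt (by simpa using h.r_pos)).continuousAt Complex.continuous_ofReal.continuousAt

/-- Second-order Taylor expansion of the extension, uniformly along the boundary. -/
lemma exists_taylor (h : BoundaryStrip W Q l r B) : ∃ C > 0, ∀ (s : ℝ) (t : ℂ), ‖t - s‖ ≤ r / 4 →
    ‖Q t - Q s - deriv Q s * (t - s)‖ ≤ C * ‖t - s‖ ^ 2 := by
  have hr := h.r_pos
  set K : ℝ := B / (r / 4) / (r / 4) with hK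
  have hK0 : 0 ≤ K := by have := h.B_nonneg; positivity
  have h1 : ∀ t : ℂ, |t.im| < 3 * r / 4 → ‖deriv Q t‖ ≤ B / (r / 4) := fun t ht =>
    norm_deriv_le_of_strip h.holo h.bound (by positivity) (by linarith)
  have h2 : ∀ t : ℂ, |t.im| < r / 2 → ‖deriv (deriv Q) t‖ ≤ K := fun t ht =>
    norm_deriv_le_of_strip (r := 3 * r / 4)
      ((h.holo.deriv (isOpen_strip r)).mono fun t (ht : |t.im| < 3 * r / 4) => by
        show |t.im| < r; linarith) h1 (by positivity) (by linarith)
  refine ⟨K + 1, by positivity, fun s t ht => ?_⟩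
  set R := ‖t - s‖ with hR
  have him : ∀ w ∈ Metric.closedBall (s : ℂ) R, |w.im| < r / 2 := fun w hw => by
    have := abs_im_le_norm_sub w s
    rw [Metric.mem_closedBall, Complex.dist_eq] at hw
    linarith
  have hs : (s : ℂ) ∈ Metric.closedBall (s : ℂ) R := Metric.mem_closedBall_self (norm_nonneg _)
  have htm : t ∈ Metric.closedBall (s : ℂ) R := by
    rw [Metric.mem_closedBall, Complex.dist_eq]
  have h3 : ∀ w ∈ Metric.closedBall (s : ℂ) R, ‖deriv Q w - deriv Q s‖ ≤ K * R := fun w hw => by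
    have := Convex.norm_image_sub_le_of_norm_deriv_le (f := deriv Q) (C := K)
      (fun x hx => (h.analyticAt (t := x) (by have := him x hx; linarith)).deriv.differentiableAt)
      (fun x hx => h2 x (him x hx)) (convex_closedBall (s : ℂ) R) hs hw
    refine this.trans ?_
    gcongr
    rwa [Metric.mem_closedBall, Complex.dist_eq] at hw
  have hd : ∀ w ∈ Metric.closedBall (s : ℂ) R,
      HasDerivAt (fun w => Q w - deriv Q s * w) (deriv Q w - deriv Q s) w := fun w hw => by
    have h4 := (h.analyticAt (t := w) (by have := him w hw; linarith)).differentiableAt.hasDerivAt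
    simpa using h4.fun_sub ((hasDerivAt_id' w).const_mul (deriv Q s))
  have h5 := (convex_closedBall (s : ℂ) R).norm_image_sub_le_of_norm_hasDerivWithin_le
    (fun w hw => (hd w hw).hasDerivWithinAt) h3 hs htm
  rw [← hR] at h5
  calc _ = ‖Q t - deriv Q s * t - (Q s - deriv Q s * s)‖ := by congr 1; ring
    _ ≤ K * R * R := h5
    _ ≤ (K + 1) * R ^ 2 := by nlinarith [sq_nonneg R]

/-- Near the real axis the extension is a uniform local diffeomorphism. -/
lemma exists_local (h : BoundaryStrip W Q l r B) : ∃ ρ > 0, ρ ≤ r / 4 ∧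
    (∀ (s : ℝ) (t : ℂ), ‖t - s‖ ≤ ρ → ‖t - s‖ ≤ 2 * ‖Q t - Q s‖ ∧ ‖Q t - Q s‖ ≤ 2 * ‖t - s‖) ∧
    ∀ (s : ℝ) (R : ℝ), 0 < R → R ≤ ρ → Metric.ball (Q s) (R / 4) ⊆
      Q '' Metric.closedBall (s : ℂ) R := by
  obtain ⟨C, hC, hT⟩ := h.exists_taylor
  have hr := h.r_pos
  set ρ := min (r / 4) (1 / (2 * C)) with hρ
  have hρ0 : 0 < ρ := by positivity
  have hloc : ∀ (s : ℝ) (t : ℂ), ‖t - s‖ ≤ ρ →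
      ‖t - s‖ ≤ 2 * ‖Q t - Q s‖ ∧ ‖Q t - Q s‖ ≤ 2 * ‖t - s‖ := fun s t ht => by
    have h1 := hT s t (ht.trans (min_le_left _ _))
    have h2 : C * ‖t - s‖ ≤ 1 / 2 := by
      calc C * ‖t - s‖ ≤ C * (1 / (2 * C)) := by gcongr; exact ht.trans (min_le_right _ _)
        _ = 1 / 2 := by field_simp
    have h3 : C * ‖t - s‖ ^ 2 ≤ ‖t - s‖ / 2 := by nlinarith [norm_nonneg (t - s)]
    have h4 : ‖deriv Q s * (t - s)‖ = ‖t - s‖ := by rw [norm_mul, h.norm_deriv, one_mul]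
    have h5 := norm_sub_norm_le (deriv Q s * (t - s)) (Q t - Q s)
    rw [norm_sub_rev (deriv Q s * (t - s)) (Q t - Q s)] at h5
    have h6 := norm_sub_norm_le (Q t - Q s) (deriv Q s * (t - s))
    constructor <;> linarith [norm_nonneg (t - s)]
  refine ⟨ρ, hρ0, min_le_left _ _, hloc, fun s R hR hRρ => ?_⟩
  have hsub : Metric.closedBall (s : ℂ) R ⊆ {t | |t.im| < r} :=
    closedBall_subset_strip (by
      have : ρ ≤ r / 4 := min_le_left _ _
      simp; linarith)
  have e : R / 4 = R / 2 / 2 := by ring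
  rw [e]
  refine (h.holo.diffContOnCl_ball hsub).ball_subset_image_closedBall hR (fun z hz => ?_) ?_
  · rw [mem_sphere_iff_norm] at hz
    have := (hloc s z (by rw [hz]; exact hRρ)).1
    rw [hz] at this
    linarith
  · refine Eventually.frequently (f := 𝓝[≠] (s : ℂ)) ?_ |>.filter_mono nhdsWithin_le_nhds
    filter_upwards [self_mem_nhdsWithin, mem_nhdsWithin_of_mem_nhds
      (Metric.ball_mem_nhds (s : ℂ) hρ0)] with z hz hzb heq
    rw [Metric.mem_ball, Complex.dist_eq] at hzb
    have := (hloc s z hzb.le).1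
    rw [heq, sub_self, norm_zero, mul_zero] at this
    exact hz (sub_eq_zero.1 (norm_le_zero_iff.1 this))

/-- The extension avoids the frontier off the real axis, near the real axis. -/
lemma exists_notMem_frontier (h : BoundaryStrip W Q l r B)
    (hi : Set.InjOn (fun s : ℝ => Q s) (Set.Ico 0 l)) : ∃ δ > 0, δ < r ∧
    ∀ t : ℂ, 0 < |t.im| → |t.im| < δ → Q t ∉ frontier W := by
  obtain ⟨ρ, hρ, hρr, hloc, -⟩ := h.exists_local
  have hper : Function.Periodic (fun s : ℝ => Q s) l := fun s => by
    have := h.periodic s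
    simpa using this
  obtain ⟨κ, hκ, hclose⟩ := exists_param_close h.l_pos h.continuous_ofReal hper hi (half_pos hρ)
  have hr := h.r_pos
  refine ⟨min (ρ / 2) (κ / 2), by positivity, (min_le_left _ _).trans_lt (by linarith),
    fun t ht0 ht hfr => ?_⟩
  rw [h.frontier_eq] at hfr
  obtain ⟨s', hs'⟩ := hfr
  simp only at hs'
  have him : ‖t - (t.re : ℂ)‖ = |t.im| := by
    have : t - (t.re : ℂ) = t.im * Complex.I := by
      rw [sub_eq_iff_eq_add, add_comm]; exact (Complex.re_add_im t).symm
    rw [this]; simp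
  have hρ2 : |t.im| < ρ / 2 := ht.trans_le (min_le_left _ _)
  have hκ2 : |t.im| < κ / 2 := ht.trans_le (min_le_right _ _)
  have h1 := (hloc t.re t (by rw [him]; linarith)).2
  obtain ⟨k, hk⟩ := hclose t.re s' (by
    rw [hs', norm_sub_rev]; rw [him] at h1; linarith)
  have h2 : Q ((s' + k * l : ℝ) : ℂ) = Q t := by
    rw [← hs']
    have := hper.int_mul k s'
    exact this
  have h3 : ‖t - ((s' + k * l : ℝ) : ℂ)‖ ≤ ρ := by
    have e : t - ((s' + k * l : ℝ) : ℂ) = (t - (t.re : ℂ)) + ((t.re - (s' + k * l) : ℝ) : ℂ) := by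
      push_cast; ring
    rw [e]
    refine (norm_add_le _ _).trans ?_
    rw [him, Complex.norm_real, Real.norm_eq_abs]
    linarith
  have h4 := (hloc _ t h3).1
  rw [h2, sub_self, norm_zero, mul_zero] at h4
  have h5 := sub_eq_zero.1 (norm_le_zero_iff.1 h4)
  rw [h5] at ht0
  simp at ht0

lemma subset_or_disjoint (h : BoundaryStrip W Q l r B) {S : Set ℂ} (hS : IsPreconnected S)
    (hSr : S ⊆ {t | |t.im| < r}) (hfr : ∀ t ∈ S, Q t ∉ frontier W) :
    (∀ t ∈ S, Q t ∈ W) ∨ ∀ t ∈ S, Q t ∉ W := by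
  by_cases hne : ∃ t ∈ S, Q t ∈ W
  · left
    obtain ⟨t₀, ht₀, hW⟩ := hne
    have himg : IsPreconnected (Q '' S) := hS.image Q (h.holo.continuousOn.mono hSr)
    have hsub := himg.subset_left_of_subset_union h.isOpen (isClosed_closure (s := W)).isOpen_compl
      (Set.disjoint_compl_right_iff_subset.2 subset_closure) (by
        rintro _ ⟨t, ht, rfl⟩
        by_cases hc : Q t ∈ closure W
        · left
          by_contra hn
          exact hfr t ht (by rw [h.isOpen.frontier_eq]; exact ⟨hc, hn⟩)
        · exact Or.inr hc) ⟨Q t₀, Set.mem_image_of_mem Q ht₀, hW⟩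
    exact fun t ht => hsub (Set.mem_image_of_mem Q ht)
  · right
    exact fun t ht hW => hne ⟨t, ht, hW⟩

end BoundaryStrip

namespace BoundaryStrip

variable {W : Set ℂ} {Q : ℂ → ℂ} {l r B : ℝ}

lemma exists_inward (h : BoundaryStrip W Q l r B) {ν : ℝ → ℂ} (hν : ∀ s, ‖ν s‖ = 1)
    (horth : ∀ s, (ν s * (starRingEnd ℂ) (deriv Q s)).re = 0)
    (hin : ∀ s : ℝ, ∃ δ > 0, ∀ τ ∈ Set.Ioo (0 : ℝ) δ, Q s + τ * ν s ∈ W) {δ : ℝ} (hδ : 0 < δ)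
    (s : ℝ) : ∃ θ : ℝ, (θ = 1 ∨ θ = -1) ∧ ν s = θ * Complex.I * deriv Q s ∧
      ∃ t : ℂ, 0 < θ * t.im ∧ |t.im| < δ ∧ Q t ∈ W := by
  obtain ⟨ρ, hρ, hρr, hloc, hsurj⟩ := h.exists_local
  obtain ⟨C, hC, hT⟩ := h.exists_taylor
  obtain ⟨δ', hδ', hin'⟩ := hin s
  set θ : ℝ := (ν s * (starRingEnd ℂ) (deriv Q s)).im with hθ
  have hD : (starRingEnd ℂ) (deriv Q s) * deriv Q s = 1 := by
    rw [mul_comm, Complex.mul_conj, Complex.normSq_eq_norm_sq, h.norm_deriv]; simp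
  have e1 : ν s * (starRingEnd ℂ) (deriv Q s) = θ * Complex.I :=
    Complex.ext (by rw [horth]; simp) (by rw [hθ]; simp)
  have e2 : ν s = θ * Complex.I * deriv Q s := by
    rw [← e1, mul_assoc, hD, mul_one]
  have hθ1 : |θ| = 1 := by
    have := congrArg norm e1
    rw [norm_mul, hν, RCLike.norm_conj, h.norm_deriv] at this
    simpa using this.symm
  have hθ' : θ = 1 ∨ θ = -1 := by
    rcases abs_choice θ with h1 | h1 <;> rw [hθ1] at h1
    · exact .inl h1.symm
    · right; linarith
  have hθ2 : θ * θ = 1 := by rcases hθ' with h | h <;> rw [h] <;> norm_num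
  refine ⟨θ, hθ', e2, ?_⟩
  set τ : ℝ := min (min (δ' / 2) (ρ / 8)) (min (δ / 4) (1 / (8 * C))) with hτ
  have hτ0 : 0 < τ := by positivity
  have hτ1 : τ ≤ δ' / 2 := (min_le_left _ _).trans (min_le_left _ _)
  have hτ2 : τ ≤ ρ / 8 := (min_le_left _ _).trans (min_le_right _ _)
  have hτ3 : τ ≤ δ / 4 := (min_le_right _ _).trans (min_le_left _ _)
  have hτ4 : τ ≤ 1 / (8 * C) := (min_le_right _ _).trans (min_le_right _ _)
  have hW := hin' τ ⟨hτ0, by linarith⟩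
  have hn : ‖(τ : ℂ) * ν s‖ = τ := by
    rw [norm_mul, hν, mul_one, Complex.norm_real, Real.norm_eq_abs, abs_of_pos hτ0]
  obtain ⟨t, ht, hQt⟩ := hsurj s ρ hρ le_rfl (show Q s + τ * ν s ∈ _ by
    rw [Metric.mem_ball, dist_eq_norm, add_sub_cancel_left, hn]; linarith)
  rw [Metric.mem_closedBall, Complex.dist_eq] at ht
  have h1 := (hloc s t ht).1
  rw [hQt, add_sub_cancel_left, hn] at h1
  have h2 := hT s t (ht.trans hρr)
  rw [hQt, add_sub_cancel_left, e2] at h2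
  have h3 : ‖(τ : ℂ) * (θ * Complex.I * deriv Q s) - deriv Q s * (t - s)‖
      = ‖(τ : ℂ) * θ * Complex.I - (t - s)‖ := by
    rw [show (τ : ℂ) * (θ * Complex.I * deriv Q s) - deriv Q s * (t - s)
      = deriv Q s * ((τ : ℂ) * θ * Complex.I - (t - s)) by ring, norm_mul, h.norm_deriv, one_mul]
  rw [h3] at h2
  have h4 := (Complex.abs_im_le_norm _).trans h2
  have e3 : ((τ : ℂ) * θ * Complex.I - (t - s)).im = τ * θ - t.im := by simp
  rw [e3] at h4
  have h5 : C * ‖t - s‖ ^ 2 ≤ τ / 2 := by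
    calc C * ‖t - s‖ ^ 2 ≤ C * (2 * τ) ^ 2 := by gcongr
      _ = 4 * C * τ * τ := by ring
      _ ≤ 4 * C * (1 / (8 * C)) * τ := by gcongr
      _ = τ / 2 := by field_simp; norm_num
  have h6 := (abs_le.1 (h4.trans h5))
  refine ⟨t, ?_, (abs_im_le_norm_sub t s).trans_lt (by linarith), hQt ▸ hW⟩
  rcases hθ' with h | h <;> rw [h] at h6 ⊢ <;> linarith

/-- Exactly one side of the real axis is mapped into the domain, and the inward normal points to
that side. -/
theorem exists_side (h : BoundaryStrip W Q l r B)
    (hi : Set.InjOn (fun s : ℝ => Q s) (Set.Ico 0 l)) {ν : ℝ → ℂ} (hν : ∀ s, ‖ν s‖ = 1)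
    (horth : ∀ s, (ν s * (starRingEnd ℂ) (deriv Q s)).re = 0)
    (hin : ∀ s : ℝ, ∃ δ > 0, ∀ τ ∈ Set.Ioo (0 : ℝ) δ, Q s + τ * ν s ∈ W) :
    ∃ σ : ℝ, (σ = 1 ∨ σ = -1) ∧ (∀ s, ν s = σ * Complex.I * deriv Q s) ∧
    ∃ δ > 0, δ < r ∧ (∀ t : ℂ, 0 < σ * t.im → |t.im| < δ → Q t ∈ W) ∧
      ∀ t : ℂ, σ * t.im < 0 → |t.im| < δ → Q t ∉ W := by
  obtain ⟨δ, hδ, hδr, hfr⟩ := h.exists_notMem_frontier hi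
  have hside : ∀ σ : ℝ, (σ = 1 ∨ σ = -1) → (∀ t : ℂ, 0 < σ * t.im → |t.im| < δ → Q t ∈ W) ∨
      ∀ t : ℂ, 0 < σ * t.im → |t.im| < δ → Q t ∉ W := by
    intro σ hσ
    have hconv : Convex ℝ ({t : ℂ | 0 < σ * t.im} ∩ {t : ℂ | |t.im| < δ}) := by
      refine Convex.inter ?_ ?_
      · exact (convex_Ioi (𝕜 := ℝ) (β := ℝ) 0).linear_preimage (σ • Complex.imLm)
      · have : {t : ℂ | |t.im| < δ} = Complex.imLm ⁻¹' Set.Ioo (-δ) δ := by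
          ext t
          exact abs_lt (a := t.im) (b := δ)
        rw [this]
        exact (convex_Ioo _ _).linear_preimage _
    rcases h.subset_or_disjoint hconv.isPreconnected
      (fun t ht => lt_trans (show |t.im| < δ from ht.2) hδr) (fun t ht => by
        refine hfr t (abs_pos.2 fun h0 => ?_) ht.2
        have : 0 < σ * t.im := ht.1
        rw [h0, mul_zero] at this
        exact lt_irrefl _ this) with h1 | h1
    · exact .inl fun t a b => h1 t ⟨a, b⟩
    · exact .inr fun t a b => h1 t ⟨a, b⟩
  have hnot : ¬ ∀ t : ℂ, t.im ≠ 0 → |t.im| < δ → Q t ∈ W := by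
    intro hall
    obtain ⟨ρ, hρ, hρr, hloc, hsurj⟩ := h.exists_local
    have hopen : IsOpen (closure W) := by
      rw [isOpen_iff_mem_nhds]
      intro x hx
      by_cases hxW : x ∈ W
      · exact mem_of_superset (h.isOpen.mem_nhds hxW) subset_closure
      · have : x ∈ frontier W := by rw [h.isOpen.frontier_eq]; exact ⟨hx, hxW⟩
        rw [h.frontier_eq] at this
        obtain ⟨s, rfl⟩ := this
        have hR : 0 < min ρ (δ / 2) := by positivity
        refine mem_of_superset (Metric.ball_mem_nhds _ (by positivity))
          ((hsurj s (min ρ (δ / 2)) hR (min_le_left _ _)).trans ?_)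
        rintro _ ⟨t, ht, rfl⟩
        rw [Metric.mem_closedBall, Complex.dist_eq] at ht
        have him : |t.im| < δ := by
          have := (abs_im_le_norm_sub t s).trans (ht.trans (min_le_right _ _))
          linarith
        by_cases h0 : t.im = 0
        · have : t = (t.re : ℂ) := Complex.ext rfl (by simpa using h0)
          rw [this]
          exact frontier_subset_closure (h.ofReal_mem _)
        · exact subset_closure (hall t h0 him)
    have hcl : closure W = Set.univ :=
      (isClopen_iff.1 ⟨isClosed_closure, hopen⟩).resolve_left h.nonempty.closure.ne_empty
    exact NormedSpace.unbounded_univ ℝ ℂ (hcl ▸ h.isBounded.closure)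
  obtain ⟨σ, hσ, -, t₀, ht₀, ht₀', hW₀⟩ := h.exists_inward hν horth hin hδ 0
  have hin1 : ∀ t : ℂ, 0 < σ * t.im → |t.im| < δ → Q t ∈ W :=
    (hside σ hσ).resolve_right fun hn => hn t₀ ht₀ ht₀' hW₀
  have hout : ∀ t : ℂ, 0 < -σ * t.im → |t.im| < δ → Q t ∉ W := by
    refine (hside (-σ) (by rcases hσ with h | h <;> rw [h] <;> norm_num)).resolve_left fun hn => ?_
    refine hnot fun t h0 ht => ?_
    have hσ0 : σ * t.im ≠ 0 := mul_ne_zero (by rcases hσ with h | h <;> rw [h] <;> norm_num) h0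
    rcases lt_or_gt_of_ne hσ0 with h1 | h1
    · exact hn t (by linarith) ht
    · exact hin1 t h1 ht
  refine ⟨σ, hσ, fun s => ?_, δ, hδ, hδr, hin1, fun t ht => hout t (by linarith)⟩
  obtain ⟨θ, hθ, e, t, ht, ht', hWt⟩ := h.exists_inward hν horth hin hδ s
  rw [e]
  have : θ = σ := by
    by_contra hne
    have : θ = -σ := by
      rcases hθ with h1 | h1 <;> rcases hσ with h2 | h2 <;> simp_all
    rw [this] at ht
    exact hout t ht ht' hWt
  rw [this]

end BoundaryStrip

/-- A `BoundaryStrip` whose upper side is the inner side, together with a uniform collar. -/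
structure BoundaryCollar (W : Set ℂ) (Q : ℂ → ℂ) (l r B δ r₀ : ℝ) : Prop extends
    BoundaryStrip W Q l r B where
  δ_pos : 0 < δ
  δ_le : 4 * δ ≤ r
  r₀_pos : 0 < r₀
  inside : ∀ t : ℂ, 0 < t.im → t.im ≤ δ → Q t ∈ W
  cover : ∀ x ∈ W, ∀ s : ℝ, ‖x - Q s‖ < r₀ →
    ∃ t : ℂ, Q t = x ∧ 0 < t.im ∧ t.im ≤ 2 * ‖x - Q s‖ ∧ t.im ≤ δ

theorem BoundaryStrip.exists_collar {W : Set ℂ} {Q : ℂ → ℂ} {l r B : ℝ}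
    (h : BoundaryStrip W Q l r B)
    (hi : Set.InjOn (fun s : ℝ => Q s) (Set.Ico 0 l)) {ν : ℝ → ℂ} (hν : ∀ s, ‖ν s‖ = 1)
    (horth : ∀ s, (ν s * (starRingEnd ℂ) (deriv Q s)).re = 0)
    (hin : ∀ s : ℝ, ∃ δ > 0, ∀ τ ∈ Set.Ioo (0 : ℝ) δ, Q s + τ * ν s ∈ W) :
    ∃ σ : ℝ, (σ = 1 ∨ σ = -1) ∧ ∃ δ r₀ : ℝ, BoundaryCollar W (fun t => Q (σ * t)) l r B δ r₀ ∧
      ∀ s : ℝ, ν s = Complex.I * deriv (fun t => Q (σ * t)) ((σ * s : ℝ) : ℂ) := by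
  obtain ⟨σ, hσ, hνσ, δ, hδ, hδr, hins, hout⟩ := h.exists_side hi hν horth hin
  have hσσ : σ * σ = 1 := by rcases hσ with h | h <;> rw [h] <;> norm_num
  have hσσ' : (σ : ℂ) * σ = 1 := by exact_mod_cast hσσ
  have hσabs : |σ| = 1 := by rcases hσ with h | h <;> rw [h] <;> norm_num
  have him : ∀ t : ℂ, ((σ : ℂ) * t).im = σ * t.im := fun t => by simp
  have hab : ∀ t : ℂ, |((σ : ℂ) * t).im| = |t.im| := fun t => by
    rw [him, abs_mul, hσabs, one_mul]
  have hder : ∀ t : ℂ, deriv (fun t => Q (σ * t)) t = σ * deriv Q (σ * t) := fun t => by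
    have := deriv_comp_mul_left (σ : ℂ) Q t
    simpa using this
  obtain ⟨ρ, hρ, hρr, hloc, hsurj⟩ := h.exists_local
  have hr := h.r_pos
  obtain ⟨η, hη, hη1, hη2⟩ : ∃ η > 0, η < δ ∧ 4 * η ≤ r :=
    ⟨min (δ / 2) (r / 4), by positivity, (min_le_left _ _).trans_lt (by linarith),
      by linarith [min_le_right (δ / 2) (r / 4)]⟩
  refine ⟨σ, hσ, η, min (ρ / 4) (η / 2), ?_, fun s => ?_⟩
  · refine ⟨⟨h.isOpen, h.isBounded, h.nonempty, h.l_pos, h.r_pos, ?_, ?_, ?_, ?_, ?_⟩, hη,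
      hη2, by positivity, ?_, ?_⟩
    · exact h.holo.comp (by fun_prop) fun t ht => by
        show |((σ : ℂ) * t).im| < r
        rw [hab]; exact ht
    · exact fun t ht => h.bound _ (by rw [hab]; exact ht)
    · intro t
      rcases hσ with rfl | rfl
      · simpa using h.periodic t
      · have := h.periodic (-(t + l))
        simp only [Complex.ofReal_neg, Complex.ofReal_one, neg_mul, one_mul]
        rw [← this]
        congr 1
        ring
    · intro s
      rw [hder, norm_mul, Complex.norm_real, Real.norm_eq_abs, hσabs, one_mul,
        ← Complex.ofReal_mul, h.norm_deriv]
    · rw [h.frontier_eq]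
      ext x
      constructor
      · rintro ⟨s, rfl⟩
        refine ⟨σ * s, ?_⟩
        simp only [Complex.ofReal_mul]
        rw [← mul_assoc, hσσ', one_mul]
      · rintro ⟨s, rfl⟩
        exact ⟨σ * s, by simp⟩
    · intro t ht htδ
      refine hins _ ?_ ?_
      · rw [him, ← mul_assoc, hσσ, one_mul]; exact ht
      · rw [hab, abs_of_pos ht]; linarith
    · intro x hx s hs
      rw [← Complex.ofReal_mul] at hs ⊢
      set s' : ℝ := σ * s with hs'
      obtain ⟨t, ht, hQt⟩ := hsurj s' ρ hρ le_rfl (show x ∈ _ by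
        rw [Metric.mem_ball, dist_eq_norm]; exact hs.trans_le (min_le_left _ _))
      rw [Metric.mem_closedBall, Complex.dist_eq] at ht
      have h1 := (hloc s' t ht).1
      rw [hQt] at h1
      have h2 := (BoundaryStrip.abs_im_le_norm_sub t s').trans h1
      have h3 : ‖x - Q s'‖ < η / 2 := hs.trans_le (min_le_right _ _)
      have hpos : 0 < σ * t.im := by
        by_contra hneg
        push Not at hneg
        rcases hneg.lt_or_eq with h4 | h4
        · exact hout t h4 (by linarith) (hQt ▸ hx)
        · have h5 : t.im = 0 := by
            rcases mul_eq_zero.1 h4 with h6 | h6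
            · rw [h6] at hσabs; simp at hσabs
            · exact h6
          have e : t = (t.re : ℂ) := Complex.ext rfl (by simpa using h5)
          have h6 := h.ofReal_mem t.re
          rw [← e, hQt, h.isOpen.frontier_eq] at h6
          exact h6.2 hx
      have h7 : σ * t.im ≤ |t.im| := by
        calc σ * t.im ≤ |σ * t.im| := le_abs_self _
          _ = |t.im| := by rw [abs_mul, hσabs, one_mul]
      refine ⟨σ * t, ?_, ?_, ?_, ?_⟩
      · rw [← mul_assoc, hσσ', one_mul, hQt]
      · rwa [him]
      · rw [him]; linarith
      · rw [him]; linarith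
  · rw [hder, ← Complex.ofReal_mul, show σ * (σ * s) = s by rw [← mul_assoc, hσσ, one_mul], hνσ]
    ring

/-- A Dirichlet eigenfunction on a planar set, in the complex coordinate. -/
structure DirichletMode (W : Set ℂ) (lam : ℝ) (Φ : ℂ → ℝ) : Prop where
  lam_pos : 0 < lam
  analytic : ∀ z ∈ closure W, AnalyticAt ℝ Φ z
  nontrivial : ∃ z ∈ W, Φ z ≠ 0
  eigen : ∀ z ∈ W, lapC Φ z = -lam ^ 2 * Φ z
  zero : ∀ z ∈ frontier W, Φ z = 0

lemma DirichletMode.exists_max {W : Set ℂ} {lam : ℝ} {Φ : ℂ → ℝ} (h : DirichletMode W lam Φ)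
    (hW : Bornology.IsBounded W) :
    ∃ x ∈ W, 0 < |Φ x| ∧ ∀ z ∈ closure W, |Φ z| ≤ |Φ x| := by
  obtain ⟨z₀, hz₀, hz₀'⟩ := h.nontrivial
  have hK : IsCompact (closure W) := hW.isCompact_closure
  have hc : ContinuousOn (fun z => |Φ z|) (closure W) :=
    fun z hz => ((h.analytic z hz).continuousAt.abs).continuousWithinAt
  obtain ⟨x, hx, hmax⟩ := hK.exists_isMaxOn ⟨z₀, subset_closure hz₀⟩ hc
  have hpos : 0 < |Φ x| := (abs_pos.2 hz₀').trans_le (hmax (subset_closure hz₀))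
  refine ⟨x, ?_, hpos, fun z hz => hmax hz⟩
  by_contra hxW
  have : x ∈ frontier W := ⟨hx, fun hi => hxW (interior_subset hi)⟩
  rw [h.zero x this, abs_zero] at hpos
  exact lt_irrefl _ hpos

namespace BoundaryCollar

variable {W : Set ℂ} {Q : ℂ → ℂ} {l r B δ r₀ lam M : ℝ} {Φ : ℂ → ℝ}

lemma mem_closure (h : BoundaryCollar W Q l r B δ r₀) {t : ℂ} (h0 : 0 ≤ t.im) (h1 : t.im ≤ δ) :
    Q t ∈ closure W := by
  rcases h0.lt_or_eq with h2 | h2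
  · exact subset_closure (h.inside t h2 h1)
  · have : t = (t.re : ℂ) := Complex.ext rfl (by simpa using h2.symm)
    rw [this]
    exact frontier_subset_closure (h.ofReal_mem _)

lemma analyticAt_of_im_le (h : BoundaryCollar W Q l r B δ r₀) {t : ℂ} (h0 : 0 ≤ t.im)
    (h1 : t.im ≤ δ) : AnalyticAt ℂ Q t :=
  h.analyticAt (by rw [abs_of_nonneg h0]; linarith [h.δ_le, h.δ_pos])

lemma comp_analyticAt (h : BoundaryCollar W Q l r B δ r₀) (hm : DirichletMode W lam Φ) {t : ℂ}
    (h0 : 0 ≤ t.im) (h1 : t.im ≤ δ) : AnalyticAt ℝ (fun w => Φ (Q w)) t :=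
  (hm.analytic _ (h.mem_closure h0 h1)).comp (h.analyticAt_of_im_le h0 h1).restrictScalars

lemma norm_deriv_le (h : BoundaryCollar W Q l r B δ r₀) {t : ℂ} (ht : |t.im| < 3 * r / 4) :
    ‖deriv Q t‖ ≤ B / (r / 4) :=
  norm_deriv_le_of_strip h.holo h.bound (by linarith [h.r_pos]) (by linarith)

lemma halfStripSolution (h : BoundaryCollar W Q l r B δ r₀) (hm : DirichletMode W lam Φ)
    (hM : ∀ z ∈ closure W, |Φ z| ≤ M) :
    HalfStripSolution δ M lam ((B / (r / 4)) ^ 2) (r / 4) (fun z => ‖deriv Q z‖ ^ 2)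
      fun z => Φ (Q z) where
  analytic z h0 h1 := h.comp_analyticAt hm h0 h1
  coeff_analytic z h0 h1 := analyticAt_norm_sq (h.analyticAt_of_im_le h0 h1).deriv
  coeff_le j z h0 h1 := by
    have hr := h.r_pos
    refine abs_dRe_iterate_norm_sq_le (r := 3 * r / 4) ?_ (fun t => h.norm_deriv_le)
      (by linarith) ?_ j
    · exact fun t ht => (h.analyticAt (lt_trans ht (by linarith))).deriv.differentiableAt
        |>.differentiableWithinAt
    · rw [abs_of_nonneg h0]; linarith [h.δ_le]
  lap_eq z h0 h1 := by
    have hz := h.inside z h0 h1.le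
    rw [lapC_comp (hm.analytic _ (subset_closure hz)) (h.analyticAt_of_im_le h0.le h1.le),
      hm.eigen _ hz]
    ring
  bound z h0 h1 := hM _ (h.mem_closure h0 h1)
  zero z hz := by
    have : z = (z.re : ℂ) := Complex.ext rfl (by simpa using hz)
    rw [this]
    exact hm.zero _ (h.ofReal_mem _)

/-- The normal derivative of a Dirichlet eigenfunction extends to a uniform strip. -/
theorem exists_extension (h : BoundaryCollar W Q l r B δ r₀) :
    ∃ R > 0, ∃ C > 0, ∀ lam Φ M, DirichletMode W lam Φ → (∀ z ∈ closure W, |Φ z| ≤ M) →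
      ∃ F : ℂ → ℂ, DifferentiableOn ℂ F {t | |t.im| < R} ∧
        (∀ s : ℝ, F s = (fderiv ℝ Φ (Q s) (Complex.I * deriv Q s) : ℝ)) ∧
        (∀ t : ℂ, |t.im| ≤ R / 2 → ‖F t‖ ≤ C * exp (δ * lam) * M) ∧
        ∀ t : ℂ, F (t + l) = F t := by
  have hr := h.r_pos
  have hδ := h.δ_pos
  set A := (B / (r / 4)) ^ 2 with hA
  have hA0 : 0 ≤ A := by positivity
  set K := 2 + A + 2 * δ / (r / 4) with hK
  have hK0 : 0 < K := by positivity
  refine ⟨δ / (2 * exp 1 * K), by positivity, 2 * (2 * exp 1 * K / δ), by positivity,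
    fun lam Φ M hm hM => ?_⟩
  have hs := h.halfStripSolution hm hM
  have hM0 : 0 ≤ M := by
    obtain ⟨z, hz, -⟩ := hm.nontrivial
    exact (abs_nonneg _).trans (hM z (subset_closure hz))
  have hb := hs.iteratedDeriv_dIm_le hδ hM0 hA0 (by linarith) hm.lam_pos (K := K)
    (by rw [hK]; linarith [show 0 ≤ 2 * δ / (r / 4) by positivity])
    (by
      have : r / 4 * (2 * δ / (r / 4)) = 2 * δ := by field_simp
      rw [hK, mul_add, this]
      nlinarith)
  set f : ℝ → ℝ := fun s => dIm (fun z => Φ (Q z)) s with hf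
  have hdI : ∀ x : ℝ, AnalyticAt ℝ (dIm fun z => Φ (Q z)) ⟨x, 0⟩ := fun x =>
    analyticAt_dIm (h.comp_analyticAt hm (by simp) (by simpa using hδ.le))
  have hcast : ∀ x : ℝ, AnalyticAt ℝ (fun s : ℝ => (s : ℂ)) x := fun x =>
    Complex.ofRealCLM.analyticAt x
  have hfa : ∀ s, AnalyticAt ℝ f s := fun s =>
    AnalyticAt.comp (g := dIm fun z => Φ (Q z)) (f := fun s : ℝ => (s : ℂ)) (hdI s) (hcast s)
  have hfk : ∀ k s, iteratedDeriv k f s = dRe^[k] (dIm fun z => Φ (Q z)) s := fun k s =>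
    (dRe_iterate_eq_iteratedDeriv k hdI s).symm
  obtain ⟨F, hF, hFs, hFb, hFp⟩ := exists_strip_extension (f := fun s => (f s : ℂ))
    (A := M * exp (δ * lam) * (2 * exp 1 * K / δ)) (r := δ / (2 * exp 1 * K)) (by positivity)
    (fun s => (Complex.ofRealCLM.analyticAt _).comp (hfa s)) (fun k s => by
      rw [norm_iteratedDeriv_ofReal (hfa s), hfk]
      exact hb k s)
  have hfeq : ∀ s : ℝ, f s = fderiv ℝ Φ (Q s) (Complex.I * deriv Q s) := fun s => by
    have ht0 : (0 : ℝ) ≤ (s : ℂ).im := by simp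
    have ht1 : (s : ℂ).im ≤ δ := by simpa using hδ.le
    rw [hf, fderiv_apply_eq]
    simp only
    rw [dIm_comp (hm.analytic _ (h.mem_closure ht0 ht1)).differentiableAt
      (h.analyticAt_of_im_le ht0 ht1).differentiableAt]
    simp
  refine ⟨F, hF, fun s => by rw [hFs, hfeq], fun t ht => (hFb t ht).trans (le_of_eq (by ring)), ?_⟩
  refine hFp l fun s => ?_
  simp only
  rw [hfeq, hfeq]
  have e : (fun t : ℂ => Q (t + l)) = Q := funext h.periodic
  have : deriv Q ((s : ℂ) + l) = deriv Q s := by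
    rw [← deriv_comp_add_const, e]
  rw [Complex.ofReal_add, this, h.periodic]

end BoundaryCollar

lemma analyticAt_lapC {u : ℂ → ℝ} {z : ℂ} (hu : AnalyticAt ℝ u z) : AnalyticAt ℝ (lapC u) z :=
  (analyticAt_dRe (analyticAt_dRe hu)).add (analyticAt_dIm (analyticAt_dIm hu))

lemma ball_subset_of_disjoint_frontier {W : Set ℂ} (hW : IsOpen W) {x : ℂ} (hx : x ∈ W) {D : ℝ}
    (hD : ∀ y ∈ frontier W, D ≤ ‖x - y‖) : Metric.ball x D ⊆ W := by
  rcases le_or_gt D 0 with h | h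
  · rw [Metric.ball_eq_empty.2 h]; exact Set.empty_subset _
  refine (convex_ball x D).isPreconnected.subset_left_of_subset_union hW
    (isClosed_closure (s := W)).isOpen_compl
    (Set.disjoint_compl_right_iff_subset.2 subset_closure) ?_ ⟨x, Metric.mem_ball_self h, hx⟩
  intro y hy
  by_cases hc : y ∈ closure W
  · left
    by_contra hn
    have := hD y (by rw [hW.frontier_eq]; exact ⟨hc, hn⟩)
    rw [Metric.mem_ball, dist_comm, dist_eq_norm] at hy
    linarith
  · exact Or.inr hc

namespace DirichletMode

variable {W : Set ℂ} {lam M R : ℝ} {Φ : ℂ → ℝ}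

lemma eigen_closure (h : DirichletMode W lam Φ) {z : ℂ} (hz : z ∈ closure W) :
    lapC Φ z = -lam ^ 2 * Φ z := by
  have hne : (𝓝[W] z).NeBot := mem_closure_iff_nhdsWithin_neBot.1 hz
  have h1 : Tendsto (lapC Φ) (𝓝[W] z) (𝓝 (lapC Φ z)) :=
    (analyticAt_lapC (h.analytic z hz)).continuousAt.mono_left nhdsWithin_le_nhds
  have h2 : Tendsto (fun w => -lam ^ 2 * Φ w) (𝓝[W] z) (𝓝 (-lam ^ 2 * Φ z)) :=
    ((h.analytic z hz).continuousAt.const_mul _).mono_left nhdsWithin_le_nhds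
  refine tendsto_nhds_unique h1 (h2.congr' ?_)
  filter_upwards [self_mem_nhdsWithin] with w hw using (h.eigen w hw).symm

lemma le_of_bound (h : DirichletMode W lam Φ)
    (hR : ∀ z ∈ closure W, ‖z‖ ≤ R) (hM : ∀ z ∈ closure W, |Φ z| ≤ M) {σ : ℝ}
    (hσ : |σ| = 1) {x : ℂ} (hx : x ∈ closure W) : σ * Φ x ≤ lam ^ 2 * M / 4 * R ^ 2 := by
  have hK : IsCompact (closure W) :=
    (isBounded_iff_forall_norm_le.2 ⟨R, hR⟩ : Bornology.IsBounded (closure W)).isCompact_closure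
      |>.of_isClosed_subset isClosed_closure subset_closure
  have key : ∀ η > 0, σ * Φ x ≤ (lam ^ 2 * M / 4 + η) * R ^ 2 := by
    intro η hη
    set c := lam ^ 2 * M / 4 + η with hc
    have hM0 : 0 ≤ M := (abs_nonneg _).trans (hM x hx)
    have hc0 : 0 ≤ c := by positivity
    have hmain := le_zero_of_hasLap_pos hK
      (w := fun w => σ * Φ w + (c * (w.im - 0) ^ 2 + c * w.re ^ 2 + 0 * w.re + 0 * w.im + -(c * R ^ 2)))
      (by
        refine ContinuousOn.add (continuousOn_const.mul fun z hz =>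
          (h.analytic z hz).continuousAt.continuousWithinAt) ?_
        fun_prop)
      (by
        intro z hz
        have hz' := interior_subset hz
        refine ⟨_, ?_, ((hasLap_of_analyticAt (h.analytic z hz')).const_mul σ).add
          (hasLap_poly _ _ _ _ _ _ _)⟩
        have e := h.eigen_closure hz'
        rw [lapC] at e
        rw [e]
        have h1 : |σ * (-lam ^ 2 * Φ z)| ≤ lam ^ 2 * M := by
          rw [abs_mul, hσ, one_mul, abs_mul, abs_neg, abs_of_nonneg (sq_nonneg lam)]
          gcongr
          exact hM z hz'
        have := (abs_le.1 h1).1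
        linarith)
      (by
        intro z hz hni
        have hzf : z ∈ frontier W := ⟨hz, fun hi => hni (interior_mono subset_closure hi)⟩
        have hn : z.re ^ 2 + z.im ^ 2 ≤ R ^ 2 := by
          have : z.re ^ 2 + z.im ^ 2 = ‖z‖ ^ 2 := by
            rw [← Complex.normSq_eq_norm_sq, Complex.normSq_apply]; ring
          rw [this]
          exact pow_le_pow_left₀ (norm_nonneg _) (hR z hz) 2
        simp only [h.zero z hzf]
        nlinarith)
      x hx
    nlinarith [mul_nonneg hc0 (sq_nonneg x.im), mul_nonneg hc0 (sq_nonneg x.re)]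
  refine le_of_forall_pos_le_add fun ε hε => ?_
  have := key (ε / (R ^ 2 + 1)) (by positivity)
  have h2 : ε / (R ^ 2 + 1) * R ^ 2 ≤ ε := by
    rw [div_mul_eq_mul_div, div_le_iff₀ (by positivity)]
    nlinarith
  linarith

lemma four_le (h : DirichletMode W lam Φ)
    (hR : ∀ z ∈ closure W, ‖z‖ ≤ R) {x : ℂ} (hx : x ∈ W) (h0 : 0 < |Φ x|)
    (hM : ∀ z ∈ closure W, |Φ z| ≤ |Φ x|) : 4 ≤ lam ^ 2 * R ^ 2 := by
  have h1 : |Φ x| ≤ lam ^ 2 * |Φ x| / 4 * R ^ 2 := by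
    rcases abs_cases (Φ x) with ⟨e, -⟩ | ⟨e, -⟩
    · have := h.le_of_bound hR hM (σ := 1) (by simp) (subset_closure hx)
      linarith
    · have := h.le_of_bound hR hM (σ := -1) (by simp) (subset_closure hx)
      linarith
  by_contra hlt
  push Not at hlt
  nlinarith

/-- Interior gradient bound. -/
lemma norm_fderiv_le (h : DirichletMode W lam Φ) {x : ℂ} {d : ℝ} (hd : 0 < d)
    (hball : Metric.closedBall x (2 * d) ⊆ W) (hM : ∀ z ∈ closure W, |Φ z| ≤ M) :
    ‖fderiv ℝ Φ x‖ ≤ 2 * M / d + lam ^ 2 * M * d / 2 := by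
  have hM0 : 0 ≤ M := (abs_nonneg _).trans
    (hM x (subset_closure (hball (Metric.mem_closedBall_self (by linarith)))))
  have hunit : ∀ θ : ℂ, ‖θ‖ = 1 →
      |fderiv ℝ Φ x θ| ≤ 2 * M / d + lam ^ 2 * M * d / 2 := by
    intro θ hθ
    have hQ : ∀ w, AnalyticAt ℂ (fun w => x + θ * w) w := fun w => by fun_prop
    have hQd : ∀ w, deriv (fun w => x + θ * w) w = θ := fun w => by
      simp
    have hmem : ∀ w ∈ Set.Icc ((0 : ℂ).re - d) ((0 : ℂ).re + d) ×ℂ Set.Icc (-d) d,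
        x + θ * w ∈ W := by
      intro w hw
      refine hball ?_
      rw [Metric.mem_closedBall, dist_eq_norm, add_sub_cancel_left, norm_mul, hθ, one_mul]
      have h1 : |w.re| ≤ d := abs_le.2 ⟨by simpa using hw.1.1, by simpa using hw.1.2⟩
      have h2 : |w.im| ≤ d := abs_le.2 hw.2
      exact (Complex.norm_le_abs_re_add_abs_im w).trans (by linarith)
    have hb := abs_dRe_le (z0 := 0) (a := -d) (b := d) (N := M) (f := lam ^ 2 * M) hd
      (u := fun w => Φ (x + θ * w)) hM0 (by positivity) ⟨by simpa using hd.le, by simpa using hd.le⟩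
      (fun w hw => AnalyticAt.comp (g := Φ) (f := fun w => x + θ * w)
        (h.analytic _ (subset_closure (hmem w hw))) (hQ w).restrictScalars)
      (fun w h1 h2 h3 h4 => by
        have hw := hmem w ⟨⟨h1.le, h2.le⟩, h3.le, h4.le⟩
        rw [lapC_comp (Q := fun w => x + θ * w) (h.analytic _ (subset_closure hw)) (hQ w), hQd, hθ,
          h.eigen _ hw, one_pow, one_mul, abs_mul, abs_neg, abs_of_nonneg (sq_nonneg lam)]
        gcongr
        exact hM _ (subset_closure hw))
      (fun w hw => hM _ (subset_closure (hmem w hw)))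
      (.inl (by simp [abs_of_pos hd])) (.inl (by simp [abs_of_pos hd]))
    have hx0 : x + θ * 0 ∈ W := hmem 0 ⟨⟨by simpa using hd.le, by simpa using hd.le⟩,
      by simpa using hd.le, by simpa using hd.le⟩
    rw [dRe_comp (Q := fun w => x + θ * w) (h.analytic _ (subset_closure hx0)).differentiableAt
      (hQ 0).differentiableAt, hQd] at hb
    simp only [mul_zero, add_zero] at hb
    rwa [fderiv_apply_eq]
  refine ContinuousLinearMap.opNorm_le_bound _ (by positivity) fun v => ?_
  rcases eq_or_ne v 0 with rfl | hv
  · simp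
  have hv' : ‖v‖ ≠ 0 := norm_ne_zero_iff.2 hv
  have h1 := hunit ((‖v‖⁻¹ : ℝ) • v) (by rw [norm_smul]; simp [hv'])
  rw [map_smul, smul_eq_mul, abs_mul, abs_of_nonneg (by positivity)] at h1
  rw [Real.norm_eq_abs]
  calc |fderiv ℝ Φ x v| = (‖v‖⁻¹ * |fderiv ℝ Φ x v|) * ‖v‖ := by field_simp
    _ ≤ _ := by gcongr

end DirichletMode

namespace BoundaryCollar

variable {W : Set ℂ} {Q : ℂ → ℂ} {l r B δ r₀ lam M : ℝ} {Φ : ℂ → ℝ}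

/-- Linear decay of an eigenfunction at the boundary. -/
lemma exists_decay (h : BoundaryCollar W Q l r B δ r₀) :
    ∃ C > 0, ∀ lam Φ M, DirichletMode W lam Φ → (∀ z ∈ closure W, |Φ z| ≤ M) →
      ∀ x ∈ W, ∀ s : ℝ, ‖x - Q s‖ < r₀ → |Φ x| ≤ C * (1 + lam) * M * ‖x - Q s‖ := by
  have hδ := h.δ_pos
  set A := (B / (r / 4)) ^ 2 with hA
  have hA0 : 0 ≤ A := by positivity
  refine ⟨2 * (2 / δ + A * δ / 2), by positivity, fun lam Φ M hm hM x hx s hs => ?_⟩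
  have hlam := hm.lam_pos
  have hM0 : 0 ≤ M := (abs_nonneg _).trans (hM x (subset_closure hx))
  obtain ⟨t, rfl, ht0, ht2, htδ⟩ := h.cover x hx s hs
  have hst := h.halfStripSolution hm hM
  suffices hy : |Φ (Q t)| ≤ (2 / δ + A * δ / 2) * (1 + lam) * M * t.im by
    refine hy.trans ?_
    calc (2 / δ + A * δ / 2) * (1 + lam) * M * t.im
        ≤ (2 / δ + A * δ / 2) * (1 + lam) * M * (2 * ‖Q t - Q s‖) := by gcongr
      _ = _ := by ring
  set d := δ / (1 + lam) with hd
  have hd0 : 0 < d := by positivity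
  have hdδ : d ≤ δ := div_le_self hδ.le (by linarith)
  rcases le_or_gt t.im d with htd | htd
  · have := abs_le_mul_im (u := fun z => Φ (Q z)) (s := t.re) (N := M)
      (f := lam ^ 2 * (A * M)) hd0 hM0 (by positivity)
      (fun z hz => hst.analytic z hz.2.1 (hz.2.2.trans hdδ))
      (fun z _ _ h3 h4 => by
        rw [hst.lap_eq z h3 (h4.trans_le hdδ), abs_mul, abs_neg, abs_of_nonneg (sq_nonneg lam),
          abs_mul]
        have h5 := hst.coeff_le 0 z h3.le (h4.le.trans hdδ)
        simp only [Function.iterate_zero, id_eq, Nat.factorial_zero, Nat.cast_one, mul_one,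
          pow_zero, div_one] at h5
        gcongr
        exact hst.bound z h3.le (h4.le.trans hdδ))
      (fun z hz => hst.bound z hz.2.1 (hz.2.2.trans hdδ))
      (fun z _ hz0 => hst.zero z hz0) ht0.le htd
    refine this.trans ?_
    have e1 : 2 * M / d = 2 / δ * (1 + lam) * M := by rw [hd]; field_simp
    have e2 : lam ^ 2 * (A * M) * d / 2 ≤ A * δ / 2 * (1 + lam) * M := by
      have : lam ^ 2 * d ≤ δ * (1 + lam) := by
        rw [hd, mul_div_assoc', div_le_iff₀ (by positivity)]
        nlinarith [mul_pos hδ hlam]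
      nlinarith [mul_le_mul_of_nonneg_left this (show 0 ≤ A * M / 2 by positivity)]
    refine mul_le_mul_of_nonneg_right ?_ ht0.le
    rw [e1]
    linarith
  · refine (hst.bound t ht0.le htδ).trans ?_
    have h1 : 1 ≤ t.im * (1 + lam) / δ := by
      rw [le_div_iff₀ hδ, one_mul]
      rw [hd, div_lt_iff₀ (by positivity)] at htd
      exact htd.le
    calc M ≤ M * (t.im * (1 + lam) / δ) := le_mul_of_one_le_right hM0 h1
      _ = 1 / δ * ((1 + lam) * M * t.im) := by ring
      _ ≤ (2 / δ + A * δ / 2) * ((1 + lam) * M * t.im) := by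
          refine mul_le_mul_of_nonneg_right ?_ (by positivity)
          have : 1 / δ ≤ 2 / δ := by gcongr; norm_num
          have : 0 ≤ A * δ / 2 := by positivity
          linarith
      _ = _ := by ring

/-- An eigenfunction stays comparable to its maximum on a ball of radius `c / (1 + lam)`. -/
lemma exists_ball (h : BoundaryCollar W Q l r B δ r₀) :
    ∃ c > 0, ∀ lam Φ, DirichletMode W lam Φ → ∀ x ∈ W, (∀ z ∈ closure W, |Φ z| ≤ |Φ x|) →
      0 < |Φ x| → Metric.ball x (c / (1 + lam)) ⊆ W ∧
        ∀ y ∈ Metric.ball x (c / (1 + lam)), |Φ x| / 2 ≤ |Φ y| := by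
  obtain ⟨C, hC, hdecay⟩ := h.exists_decay
  have hr₀ := h.r₀_pos
  set c₂ := min (1 / C) r₀ with hc₂
  have hc₂0 : 0 < c₂ := by positivity
  set C₃ := 16 / c₂ + c₂ / 16 with hC₃
  have hC₃0 : 0 < C₃ := by positivity
  refine ⟨min (c₂ / 2) (1 / (2 * C₃)), by positivity, fun lam Φ hm x hx hM hx0 => ?_⟩
  have hlam := hm.lam_pos
  set D := c₂ / (1 + lam) with hD
  have hD0 : 0 < D := by positivity
  have hballD : Metric.ball x D ⊆ W := by
    refine ball_subset_of_disjoint_frontier h.isOpen hx fun y hy => ?_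
    rw [h.frontier_eq] at hy
    obtain ⟨s, rfl⟩ := hy
    by_contra hlt
    push Not at hlt
    have h1 : ‖x - Q s‖ < r₀ := hlt.trans_le
      ((div_le_self hc₂0.le (by linarith)).trans (min_le_right _ _))
    have h2 := hdecay lam Φ |Φ x| hm hM x hx s h1
    have h3 : C * (1 + lam) * ‖x - Q s‖ < 1 := by
      calc C * (1 + lam) * ‖x - Q s‖ < C * (1 + lam) * D := by gcongr
        _ = C * c₂ := by rw [hD]; field_simp
        _ ≤ C * (1 / C) := by gcongr; exact min_le_left _ _
        _ = 1 := by field_simp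
    nlinarith
  have hsub : Metric.ball x (min (c₂ / 2) (1 / (2 * C₃)) / (1 + lam)) ⊆ Metric.ball x (D / 2) := by
    refine Metric.ball_subset_ball ?_
    calc min (c₂ / 2) (1 / (2 * C₃)) / (1 + lam) ≤ c₂ / 2 / (1 + lam) := by
          gcongr; exact min_le_left _ _
      _ = D / 2 := by rw [hD]; ring
  have hsub' : Metric.ball x (D / 2) ⊆ W :=
    (Metric.ball_subset_ball (by linarith)).trans hballD
  refine ⟨hsub.trans hsub', fun y hy => ?_⟩
  have hgrad : ∀ z ∈ Metric.ball x (D / 2), ‖fderiv ℝ Φ z‖ ≤ C₃ * (1 + lam) * |Φ x| := by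
    intro z hz
    refine (hm.norm_fderiv_le (d := D / 8) (by positivity) ?_ hM).trans ?_
    · refine Set.Subset.trans (fun w hw => ?_) hballD
      rw [Metric.mem_ball] at hz ⊢
      rw [Metric.mem_closedBall] at hw
      linarith [dist_triangle w z x]
    · have e1 : 2 * |Φ x| / (D / 8) = 16 / c₂ * (1 + lam) * |Φ x| := by
        rw [hD]; field_simp; ring
      have e2 : lam ^ 2 * |Φ x| * (D / 8) / 2 ≤ c₂ / 16 * (1 + lam) * |Φ x| := by
        have : lam ^ 2 * D ≤ c₂ * (1 + lam) := by
          rw [hD, mul_div_assoc', div_le_iff₀ (by positivity)]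
          nlinarith [mul_pos hc₂0 hlam]
        nlinarith [mul_le_mul_of_nonneg_left this (show 0 ≤ |Φ x| / 16 by positivity)]
      rw [e1, hC₃]
      linarith
  have hmv := (convex_ball x (D / 2)).norm_image_sub_le_of_norm_fderiv_le (𝕜 := ℝ) (f := Φ)
    (fun z hz => (hm.analytic z (subset_closure (hsub' hz))).differentiableAt) hgrad
    (Metric.mem_ball_self (by positivity)) (hsub hy)
  have hyn : ‖y - x‖ ≤ 1 / (2 * C₃) / (1 + lam) := by
    rw [Metric.mem_ball, dist_eq_norm] at hy
    refine hy.le.trans ?_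
    gcongr
    exact min_le_right _ _
  have h4 : ‖Φ y - Φ x‖ ≤ |Φ x| / 2 := by
    refine hmv.trans ?_
    calc C₃ * (1 + lam) * |Φ x| * ‖y - x‖
        ≤ C₃ * (1 + lam) * |Φ x| * (1 / (2 * C₃) / (1 + lam)) := by gcongr
      _ = |Φ x| / 2 := by field_simp
  rw [Real.norm_eq_abs, abs_sub_comm] at h4
  have := abs_sub_abs_le_abs_sub (Φ x) (Φ y)
  linarith

end BoundaryCollar

lemma exists_lipschitz_eqOn_nhds {W : Set ℂ} (hW : Bornology.IsBounded W) {V : ℂ → ℝ}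
    (hV : ∀ z ∈ closure W, AnalyticAt ℝ V z) :
    ∃ f : ℂ → ℝ, (∃ C, LipschitzWith C f) ∧ ∀ z ∈ closure W, f =ᶠ[𝓝 z] V := by
  obtain ⟨L, hL, hWL, hLU⟩ := exists_compact_between hW.isCompact_closure
    (isOpen_analyticAt ℝ V) (fun z hz => hV z hz)
  obtain ⟨η, h1, h0, -⟩ := exists_contMDiffMap_one_nhds_of_subset_interior
    (modelWithCornersSelf ℝ ℂ) (n := 1) (isClosed_closure (s := W)) hWL
  have hη : ContDiff ℝ 1 η := η.contMDiff.contDiff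
  refine ⟨fun z => η z * V z, ?_, fun z hz => ?_⟩
  · refine ContDiff.lipschitzWith_of_hasCompactSupport (𝕂 := ℝ) (n := 1)
      (HasCompactSupport.intro hL fun z hz => by rw [h0 z hz, zero_mul]) ?_ one_ne_zero
    refine contDiff_iff_contDiffAt.2 fun z => ?_
    by_cases hz : z ∈ L
    · exact hη.contDiffAt.mul (show AnalyticAt ℝ V z from hLU hz).contDiffAt
    · refine (contDiffAt_const (c := (0 : ℝ))).congr_of_eventuallyEq ?_
      filter_upwards [hL.isClosed.isOpen_compl.mem_nhds hz] with w hw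
      rw [h0 w hw, zero_mul]
  · filter_upwards [(eventually_nhdsSet_iff_forall.1 h1) z hz] with w hw
    rw [hw, one_mul]

lemma lineDeriv_eq_zero_of_notMem_tsupport {χ : ℂ → ℝ} {z : ℂ} (hz : z ∉ tsupport χ) (v : ℂ) :
    lineDeriv ℝ χ z v = 0 := by
  rw [(notMem_tsupport_iff_eventuallyEq.1 hz).lineDeriv_eq]
  simp [lineDeriv]

/-- Integration by parts against a Lipschitz cutoff supported in `W`. -/
lemma integral_fderiv_mul_cutoff {W : Set ℂ} (hW : Bornology.IsBounded W) {V χ : ℂ → ℝ}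
    (hV : ∀ z ∈ closure W, AnalyticAt ℝ V z) {K : NNReal} (hχ : LipschitzWith K χ)
    (hc : HasCompactSupport χ) (hs : tsupport χ ⊆ W) (v : ℂ) :
    ∫ z, fderiv ℝ V z v * χ z = ∫ z, lineDeriv ℝ χ z (-v) * V z := by
  obtain ⟨f, ⟨C, hf⟩, hfV⟩ := exists_lipschitz_eqOn_nhds hW hV
  have h := hf.integral_lineDeriv_mul_eq (μ := volume) hχ hc v
  have e1 : ∀ z, lineDeriv ℝ f z v * χ z = fderiv ℝ V z v * χ z := by
    intro z
    by_cases hz : z ∈ tsupport χ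
    · have hzW := subset_closure (hs hz)
      rw [(hfV z hzW).lineDeriv_eq, (hV z hzW).differentiableAt.lineDeriv_eq_fderiv]
    · rw [image_eq_zero_of_notMem_tsupport hz, mul_zero, mul_zero]
  have e2 : ∀ z, lineDeriv ℝ χ z (-v) * f z = lineDeriv ℝ χ z (-v) * V z := by
    intro z
    by_cases hz : z ∈ tsupport χ
    · rw [(hfV z (subset_closure (hs hz))).eq_of_nhds]
    · rw [lineDeriv_eq_zero_of_notMem_tsupport hz, zero_mul, zero_mul]
  simpa only [e1, e2] using h

/-- A Lipschitz cutoff of a proper open set at scale `h`. -/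
def distCutoff (W : Set ℂ) (h : ℝ) (z : ℂ) : ℝ :=
  max 0 (min 1 (Metric.infDist z Wᶜ / h - 1))

section DistCutoff

variable {W : Set ℂ} {h : ℝ}

lemma distCutoff_nonneg (z : ℂ) : 0 ≤ distCutoff W h z := le_max_left _ _

lemma distCutoff_eq_one (hh : 0 < h) {z : ℂ} (hz : 2 * h ≤ Metric.infDist z Wᶜ) :
    distCutoff W h z = 1 := by
  have : 2 ≤ Metric.infDist z Wᶜ / h := by rwa [le_div_iff₀ hh]
  rw [distCutoff, min_eq_left (by linarith), max_eq_right zero_le_one]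

lemma distCutoff_lipschitz (hh : 0 < h) : LipschitzWith (Real.toNNReal h⁻¹) (distCutoff W h) := by
  refine LipschitzWith.of_dist_le_mul fun x y => ?_
  rw [Real.coe_toNNReal _ (by positivity), Real.dist_eq, distCutoff, distCutoff, max_comm 0, max_comm 0]
  refine (abs_max_sub_max_le_abs _ _ _).trans ?_
  refine le_trans ?_ (show |Metric.infDist x Wᶜ / h - Metric.infDist y Wᶜ / h| ≤ _ from ?_)
  · rcases le_total 1 (Metric.infDist x Wᶜ / h - 1) with h1 | h1 <;>
    rcases le_total 1 (Metric.infDist y Wᶜ / h - 1) with h2 | h2 <;>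
    simp only [min_eq_left, min_eq_right, h1, h2] <;>
    rw [abs_le] <;> constructor <;>
    first
    | linarith [abs_nonneg (Metric.infDist x Wᶜ / h - Metric.infDist y Wᶜ / h),
        le_abs_self (Metric.infDist x Wᶜ / h - Metric.infDist y Wᶜ / h),
        neg_abs_le (Metric.infDist x Wᶜ / h - Metric.infDist y Wᶜ / h)]
  · rw [← sub_div, abs_div, abs_of_pos hh, div_eq_inv_mul]
    gcongr
    have h1 := Metric.infDist_le_infDist_add_dist (s := Wᶜ) (x := x) (y := y)
    have h2 := Metric.infDist_le_infDist_add_dist (s := Wᶜ) (x := y) (y := x)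
    rw [dist_comm y x] at h2
    exact abs_le.2 ⟨by linarith, by linarith⟩

lemma tsupport_distCutoff (hh : 0 < h) :
    tsupport (distCutoff W h) ⊆ {z | h ≤ Metric.infDist z Wᶜ} := by
  refine closure_minimal (fun z hz => ?_)
    (isClosed_le continuous_const (Metric.continuous_infDist_pt _))
  by_contra hlt
  simp only [Set.mem_ofPred_eq, not_le] at hlt
  refine hz ?_
  have : Metric.infDist z Wᶜ / h < 1 := by rwa [div_lt_one hh]
  rw [distCutoff]
  exact max_eq_left ((min_le_right _ _).trans (by linarith))

lemma tsupport_distCutoff_subset (hh : 0 < h) : tsupport (distCutoff W h) ⊆ W := by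
  intro z hz
  have h1 : h ≤ Metric.infDist z Wᶜ := tsupport_distCutoff hh hz
  by_contra hn
  rw [Metric.infDist_zero_of_mem (show z ∈ Wᶜ from hn)] at h1
  linarith

lemma hasCompactSupport_distCutoff (hW : Bornology.IsBounded W) (hh : 0 < h) :
    HasCompactSupport (distCutoff W h) :=
  hW.isCompact_closure.of_isClosed_subset (isClosed_tsupport _)
    ((tsupport_distCutoff_subset hh).trans subset_closure)

lemma lineDeriv_distCutoff_eq_zero (hh : 0 < h) {z : ℂ}
    (hz : z ∉ {z | z ∈ W ∧ Metric.infDist z Wᶜ ≤ 2 * h}) (v : ℂ) :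
    lineDeriv ℝ (distCutoff W h) z v = 0 := by
  by_cases hzW : z ∈ W
  · have hlt : 2 * h < Metric.infDist z Wᶜ := by
      by_contra hle
      exact hz ⟨hzW, not_lt.1 hle⟩
    have : distCutoff W h =ᶠ[𝓝 z] fun _ => 1 := by
      filter_upwards [(isOpen_lt continuous_const (Metric.continuous_infDist_pt _)).mem_nhds hlt]
        with w hw using distCutoff_eq_one hh hw.le
    rw [this.lineDeriv_eq]
    simp [lineDeriv]
  · exact lineDeriv_eq_zero_of_notMem_tsupport (fun h => hzW (tsupport_distCutoff_subset hh h)) v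

/-- Integration by parts, with the boundary term estimated on the collar. -/
lemma abs_integral_fderiv_mul_distCutoff_le (hW : Bornology.IsBounded W) (hh : 0 < h) {V : ℂ → ℝ}
    (hV : ∀ z ∈ closure W, AnalyticAt ℝ V z) {S : ℝ}
    (hS : ∀ z ∈ W, Metric.infDist z Wᶜ ≤ 2 * h → |V z| ≤ S) {v : ℂ} (hv : ‖v‖ = 1) :
    |∫ z, fderiv ℝ V z v * distCutoff W h z| ≤
      h⁻¹ * S * volume.real {z | z ∈ W ∧ Metric.infDist z Wᶜ ≤ 2 * h} := by
  rw [integral_fderiv_mul_cutoff hW hV (distCutoff_lipschitz hh)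
    (hasCompactSupport_distCutoff hW hh) (tsupport_distCutoff_subset hh),
    ← setIntegral_eq_integral_of_forall_compl_eq_zero
      (s := {z | z ∈ W ∧ Metric.infDist z Wᶜ ≤ 2 * h})
      (fun z hz => by rw [lineDeriv_distCutoff_eq_zero hh hz, zero_mul]), ← Real.norm_eq_abs]
  refine norm_setIntegral_le_of_norm_le_const ?_ fun z hz => ?_
  · exact (measure_mono fun z hz => hz.1).trans_lt hW.measure_lt_top
  · rw [norm_mul]
    have := norm_lineDeriv_le_of_lipschitz ℝ (distCutoff_lipschitz (W := W) hh) (v := -v) (x₀ := z)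
    rw [norm_neg, hv, mul_one, Real.coe_toNNReal _ (by positivity)] at this
    exact mul_le_mul this (hS z hz.1 hz.2) (norm_nonneg _) (by positivity)

lemma continuous_mul_distCutoff (hh : 0 < h) {g : ℂ → ℝ} (hg : ContinuousOn g W)
    (hW : IsOpen W) : Continuous fun z => g z * distCutoff W h z := by
  refine continuous_iff_continuousAt.2 fun z => ?_
  by_cases hz : z ∈ W
  · exact (hg.continuousAt (hW.mem_nhds hz)).mul (distCutoff_lipschitz hh).continuous.continuousAt
  · have : (fun z => g z * distCutoff W h z) =ᶠ[𝓝 z] fun _ => 0 := by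
      filter_upwards [notMem_tsupport_iff_eventuallyEq.1
        (fun h => hz (tsupport_distCutoff_subset hh h))] with w hw
      rw [hw]; simp
    exact continuousAt_const.congr this.symm

lemma integrable_mul_distCutoff (hh : 0 < h) {g : ℂ → ℝ} (hg : ContinuousOn g W)
    (hW : IsOpen W) (hb : Bornology.IsBounded W) :
    Integrable fun z => g z * distCutoff W h z :=
  (continuous_mul_distCutoff hh hg hW).integrable_of_hasCompactSupport
    ((hasCompactSupport_distCutoff hb hh).mul_left)

end DistCutoff

/-- First component of the Rellich vector field. -/
def rellichRe (lam : ℝ) (Φ : ℂ → ℝ) (z : ℂ) : ℝ :=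
  z.re * (dRe Φ z ^ 2 - dIm Φ z ^ 2) / 2 + z.im * (dRe Φ z * dIm Φ z) +
    lam ^ 2 / 2 * (z.re * Φ z ^ 2)

/-- Second component of the Rellich vector field. -/
def rellichIm (lam : ℝ) (Φ : ℂ → ℝ) (z : ℂ) : ℝ :=
  z.im * (dIm Φ z ^ 2 - dRe Φ z ^ 2) / 2 + z.re * (dRe Φ z * dIm Φ z) +
    lam ^ 2 / 2 * (z.im * Φ z ^ 2)

section Rellich

variable {lam : ℝ} {Φ : ℂ → ℝ} {z : ℂ}

lemma analyticAt_re (z : ℂ) : AnalyticAt ℝ (fun z : ℂ => z.re) z := Complex.reCLM.analyticAt z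

lemma analyticAt_im (z : ℂ) : AnalyticAt ℝ (fun z : ℂ => z.im) z := Complex.imCLM.analyticAt z

lemma analyticAt_rellichRe (hΦ : AnalyticAt ℝ Φ z) : AnalyticAt ℝ (rellichRe lam Φ) z :=
  ((((analyticAt_re z).fun_mul (((analyticAt_dRe hΦ).fun_pow 2).fun_sub
    ((analyticAt_dIm hΦ).fun_pow 2))).fun_div analyticAt_const two_ne_zero).fun_add
    ((analyticAt_im z).fun_mul ((analyticAt_dRe hΦ).fun_mul (analyticAt_dIm hΦ)))).fun_add
    (analyticAt_const.fun_mul ((analyticAt_re z).fun_mul (hΦ.fun_pow 2)))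

lemma analyticAt_rellichIm (hΦ : AnalyticAt ℝ Φ z) : AnalyticAt ℝ (rellichIm lam Φ) z :=
  ((((analyticAt_im z).fun_mul (((analyticAt_dIm hΦ).fun_pow 2).fun_sub
    ((analyticAt_dRe hΦ).fun_pow 2))).fun_div analyticAt_const two_ne_zero).fun_add
    ((analyticAt_re z).fun_mul ((analyticAt_dRe hΦ).fun_mul (analyticAt_dIm hΦ)))).fun_add
    (analyticAt_const.fun_mul ((analyticAt_im z).fun_mul (hΦ.fun_pow 2)))

/-- The Rellich identity in differential form. -/
lemma div_rellich (hΦ : AnalyticAt ℝ Φ z) (hL : lapC Φ z = -lam ^ 2 * Φ z) :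
    fderiv ℝ (rellichRe lam Φ) z 1 + fderiv ℝ (rellichIm lam Φ) z Complex.I =
      lam ^ 2 * Φ z ^ 2 := by
  have hp := (analyticAt_dRe hΦ).differentiableAt.hasFDerivAt
  have hq := (analyticAt_dIm hΦ).differentiableAt.hasFDerivAt
  have hf := hΦ.differentiableAt.hasFDerivAt
  have hx : HasFDerivAt (fun z : ℂ => z.re) Complex.reCLM z := Complex.reCLM.hasFDerivAt
  have hy : HasFDerivAt (fun z : ℂ => z.im) Complex.imCLM z := Complex.imCLM.hasFDerivAt
  have h1 := ((((hx.fun_mul ((hp.fun_mul hp).fun_sub (hq.fun_mul hq))).const_mul (1 / 2)).fun_add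
    (hy.fun_mul (hp.fun_mul hq))).fun_add ((hx.fun_mul (hf.fun_mul hf)).const_mul (lam ^ 2 / 2)))
  have h2 := ((((hy.fun_mul ((hq.fun_mul hq).fun_sub (hp.fun_mul hp))).const_mul (1 / 2)).fun_add
    (hx.fun_mul (hp.fun_mul hq))).fun_add ((hy.fun_mul (hf.fun_mul hf)).const_mul (lam ^ 2 / 2)))
  have e1 : rellichRe lam Φ = fun z => 1 / 2 * (z.re * (dRe Φ z * dRe Φ z - dIm Φ z * dIm Φ z)) +
      z.im * (dRe Φ z * dIm Φ z) + lam ^ 2 / 2 * (z.re * (Φ z * Φ z)) := by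
    ext w; rw [rellichRe]; ring
  have e2 : rellichIm lam Φ = fun z => 1 / 2 * (z.im * (dIm Φ z * dIm Φ z - dRe Φ z * dRe Φ z)) +
      z.re * (dRe Φ z * dIm Φ z) + lam ^ 2 / 2 * (z.im * (Φ z * Φ z)) := by
    ext w; rw [rellichIm]; ring
  rw [e1, e2, h1.fderiv, h2.fderiv]
  have c : fderiv ℝ (dIm Φ) z 1 = fderiv ℝ (dRe Φ) z Complex.I := dRe_dIm_eq hΦ
  have l : fderiv ℝ (dRe Φ) z 1 + fderiv ℝ (dIm Φ) z Complex.I = -lam ^ 2 * Φ z := hL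
  have p1 : fderiv ℝ Φ z 1 = dRe Φ z := rfl
  have p2 : fderiv ℝ Φ z Complex.I = dIm Φ z := rfl
  simp only [_root_.add_apply, _root_.smul_apply,
    _root_.sub_apply, Complex.reCLM_apply, Complex.imCLM_apply, smul_eq_mul,
    Complex.one_re, Complex.one_im, Complex.I_re, Complex.I_im, c, p1, p2]
  linear_combination (z.re * dRe Φ z + z.im * dIm Φ z) * l

lemma abs_rellich_le (h0 : Φ z = 0) {B m : ℝ} (hB : ‖z‖ ≤ B)
    (hm : dRe Φ z ^ 2 + dIm Φ z ^ 2 ≤ m ^ 2) :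
    |rellichRe lam Φ z| ≤ B * m ^ 2 ∧ |rellichIm lam Φ z| ≤ B * m ^ 2 := by
  have hx := (Complex.abs_re_le_norm z).trans hB
  have hy := (Complex.abs_im_le_norm z).trans hB
  have hB0 : 0 ≤ B := (norm_nonneg _).trans hB
  set p := dRe Φ z
  set q := dIm Φ z
  have h1 : |p ^ 2 - q ^ 2| ≤ m ^ 2 := abs_le.2 ⟨by nlinarith, by nlinarith⟩
  have h1' : |q ^ 2 - p ^ 2| ≤ m ^ 2 := by rwa [abs_sub_comm]
  have h2 : |p * q| ≤ m ^ 2 / 2 :=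
    abs_le.2 ⟨by nlinarith [sq_nonneg (p + q)], by nlinarith [sq_nonneg (p - q)]⟩
  have key : ∀ a b c d : ℝ, |a| ≤ B → |b| ≤ B → |c| ≤ m ^ 2 → |d| ≤ m ^ 2 / 2 →
      |a * c / 2 + b * d| ≤ B * m ^ 2 := fun a b c d ha hb hc hd => by
    have k1 : |a * c| ≤ B * m ^ 2 := by rw [abs_mul]; gcongr
    have k2 : |b * d| ≤ B * (m ^ 2 / 2) := by rw [abs_mul]; gcongr
    rw [abs_le] at *
    constructor <;> linarith
  refine ⟨?_, ?_⟩
  · rw [rellichRe, h0, show z.re * (p ^ 2 - q ^ 2) / 2 + z.im * (p * q) +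
      lam ^ 2 / 2 * (z.re * 0 ^ 2) = z.re * (p ^ 2 - q ^ 2) / 2 + z.im * (p * q) by ring]
    exact key _ _ _ _ hx hy h1 h2
  · rw [rellichIm, h0, show z.im * (q ^ 2 - p ^ 2) / 2 + z.re * (p * q) +
      lam ^ 2 / 2 * (z.im * 0 ^ 2) = z.im * (q ^ 2 - p ^ 2) / 2 + z.re * (p * q) by ring]
    exact key _ _ _ _ hy hx h1' h2

end Rellich

namespace BoundaryStrip

variable {W : Set ℂ} {Q : ℂ → ℂ} {l r B lam m : ℝ} {Φ : ℂ → ℝ}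

lemma norm_sub_le (h : BoundaryStrip W Q l r B) (s s' : ℝ) : ‖Q s - Q s'‖ ≤ |s - s'| := by
  have hd : ∀ x : ℝ, HasDerivAt (fun x : ℝ => Q x) (deriv Q x) x := fun x =>
    (h.analyticAt (by simpa using h.r_pos)).differentiableAt.hasDerivAt.comp_ofReal
  have := (convex_univ (𝕜 := ℝ)).norm_image_sub_le_of_norm_deriv_le (f := fun x : ℝ => Q x) (C := 1)
    (fun x _ => (hd x).differentiableAt) (fun x _ => by rw [(hd x).deriv, h.norm_deriv])
    (Set.mem_univ s') (Set.mem_univ s)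
  simpa using this

lemma periodic_ofReal (h : BoundaryStrip W Q l r B) : Function.Periodic (fun s : ℝ => Q s) l :=
  fun s => by simpa using h.periodic s

lemma exists_frontier_near (h : BoundaryStrip W Q l r B) {η : ℝ} (hη : 0 < η) {z : ℂ} (hz : z ∈ W)
    (hd : Metric.infDist z Wᶜ ≤ 2 * η) : ∃ s : ℝ, s ∈ Set.Ico 0 l ∧ ‖z - Q s‖ < 3 * η := by
  by_contra hcon
  push Not at hcon
  have hsub : Metric.ball z (3 * η) ⊆ W := by
    refine ball_subset_of_disjoint_frontier h.isOpen hz fun y hy => ?_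
    rw [h.frontier_eq] at hy
    obtain ⟨s, rfl⟩ := hy
    obtain ⟨s', hs', e⟩ := h.periodic_ofReal.exists_mem_Ico₀ h.l_pos s
    simp only at e ⊢
    rw [e]
    exact hcon s' hs'
  have hne : (Wᶜ).Nonempty := by
    refine ⟨Q (0 : ℝ), fun hW => ?_⟩
    have := h.ofReal_mem 0
    rw [h.isOpen.frontier_eq] at this
    exact this.2 hW
  have := (Metric.le_infDist (r := 3 * η) hne).2 fun y hy => by
    by_contra hlt
    rw [dist_comm] at hlt
    exact hy (hsub (Metric.mem_ball.2 (not_le.1 hlt)))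
  linarith

lemma volume_collar_le (h : BoundaryStrip W Q l r B) {η : ℝ} (hη : 0 < η) :
    volume.real {z | z ∈ W ∧ Metric.infDist z Wᶜ ≤ 2 * η} ≤ 16 * π * (l + η) * η := by
  have hl := h.l_pos
  set N := ⌈l / η⌉₊ with hN
  have hcover : {z | z ∈ W ∧ Metric.infDist z Wᶜ ≤ 2 * η} ⊆
      ⋃ j ∈ Finset.range N, Metric.closedBall (Q ((j * η : ℝ) : ℂ)) (4 * η) := by
    rintro z ⟨hz, hd⟩
    obtain ⟨s, ⟨hs0, hsl⟩, hs⟩ := h.exists_frontier_near hη hz hd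
    have hj1 := Nat.floor_le (show 0 ≤ s / η by positivity)
    have hj2 := Nat.lt_floor_add_one (s / η)
    rw [le_div_iff₀ hη] at hj1
    rw [div_lt_iff₀ hη] at hj2
    refine Set.mem_biUnion (x := ⌊s / η⌋₊) ?_ ?_
    · simp only [Finset.coe_range, Set.mem_Iio]
      rw [Nat.floor_lt (by positivity)]
      exact (div_lt_div_of_pos_right hsl hη).trans_le (Nat.le_ceil _)
    · rw [Metric.mem_closedBall, dist_eq_norm]
      have h1 := h.norm_sub_le s (⌊s / η⌋₊ * η)
      rw [abs_of_nonneg (by linarith)] at h1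
      have := norm_sub_le_norm_sub_add_norm_sub z (Q s) (Q ((⌊s / η⌋₊ * η : ℝ) : ℂ))
      linarith
  have hvol : ∀ c : ℂ, volume.real (Metric.closedBall c (4 * η)) = 16 * π * η ^ 2 := fun c => by
    rw [measureReal_def, Complex.volume_closedBall, ENNReal.toReal_mul, ENNReal.toReal_pow,
      ENNReal.toReal_ofReal (by positivity)]
    simp
    ring
  have hfin : volume (⋃ j ∈ Finset.range N, Metric.closedBall (Q ((j * η : ℝ) : ℂ)) (4 * η)) ≠ ⊤ := by
    refine ((measure_biUnion_finset_le _ _).trans_lt ?_).ne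
    exact ENNReal.sum_lt_top.2 fun j _ => Metric.isBounded_closedBall.measure_lt_top
  calc _ ≤ _ := measureReal_mono hcover hfin
    _ ≤ _ := measureReal_biUnion_finset_le _ _
    _ = N * (16 * π * η ^ 2) := by
      simp only [hvol, Finset.sum_const, Finset.card_range, nsmul_eq_mul]
    _ ≤ (l / η + 1) * (16 * π * η ^ 2) := by
      gcongr
      exact (Nat.ceil_lt_add_one (by positivity)).le
    _ = 16 * π * (l + η) * η := by field_simp

lemma gradient_sq (h : BoundaryStrip W Q l r B) (hm : DirichletMode W lam Φ) (s : ℝ) :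
    dRe Φ (Q s) ^ 2 + dIm Φ (Q s) ^ 2 = fderiv ℝ Φ (Q s) (Complex.I * deriv Q s) ^ 2 := by
  have hΦ := (hm.analytic _ (frontier_subset_closure (h.ofReal_mem s))).differentiableAt
  have hQ := (h.analyticAt (t := s) (by simpa using h.r_pos)).differentiableAt
  have ht : (deriv Q s).re * dRe Φ (Q s) + (deriv Q s).im * dIm Φ (Q s) = 0 := by
    have hcomp := hΦ.hasFDerivAt.comp_hasDerivAt s (hQ.hasDerivAt.comp_ofReal)
    have hz : (Φ ∘ fun s : ℝ => Q s) = fun _ => 0 := by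
      ext x; exact hm.zero _ (h.ofReal_mem x)
    rw [hz] at hcomp
    rw [← fderiv_apply_eq]
    exact hcomp.unique (hasDerivAt_const s 0)
  have hn : (deriv Q s).re ^ 2 + (deriv Q s).im ^ 2 = 1 := by
    have := h.norm_deriv s
    rw [← Complex.sq_norm_sub_sq_re, this]; ring
  rw [fderiv_apply_eq]
  simp only [Complex.mul_re, Complex.mul_im, Complex.I_re, Complex.I_im, zero_mul, one_mul,
    zero_sub, zero_add]
  linear_combination (-(dRe Φ (Q s) ^ 2 + dIm Φ (Q s) ^ 2)) * hn +
    ((deriv Q s).re * dRe Φ (Q s) + (deriv Q s).im * dIm Φ (Q s)) * ht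

/-- Rellich's inequality: the normal derivative controls the mass on an interior ball. -/
theorem rellich_le (h : BoundaryStrip W Q l r B) (hm : DirichletMode W lam Φ)
    (hmb : ∀ s : ℝ, |fderiv ℝ Φ (Q s) (Complex.I * deriv Q s)| ≤ m) {x : ℂ} {ρ a : ℝ} (hρ : 0 < ρ)
    (ha : 0 ≤ a) (hball : Metric.ball x ρ ⊆ W) (hx : ∀ y ∈ Metric.ball x ρ, a ≤ |Φ y|) :
    lam ^ 2 * a ^ 2 * ρ ^ 2 ≤ 256 * l * B * m ^ 2 := by
  have hl := h.l_pos
  have hclos : IsCompact (closure W) := h.isBounded.isCompact_closure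
  have hunif : ∀ V : ℂ → ℝ, (∀ z ∈ closure W, AnalyticAt ℝ V z) →
      (∀ s : ℝ, |V (Q s)| ≤ B * m ^ 2) → ∀ ε > 0, ∃ η₀ > 0, ∀ η, 0 < η → η ≤ η₀ →
      ∀ z ∈ W, Metric.infDist z Wᶜ ≤ 2 * η → |V z| ≤ B * m ^ 2 + ε := by
    intro V hV hb ε hε
    obtain ⟨η₁, hη₁, hu⟩ := Metric.uniformContinuousOn_iff.1
      (hclos.uniformContinuousOn_of_continuous
        fun z hz => (hV z hz).continuousAt.continuousWithinAt) ε hε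
    refine ⟨η₁ / 3, by positivity, fun η hη hle z hz hd => ?_⟩
    obtain ⟨s, -, hs⟩ := h.exists_frontier_near hη hz hd
    have := hu z (subset_closure hz) (Q s) (frontier_subset_closure (h.ofReal_mem s))
      (by rw [dist_eq_norm]; linarith)
    rw [Real.dist_eq] at this
    linarith [abs_sub_abs_le_abs_sub (V z) (V (Q s)), hb s]
  have hbd : ∀ s : ℝ, |rellichRe lam Φ (Q s)| ≤ B * m ^ 2 ∧ |rellichIm lam Φ (Q s)| ≤ B * m ^ 2 :=
    fun s => abs_rellich_le (hm.zero _ (h.ofReal_mem s))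
      (h.bound _ (by simpa using h.r_pos)) (by
        rw [h.gradient_sq hm]
        exact sq_le_sq' (abs_le.1 (hmb s)).1 (abs_le.1 (hmb s)).2)
  have hR : ∀ z ∈ closure W, AnalyticAt ℝ (rellichRe lam Φ) z := fun z hz =>
    analyticAt_rellichRe (hm.analytic z hz)
  have hI : ∀ z ∈ closure W, AnalyticAt ℝ (rellichIm lam Φ) z := fun z hz =>
    analyticAt_rellichIm (hm.analytic z hz)
  have key : ∀ ε > 0, lam ^ 2 * a ^ 2 * ρ ^ 2 ≤ 256 * l * (B * m ^ 2 + ε) := by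
    intro ε hε
    obtain ⟨η₁, hη₁, h1⟩ := hunif _ hR (fun s => (hbd s).1) ε hε
    obtain ⟨η₂, hη₂, h2⟩ := hunif _ hI (fun s => (hbd s).2) ε hε
    obtain ⟨η, hη, hηl, hηρ, k1, k2⟩ : ∃ η > 0, η ≤ l ∧ 4 * η ≤ ρ ∧ η ≤ η₁ ∧ η ≤ η₂ :=
      ⟨min (min l (ρ / 4)) (min η₁ η₂), by positivity, (min_le_left _ _).trans (min_le_left _ _),
        by linarith [(min_le_left (min l (ρ / 4)) (min η₁ η₂)).trans (min_le_right _ _)],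
        (min_le_right _ _).trans (min_le_left _ _), (min_le_right _ _).trans (min_le_right _ _)⟩
    have i1 := abs_integral_fderiv_mul_distCutoff_le h.isBounded hη hR (h1 η hη k1)
      (v := 1) (by simp)
    have i2 := abs_integral_fderiv_mul_distCutoff_le h.isBounded hη hI (h2 η hη k2)
      (v := Complex.I) (by simp)
    have hS : 0 ≤ B * m ^ 2 + ε := by have := h.B_nonneg; positivity
    have hcol : η⁻¹ * (B * m ^ 2 + ε) * volume.real {z | z ∈ W ∧ Metric.infDist z Wᶜ ≤ 2 * η} ≤
        32 * π * l * (B * m ^ 2 + ε) := by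
      calc _ ≤ η⁻¹ * (B * m ^ 2 + ε) * (16 * π * (l + η) * η) := by
            gcongr; exact h.volume_collar_le hη
        _ = 16 * π * (l + η) * (B * m ^ 2 + ε) := by field_simp
        _ ≤ 16 * π * (l + l) * (B * m ^ 2 + ε) := by gcongr
        _ = _ := by ring
    have hcont : ∀ {V : ℂ → ℝ}, (∀ z ∈ closure W, AnalyticAt ℝ V z) → ∀ v : ℂ,
        Integrable fun z => fderiv ℝ V z v * distCutoff W η z := fun hV v =>
      integrable_mul_distCutoff hη (fun z hz => (((hV z (subset_closure hz)).fderiv.continuousAt).clm_apply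
        continuousAt_const).continuousWithinAt) h.isOpen h.isBounded
    have hsum : ∫ z, (lam ^ 2 * Φ z ^ 2) * distCutoff W η z =
        (∫ z, fderiv ℝ (rellichRe lam Φ) z 1 * distCutoff W η z) +
          ∫ z, fderiv ℝ (rellichIm lam Φ) z Complex.I * distCutoff W η z := by
      rw [← integral_add (hcont hR 1) (hcont hI Complex.I)]
      refine integral_congr_ae (.of_forall fun z => ?_)
      simp only
      by_cases hz : z ∈ W
      · rw [← add_mul, div_rellich (hm.analytic z (subset_closure hz)) (hm.eigen z hz)]
      · have : distCutoff W η z = 0 := image_eq_zero_of_notMem_tsupport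
          fun hz' => hz (tsupport_distCutoff_subset hη hz')
        rw [this]; ring
    have hint : Integrable fun z => (lam ^ 2 * Φ z ^ 2) * distCutoff W η z :=
      integrable_mul_distCutoff hη (fun z hz => by
        have := (hm.analytic z (subset_closure hz)).continuousAt
        exact ((this.pow 2).const_mul _).continuousWithinAt) h.isOpen h.isBounded
    have hnn : 0 ≤ᵐ[volume] fun z => (lam ^ 2 * Φ z ^ 2) * distCutoff W η z :=
      .of_forall fun z => mul_nonneg (by positivity) (distCutoff_nonneg z)
    have hlow : volume.real (Metric.ball x (ρ / 2)) • (lam ^ 2 * a ^ 2) ≤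
        ∫ z in Metric.ball x (ρ / 2), (lam ^ 2 * Φ z ^ 2) * distCutoff W η z := by
      refine setIntegral_ge_of_const_le measurableSet_ball measure_ball_lt_top.ne (fun z hz => ?_)
        hint.integrableOn
      have hzρ : z ∈ Metric.ball x ρ := Metric.ball_subset_ball (by linarith) hz
      have hne : (Wᶜ).Nonempty := by
        refine ⟨Q (0 : ℝ), fun hW => ?_⟩
        have := h.ofReal_mem 0
        rw [h.isOpen.frontier_eq] at this
        exact this.2 hW
      rw [distCutoff_eq_one hη, mul_one]
      · gcongr lam ^ 2 * ?_
        rw [← sq_abs (Φ z)]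
        gcongr
        exact hx z hzρ
      · refine (Metric.le_infDist hne).2 fun y hy => ?_
        by_contra hlt
        refine hy (hball ?_)
        rw [Metric.mem_ball] at hz ⊢
        rw [dist_comm] at hlt
        linarith [dist_triangle y z x, not_le.1 hlt]
    have hvol : volume.real (Metric.ball x (ρ / 2)) = π * ρ ^ 2 / 4 := by
      rw [measureReal_def, Complex.volume_ball, ENNReal.toReal_mul, ENNReal.toReal_pow,
        ENNReal.toReal_ofReal (by positivity)]
      simp
      ring
    have hle := setIntegral_le_integral (s := Metric.ball x (ρ / 2)) hint hnn
    rw [hsum] at hle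
    rw [hvol, smul_eq_mul] at hlow
    have hfin : π * (lam ^ 2 * a ^ 2 * ρ ^ 2) ≤ π * (256 * l * (B * m ^ 2 + ε)) := by
      have := (abs_le.1 i1).2
      have := (abs_le.1 i2).2
      linarith
    exact le_of_mul_le_mul_left hfin Real.pi_pos
  refine le_of_forall_pos_le_add fun ε hε => ?_
  have := key (ε / (256 * l)) (by positivity)
  refine this.trans (le_of_eq ?_)
  field_simp

end BoundaryStrip

/-- Schwarz's lemma with several zeros (division by Blaschke factors). -/
lemma norm_zero_le_mul_pow_card {U : Set ℂ} (hU : IsOpen U) (hcl : Metric.closedBall 0 1 ⊆ U)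
    {ρ M : ℝ} (hρ : ρ < 1) (S : Finset ℂ) :
    ∀ G : ℂ → ℂ, DifferentiableOn ℂ G U → (∀ z ∈ Metric.sphere (0 : ℂ) 1, ‖G z‖ ≤ M) →
      (∀ z ∈ S, ‖z‖ ≤ ρ ∧ G z = 0) → ‖G 0‖ ≤ M * ρ ^ S.card := by
  classical
  induction S using Finset.induction_on with
  | empty =>
    intro G hG hM _
    have hd : DiffContOnCl ℂ G (Metric.ball 0 1) := hG.diffContOnCl_ball hcl
    have := Complex.norm_le_of_forall_mem_frontier_norm_le Metric.isBounded_ball hd (C := M)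
      (fun z hz => hM z (by rwa [frontier_ball _ one_ne_zero] at hz))
      (z := 0) (subset_closure (by simp))
    simpa using this
  | insert a S haS ih =>
    intro G hG hM hS
    obtain ⟨haρ, haG⟩ := hS a (by simp)
    have haU : a ∈ U := hcl (by simpa using haρ.trans hρ.le)
    set D := dslope G a with hD
    have hDd : DifferentiableOn ℂ D U :=
      (Complex.differentiableOn_dslope (hU.mem_nhds haU)).2 hG
    have hGD : ∀ w, (w - a) * D w = G w := fun w => by
      have := sub_smul_dslope G a w
      rwa [haG, sub_zero, smul_eq_mul] at this
    have key := ih (fun w => (1 - (starRingEnd ℂ) a * w) * D w)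
      (DifferentiableOn.mul (by fun_prop) hDd)
      (fun w hw => by
        have hw1 : ‖w‖ = 1 := by simpa using hw
        have e : 1 - (starRingEnd ℂ) a * w = w * (starRingEnd ℂ) (w - a) := by
          have : w * (starRingEnd ℂ) w = 1 := by
            rw [Complex.mul_conj, Complex.normSq_eq_norm_sq, hw1]; norm_num
          rw [map_sub, mul_sub, this]; ring
        have : ‖(1 - (starRingEnd ℂ) a * w) * D w‖ = ‖G w‖ := by
          rw [← hGD w, norm_mul, norm_mul, e, norm_mul, hw1, RCLike.norm_conj, one_mul]
        simpa only [this] using hM w hw)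
      (fun w hw => by
        obtain ⟨h1, h2⟩ := hS w (by simp [hw])
        refine ⟨h1, ?_⟩
        have hne : w - a ≠ 0 := sub_ne_zero.2 fun h => haS (h ▸ hw)
        have : (w - a) * D w = 0 := by rw [hGD, h2]
        rcases mul_eq_zero.1 this with h | h
        · exact absurd h hne
        · simp [h])
    have h0 : ‖G 0‖ = ‖a‖ * ‖D 0‖ := by rw [← hGD 0, norm_mul, zero_sub, norm_neg]
    simp only [mul_zero, sub_zero, one_mul] at key
    rw [h0, Finset.card_insert_of_notMem haS, pow_succ]
    calc ‖a‖ * ‖D 0‖ ≤ ρ * (M * ρ ^ S.card) :=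
          mul_le_mul haρ key (norm_nonneg _) ((norm_nonneg a).trans haρ)
      _ = _ := by ring

lemma norm_cayley_lt_one {p : ℂ} (hp : 0 < p.re) : ‖(p - 1) / (p + 1)‖ < 1 := by
  have h1 : p + 1 ≠ 0 := fun h => by
    have := congrArg Complex.re h
    simp at this; linarith
  rw [norm_div, div_lt_one (norm_pos_iff.2 h1)]
  refine lt_of_pow_lt_pow_left₀ 2 (norm_nonneg _) ?_
  rw [← Complex.normSq_eq_norm_sq, ← Complex.normSq_eq_norm_sq, Complex.normSq_apply,
    Complex.normSq_apply]
  simp only [Complex.sub_re, Complex.add_re, Complex.one_re, Complex.sub_im, Complex.add_im,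
    Complex.one_im]
  nlinarith

lemma re_cayley_pos {w : ℂ} (hw : ‖w‖ < 1) : 0 < ((1 + w) / (1 - w)).re := by
  have h1 : (1 - w) ≠ 0 := sub_ne_zero.2 fun h => by rw [← h] at hw; simp at hw
  have hw2 : w.re * w.re + w.im * w.im < 1 := by
    rw [← Complex.normSq_apply, Complex.normSq_eq_norm_sq]
    nlinarith [norm_nonneg w]
  rw [Complex.div_re, ← add_div]
  refine div_pos ?_ (Complex.normSq_pos.2 h1)
  simp only [Complex.sub_re, Complex.add_re, Complex.one_re, Complex.sub_im, Complex.add_im,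
    Complex.one_im]
  nlinarith

lemma re_exp_pos {u : ℂ} (hu : |u.im| ≤ 1) : 0 < (Complex.exp u).re := by
  rw [Complex.exp_re]
  obtain ⟨h1, h2⟩ := abs_le.1 hu
  have := Real.pi_gt_three
  exact mul_pos (Real.exp_pos _) (Real.cos_pos_of_mem_Ioo ⟨by linarith, by linarith⟩)

lemma log_cayley_exp {u : ℂ} (hu : |u.im| ≤ 1) :
    Complex.log ((1 + (Complex.exp u - 1) / (Complex.exp u + 1)) /
      (1 - (Complex.exp u - 1) / (Complex.exp u + 1))) = u := by
  have h1 : Complex.exp u + 1 ≠ 0 := fun h => by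
    have h2 := congrArg Complex.re h
    have := re_exp_pos hu
    rw [Complex.add_re, Complex.one_re, Complex.zero_re] at h2; linarith
  have e : (1 + (Complex.exp u - 1) / (Complex.exp u + 1)) /
      (1 - (Complex.exp u - 1) / (Complex.exp u + 1)) = Complex.exp u := by
    have e1 : 1 + (Complex.exp u - 1) / (Complex.exp u + 1)
        = 2 * Complex.exp u / (Complex.exp u + 1) := by field_simp; ring
    have e2 : 1 - (Complex.exp u - 1) / (Complex.exp u + 1) = 2 / (Complex.exp u + 1) := by
      field_simp; ring
    rw [e1, e2, div_div_div_cancel_right₀ h1, mul_div_cancel_left₀ _ two_ne_zero]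
  obtain ⟨h1, h2⟩ := abs_le.1 hu
  have := Real.pi_gt_three
  rw [e, Complex.log_exp (by linarith) (by linarith)]

/-- A uniform bound `< 1` for the conformal image in the unit disc of a compact rectangle. -/
lemma exists_cayley_exp_le (a : ℝ) : ∃ ρ : ℝ, 0 < ρ ∧ ρ < 1 ∧
    ∀ u : ℂ, |u.re| ≤ a → |u.im| ≤ 1 → ‖(Complex.exp u - 1) / (Complex.exp u + 1)‖ ≤ ρ := by
  have hK : IsCompact (Set.Icc (-a) a ×ℂ Set.Icc (-1 : ℝ) 1) :=
    isCompact_Icc.reProdIm isCompact_Icc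
  have hc : ContinuousOn (fun u : ℂ => ‖(Complex.exp u - 1) / (Complex.exp u + 1)‖)
      (Set.Icc (-a) a ×ℂ Set.Icc (-1 : ℝ) 1) := by
    refine ContinuousOn.norm (ContinuousOn.div (by fun_prop) (by fun_prop) fun u hu h => ?_)
    have h2 := congrArg Complex.re h
    have := re_exp_pos (abs_le.2 (Complex.mem_reProdIm.1 hu).2)
    rw [Complex.add_re, Complex.one_re, Complex.zero_re] at h2; linarith
  rcases Set.eq_empty_or_nonempty (Set.Icc (-a) a ×ℂ Set.Icc (-1 : ℝ) 1) with he | hne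
  · refine ⟨1 / 2, by norm_num, by norm_num, fun u h1 h2 => ?_⟩
    have : u ∈ (∅ : Set ℂ) := he ▸ Complex.mem_reProdIm.2 ⟨abs_le.1 h1, abs_le.1 h2⟩
    exact absurd this (Set.notMem_empty u)
  · obtain ⟨v, hv, hmax⟩ := hK.exists_isMaxOn hne hc
    refine ⟨max (1 / 2) ‖(Complex.exp v - 1) / (Complex.exp v + 1)‖, by positivity,
      max_lt (by norm_num) (norm_cayley_lt_one
        (re_exp_pos (abs_le.2 (Complex.mem_reProdIm.1 hv).2))), fun u h1 h2 => ?_⟩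
    exact le_max_of_le_right (hmax (Complex.mem_reProdIm.2 ⟨abs_le.1 h1, abs_le.1 h2⟩))

/-- A bounded holomorphic function on a strip which is not too small at some real point has few
zeros in a rectangle. -/
theorem exists_zero_count (l : ℝ) {R : ℝ} (hR : 0 < R) : ∃ C > 0, ∀ (F : ℂ → ℂ) (A s Λ : ℝ),
    DifferentiableOn ℂ F {t | |t.im| < R} → (∀ t : ℂ, |t.im| ≤ R / 2 → ‖F t‖ ≤ A) → |s| ≤ l →
    0 < A → A * Real.exp (-Λ) ≤ ‖F s‖ →
    {t : ℂ | |t.re| ≤ l ∧ |t.im| ≤ R / 8 ∧ F t = 0}.Finite ∧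
    ({t : ℂ | |t.re| ≤ l ∧ |t.im| ≤ R / 8 ∧ F t = 0}.ncard : ℝ) ≤ C * Λ := by
  classical
  obtain ⟨ρ, hρ0, hρ1, hρ⟩ := exists_cayley_exp_le (2 * l / (R / 8))
  have hsq0 : 0 < √ρ := Real.sqrt_pos.2 hρ0
  have hsq1 : √ρ < 1 := by rw [Real.sqrt_lt' one_pos]; simpa using hρ1
  have hlog : 0 < -Real.log (√ρ) := neg_pos.2 (Real.log_neg hsq0 hsq1)
  refine ⟨(-Real.log (√ρ))⁻¹, inv_pos.2 hlog, fun F A s Λ hF hA hs hA0 hsΛ => ?_⟩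
  set Z : Set ℂ := {t : ℂ | |t.re| ≤ l ∧ |t.im| ≤ R / 8 ∧ F t = 0} with hZ
  have hcard : ∀ S : Finset ℂ, (S : Set ℂ) ⊆ Z → (S.card : ℝ) ≤ (-Real.log (√ρ))⁻¹ * Λ := by
    intro S hS
    set g : ℂ → ℂ := fun z => s + (R / 8 : ℝ) * Complex.log ((1 + √ρ * z) / (1 - √ρ * z)) with hg
    have hU : IsOpen {z : ℂ | ‖(√ρ : ℂ) * z‖ < 1} :=
      isOpen_lt (by fun_prop) continuous_const
    have hgim : ∀ z : ℂ, ‖(√ρ : ℂ) * z‖ < 1 → |(g z).im| ≤ R / 2 := by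
      intro z hz
      have h1 := (Complex.abs_arg_lt_pi_div_two_iff (z := (1 + √ρ * z) / (1 - √ρ * z))).2
        (Or.inl (re_cayley_pos hz))
      have h2 := Real.pi_lt_four
      have h3 : (g z).im = R / 8 * Complex.arg ((1 + √ρ * z) / (1 - √ρ * z)) := by
        rw [hg]
        simp only [Complex.add_im, Complex.ofReal_im, Complex.im_ofReal_mul, Complex.log_im,
          zero_add]
      rw [h3, abs_mul, abs_of_pos (by positivity : 0 < R / 8)]
      nlinarith
    have hgd : DifferentiableOn ℂ g {z : ℂ | ‖(√ρ : ℂ) * z‖ < 1} := by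
      intro z hz
      have hz' : ‖(√ρ : ℂ) * z‖ < 1 := hz
      have hne : (1 - √ρ * z : ℂ) ≠ 0 := sub_ne_zero.2 fun h => by rw [← h] at hz'; simp at hz'
      have hsl : (1 + √ρ * z) / (1 - √ρ * z) ∈ Complex.slitPlane := Or.inl (re_cayley_pos hz')
      refine DifferentiableAt.differentiableWithinAt ?_
      have hq : DifferentiableAt ℂ (fun z : ℂ => (1 + √ρ * z) / (1 - √ρ * z)) z :=
        DifferentiableAt.fun_div (by fun_prop) (by fun_prop) hne
      exact ((hq.clog hsl).const_mul _).const_add _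
    have hcl : Metric.closedBall (0 : ℂ) 1 ⊆ {z : ℂ | ‖(√ρ : ℂ) * z‖ < 1} := by
      intro z hz
      have hz1 : ‖z‖ ≤ 1 := by simpa using hz
      simp only [Set.mem_ofPred_eq, norm_mul, Complex.norm_real, Real.norm_eq_abs,
        abs_of_pos hsq0]
      nlinarith
    set w : ℂ → ℂ := fun t => (Complex.exp ((t - s) / (R / 8 : ℝ)) - 1) /
      (Complex.exp ((t - s) / (R / 8 : ℝ)) + 1) with hw
    have hR8 : ((R / 8 : ℝ) : ℂ) ≠ 0 := Complex.ofReal_ne_zero.2 (by positivity)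
    have hsqC : (√ρ : ℂ) ≠ 0 := Complex.ofReal_ne_zero.2 hsq0.ne'
    have him : ∀ t ∈ Z, |((t - s) / (R / 8 : ℝ) : ℂ).im| ≤ 1 := by
      intro t ht
      rw [Complex.div_ofReal_im, abs_div, abs_of_pos (by positivity : 0 < R / 8),
        div_le_one (by positivity)]
      simpa using ht.2.1
    have hre : ∀ t ∈ Z, |((t - s) / (R / 8 : ℝ) : ℂ).re| ≤ 2 * l / (R / 8) := by
      intro t ht
      rw [Complex.div_ofReal_re, abs_div, abs_of_pos (by positivity : 0 < R / 8)]
      gcongr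
      rw [Complex.sub_re, Complex.ofReal_re]
      have h1 := ht.1
      have := abs_sub t.re s
      linarith
    have hgw : ∀ t ∈ Z, g (w t / √ρ) = t := by
      intro t ht
      have := log_cayley_exp (him t ht)
      simp only [hg, hw, mul_div_cancel₀ _ hsqC, this]
      rw [mul_div_cancel₀ _ hR8]; ring
    have hinj : Set.InjOn (fun t => w t / √ρ) (S : Set ℂ) := fun a ha b hb hab => by
      rw [← hgw a (hS ha), ← hgw b (hS hb)]; exact congrArg g hab
    have hbd := norm_zero_le_mul_pow_card hU hcl hsq1 (S.image fun t => w t / √ρ)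
      (fun z => F (g z))
      (hF.fun_comp hgd fun z hz => lt_of_le_of_lt (hgim z hz) (by linarith))
      (fun z hz => hA _ (hgim z (hcl (Metric.sphere_subset_closedBall hz))))
      (fun z hz => by
        obtain ⟨t, ht, rfl⟩ := Finset.mem_image.1 hz
        refine ⟨?_, by rw [hgw t (hS ht)]; exact (hS ht).2.2⟩
        rw [norm_div, Complex.norm_real, Real.norm_eq_abs, abs_of_pos hsq0, div_le_iff₀ hsq0,
          Real.mul_self_sqrt hρ0.le]
        exact hρ _ (hre t (hS ht)) (him t (hS ht)))
    have hg0 : g 0 = s := by simp [hg]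
    rw [Finset.card_image_of_injOn hinj, hg0] at hbd
    have h1 : Real.exp (-Λ) ≤ √ρ ^ S.card := le_of_mul_le_mul_left (hsΛ.trans hbd) hA0
    have h2 := Real.log_le_log (Real.exp_pos _) h1
    rw [Real.log_exp, Real.log_pow] at h2
    rw [inv_mul_eq_div, le_div_iff₀ hlog]
    linarith
  have hfin : Z.Finite := by
    by_contra hinf
    obtain ⟨n, hn⟩ := exists_nat_gt ((-Real.log (√ρ))⁻¹ * Λ)
    obtain ⟨S, hS, hSn⟩ := Set.Infinite.exists_subset_card_eq hinf n
    have := hcard S hS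
    rw [hSn] at this
    linarith
  refine ⟨hfin, ?_⟩
  rw [Set.ncard_eq_toFinset_card _ hfin]
  exact hcard _ (by simp)

/-- The sup norm of a Dirichlet mode is controlled by the maximum of its normal derivative. -/
lemma BoundaryCollar.exists_normal_lower {W : Set ℂ} {Q : ℂ → ℂ} {l r B δ r₀ : ℝ}
    (h : BoundaryCollar W Q l r B δ r₀) :
    ∃ lam₀ > 0, ∃ D > 0, ∀ lam Φ x m, DirichletMode W lam Φ → x ∈ W → 0 < |Φ x| →
      (∀ z ∈ closure W, |Φ z| ≤ |Φ x|) → 0 ≤ m →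
      (∀ s : ℝ, |fderiv ℝ Φ (Q s) (Complex.I * deriv Q s)| ≤ m) →
      lam₀ ≤ lam ∧ D * |Φ x| ≤ m := by
  obtain ⟨c, hc, hball⟩ := h.exists_ball
  obtain ⟨R, hR⟩ := h.isBounded.closure.exists_norm_le
  have hl := h.l_pos
  have hB := h.toBoundaryStrip.B_nonneg
  set R₀ := |R| + 1 with hR₀
  have hR₀0 : 0 < R₀ := by positivity
  set lam₀ := 2 / R₀ with hlam₀
  have hlam₀0 : 0 < lam₀ := by positivity
  set κ := lam₀ / (1 + lam₀) with hκ
  have hκ0 : 0 < κ := by positivity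
  set E := 1 + 1024 * l * B with hE
  have hE1 : 1 ≤ E := by rw [hE]; nlinarith [mul_nonneg hl.le hB]
  have hE0 : 0 < E := by linarith
  refine ⟨lam₀, hlam₀0, κ * c / E, by positivity, fun lam Φ x m hm hx h0 hmax hm0 hmb => ?_⟩
  have hlam := hm.lam_pos
  have hle : lam₀ ≤ lam := by
    have h4 := hm.four_le (R := R₀)
      (fun z hz => (hR z hz).trans ((le_abs_self R).trans (by rw [hR₀]; linarith))) hx h0 hmax
    rw [hlam₀, div_le_iff₀ hR₀0]
    have : (2 : ℝ) ^ 2 ≤ (lam * R₀) ^ 2 := by rw [mul_pow]; linarith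
    exact le_of_sq_le_sq this (by positivity)
  refine ⟨hle, ?_⟩
  obtain ⟨hb1, hb2⟩ := hball lam Φ hm x hx hmax h0
  have hrel := h.toBoundaryStrip.rellich_le hm hmb (by positivity : 0 < c / (1 + lam))
    (by positivity) hb1 hb2
  have hκle : κ ≤ lam / (1 + lam) := by
    rw [hκ, div_le_div_iff₀ (by positivity) (by positivity)]; nlinarith
  have h1 : (κ * c * |Φ x|) ^ 2 ≤ (E * m) ^ 2 := by
    calc (κ * c * |Φ x|) ^ 2 ≤ (lam / (1 + lam) * c * |Φ x|) ^ 2 := by gcongr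
      _ = 4 * (lam ^ 2 * (|Φ x| / 2) ^ 2 * (c / (1 + lam)) ^ 2) := by
        field_simp; ring
      _ ≤ 4 * (256 * l * B * m ^ 2) := by gcongr
      _ = (1024 * l * B) * m ^ 2 := by ring
      _ ≤ E ^ 2 * m ^ 2 := by
        gcongr
        nlinarith
      _ = _ := by ring
  have h2 : κ * c * |Φ x| ≤ E * m := le_of_sq_le_sq h1 (by positivity)
  rw [div_mul_eq_mul_div, div_le_iff₀ hE0]
  linarith

theorem BoundaryCollar.exists_nodal_bound {W : Set ℂ} {Q : ℂ → ℂ} {l r B δ r₀ : ℝ}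
    (h : BoundaryCollar W Q l r B δ r₀) :
    ∃ ε > 0, ∃ C > 0, ∀ lam Φ, DirichletMode W lam Φ → ∃ F : ℂ → ℂ,
      DifferentiableOn ℂ F {t | |t.im| < ε} ∧ (∀ t : ℂ, F (t + l) = F t) ∧
      (∀ s : ℝ, F s = (fderiv ℝ Φ (Q s) (Complex.I * deriv Q s) : ℝ)) ∧
      {t : ℂ | |t.re| ≤ l ∧ |t.im| ≤ ε / 2 ∧ F t = 0}.Finite ∧
      ({t : ℂ | |t.re| ≤ l ∧ |t.im| ≤ ε / 2 ∧ F t = 0}.ncard : ℝ) ≤ C * lam := by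
  obtain ⟨R, hR, C₁, hC₁, hext⟩ := h.exists_extension
  obtain ⟨lam₀, hlam₀, D, hD, hlow⟩ := h.exists_normal_lower
  have hl := h.l_pos
  have hδ := h.δ_pos
  obtain ⟨C₂, hC₂, hcount⟩ := exists_zero_count l hR
  set L := max 0 (Real.log (C₁ / D)) with hL
  have hL0 : 0 ≤ L := le_max_left _ _
  have hexpL : Real.exp (-L) ≤ D / C₁ := by
    rw [← Real.exp_log (by positivity : 0 < D / C₁), Real.exp_le_exp,
      ← inv_div, Real.log_inv, neg_le_neg_iff]
    exact le_max_right _ _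
  refine ⟨R / 4, by positivity, C₂ * (δ + L / lam₀), by positivity, fun lam Φ hm => ?_⟩
  obtain ⟨x, hx, h0, hmax⟩ := hm.exists_max h.isBounded
  obtain ⟨F, hF, hFs, hFb, hFp⟩ := hext lam Φ _ hm hmax
  have hcont : Continuous fun s : ℝ => ‖F s‖ := by
    have : ContinuousOn F {t | |t.im| < R} := hF.continuousOn
    exact (this.comp_continuous Complex.continuous_ofReal fun s => by simpa using hR).norm
  obtain ⟨s, hs, hsmax⟩ := (isCompact_Icc (a := (0 : ℝ)) (b := l)).exists_isMaxOn
    ⟨0, by simp [hl.le]⟩ hcont.continuousOn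
  have hper : Function.Periodic (fun s : ℝ => ‖F s‖) l := fun s => by
    simp only [Complex.ofReal_add, hFp]
  have hall : ∀ s' : ℝ, ‖F s'‖ ≤ ‖F s‖ := fun s' => by
    obtain ⟨y, hy, hys⟩ := hper.exists_mem_Ico₀ hl s'
    have : ‖F s'‖ = ‖F y‖ := hys
    rw [this]
    exact hsmax (Set.Ico_subset_Icc_self hy)
  obtain ⟨hle, hDm⟩ := hlow lam Φ x ‖F s‖ hm hx h0 hmax (norm_nonneg _) fun s' => by
    have := hall s'
    rwa [hFs s', Complex.norm_real, Real.norm_eq_abs] at this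
  obtain ⟨hfin, hcard⟩ := hcount F (C₁ * Real.exp (δ * lam) * |Φ x|) s (δ * lam + L) hF hFb
    (abs_le.2 ⟨by linarith [hs.1], hs.2⟩) (by positivity) (by
      calc C₁ * Real.exp (δ * lam) * |Φ x| * Real.exp (-(δ * lam + L))
          = C₁ * |Φ x| * Real.exp (-L) := by
            rw [neg_add, Real.exp_add, Real.exp_neg (δ * lam)]; field_simp
        _ ≤ C₁ * |Φ x| * (D / C₁) := by gcongr
        _ = D * |Φ x| := by field_simp
        _ ≤ _ := hDm)
  have hsub : {t : ℂ | |t.im| < R / 4} ⊆ {t : ℂ | |t.im| < R} := fun t ht => by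
    rw [Set.mem_ofPred_eq] at ht ⊢
    linarith
  refine ⟨F, hF.mono hsub, hFp, hFs, ?_⟩
  rw [show R / 4 / 2 = R / 8 by ring]
  refine ⟨hfin, hcard.trans ?_⟩
  rw [mul_assoc]
  refine mul_le_mul_of_nonneg_left ?_ hC₂.le
  have : L ≤ L / lam₀ * lam := by
    rw [div_mul_eq_mul_div, le_div_iff₀ hlam₀]
    gcongr
  linarith

/-- The standard isometry between `ℂ` and the Euclidean plane. -/
def planeIso : ℂ ≃ₗᵢ[ℝ] E2 := Complex.orthonormalBasisOneI.repr

lemma planeIso_one : planeIso 1 = EuclideanSpace.single 0 1 := by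
  have := Complex.orthonormalBasisOneI.repr_self 0
  rwa [Complex.coe_orthonormalBasisOneI] at this

lemma planeIso_I : planeIso Complex.I = EuclideanSpace.single 1 1 := by
  have := Complex.orthonormalBasisOneI.repr_self 1
  rwa [Complex.coe_orthonormalBasisOneI] at this

lemma fderiv_comp_planeIso (u : E2 → ℝ) (z w : ℂ) :
    fderiv ℝ (fun z => u (planeIso z)) z w = fderiv ℝ u (planeIso z) (planeIso w) := by
  have := planeIso.toContinuousLinearEquiv.comp_right_fderiv (f := u) (x := z)
  exact congrArg (fun T : ℂ →L[ℝ] ℝ => T w) this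

lemma lapC_comp_planeIso (u : E2 → ℝ) (z : ℂ) :
    lapC (fun z => u (planeIso z)) z = lap u (planeIso z) := by
  have h1 : dRe (fun z => u (planeIso z)) =
      fun z => (fun y => fderiv ℝ u y (EuclideanSpace.single 0 1)) (planeIso z) := by
    funext z
    simp only [dRe, fderiv_comp_planeIso, planeIso_one]
  have h2 : dIm (fun z => u (planeIso z)) =
      fun z => (fun y => fderiv ℝ u y (EuclideanSpace.single 1 1)) (planeIso z) := by
    funext z
    simp only [dIm, fderiv_comp_planeIso, planeIso_I]
  rw [lapC, h1, h2, dRe, dIm, fderiv_comp_planeIso fun y => fderiv ℝ u y _,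
    fderiv_comp_planeIso fun y => fderiv ℝ u y _, lap, Fin.sum_univ_two, planeIso_one, planeIso_I]

lemma closure_preimage_planeIso (Ω : Set E2) :
    closure (planeIso ⁻¹' Ω) = planeIso ⁻¹' closure Ω :=
  (planeIso.toHomeomorph.preimage_closure Ω).symm

lemma frontier_preimage_planeIso (Ω : Set E2) :
    frontier (planeIso ⁻¹' Ω) = planeIso ⁻¹' frontier Ω :=
  (planeIso.toHomeomorph.preimage_frontier Ω).symm

lemma IsDirichletEigenfunction.dirichletMode {Ω : Set E2} {B : BoundaryParam Ω} {lam : ℝ}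
    {φ : E2 → ℝ} (h : IsDirichletEigenfunction B lam φ) (hlam : 0 < lam) :
    DirichletMode (planeIso ⁻¹' Ω) lam (fun z => φ (planeIso z)) where
  lam_pos := hlam
  analytic z hz := by
    obtain ⟨U, -, hU, hφ⟩ := h.analytic
    rw [closure_preimage_planeIso] at hz
    exact AnalyticAt.comp (g := φ) (f := fun z => planeIso z) (hφ _ (hU hz))
      (planeIso.toContinuousLinearEquiv.toContinuousLinearMap.analyticAt z)
  nontrivial := by
    obtain ⟨x, hx, h0⟩ := h.nontrivial
    exact ⟨planeIso.symm x, by simpa using hx, by simpa using h0⟩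
  eigen z hz := by rw [lapC_comp_planeIso]; exact h.eigen _ hz
  zero z hz := by
    rw [frontier_preimage_planeIso, Set.mem_preimage, ← B.range_eq] at hz
    obtain ⟨s, hs⟩ := hz
    rw [← hs]; exact h.dirichlet s

/-- A complex model of an analytic plane domain: the boundary parametrization extends to a strip,
and up to reversing the orientation, the inner side is the upper one. -/
lemma BoundaryParam.exists_collar {Ω : Set E2} (hΩ : IsPlaneDomain Ω) (B : BoundaryParam Ω)
    (hB : B.IsAnalytic) : ∃ (Q : ℂ → ℂ) (r b σ δ r₀ : ℝ), (σ = 1 ∨ σ = -1) ∧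
      BoundaryCollar (planeIso ⁻¹' Ω) Q B.len r b δ r₀ ∧
      ∀ s : ℝ, Q ((σ * s : ℝ) : ℂ) = planeIso.symm (B.q s) ∧
        Complex.I * deriv Q ((σ * s : ℝ) : ℂ) = planeIso.symm (B.ν s) := by
  have hf : ∀ s, AnalyticAt ℝ (fun s => planeIso.symm (B.q s)) s := fun s =>
    AnalyticAt.comp (g := fun x => planeIso.symm x) (f := B.q)
      (planeIso.symm.toContinuousLinearEquiv.toContinuousLinearMap.analyticAt _)
      (hB s (Set.mem_univ s))
  have hp : Function.Periodic (fun s => planeIso.symm (B.q s)) B.len := fun s => by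
    simp only [B.periodic s]
  obtain ⟨A, r, hr, hA⟩ := exists_cauchy_bounds B.len_pos hf hp
  obtain ⟨Q, hQ, hQs, hQb, hQp⟩ := exists_strip_extension hr hf hA
  have hd : ∀ s : ℝ, deriv Q s = planeIso.symm (B.qd s) := fun s => by
    have h1 : DifferentiableAt ℂ Q s :=
      hQ.differentiableAt ((isOpen_strip r).mem_nhds (by simpa using hr))
    have h2 := h1.hasDerivAt.comp_ofReal
    simp only [hQs] at h2
    have h3 : HasDerivAt (fun s => planeIso.symm (B.q s)) (planeIso.symm (B.qd s)) s :=
      (planeIso.symm.toContinuousLinearEquiv.toContinuousLinearMap.hasFDerivAt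
        (x := B.q s)).comp_hasDerivAt s (B.hasDerivAt s)
    exact h2.unique h3
  have hfr : frontier (planeIso ⁻¹' Ω) = Set.range fun s : ℝ => Q s := by
    rw [frontier_preimage_planeIso, ← B.range_eq]
    ext z
    simp only [Set.mem_preimage, Set.mem_range, hQs]
    refine exists_congr fun s => ?_
    rw [planeIso.symm_apply_eq]
  have hS : BoundaryStrip (planeIso ⁻¹' Ω) Q B.len (r / 2) (2 * A) :=
    { isOpen := hΩ.isOpen.preimage planeIso.continuous
      isBounded := by
        have := planeIso.symm.lipschitz.isBounded_image hΩ.isBounded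
        rwa [planeIso.symm.image_eq_preimage_symm] at this
      nonempty := by
        obtain ⟨x, hx⟩ := hΩ.isConnected.nonempty
        exact ⟨planeIso.symm x, by simpa using hx⟩
      l_pos := B.len_pos
      r_pos := by positivity
      holo := hQ.mono fun t ht => by
        rw [Set.mem_ofPred_eq] at ht ⊢
        linarith
      bound := fun t ht => hQb t ht.le
      periodic := fun t => hQp _ hp t
      norm_deriv := fun s => by rw [hd, planeIso.symm.norm_map, B.unitSpeed]
      frontier_eq := hfr }
  obtain ⟨σ, hσ, δ, r₀, hcol, hν⟩ := hS.exists_collar (ν := fun s => planeIso.symm (B.ν s))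
    (fun a ha b hb hab => B.injOn ha hb (planeIso.symm.injective (by simpa only [hQs] using hab)))
    (fun s => by rw [planeIso.symm.norm_map, B.ν_unit])
    (fun s => by
      rw [hd]
      have h1 := planeIso.symm.inner_map_map (B.qd s) (B.ν s)
      rw [real_inner_comm (B.ν s), B.ν_orth, Complex.inner] at h1
      exact h1)
    (fun s => by
      obtain ⟨δ, hδ, hin⟩ := B.ν_inward s
      refine ⟨δ, hδ, fun τ hτ => ?_⟩
      have := hin τ hτ
      rw [hQs, Set.mem_preimage, ← Complex.real_smul, map_add, map_smul]
      simpa using this)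
  refine ⟨_, r / 2, 2 * A, σ, δ, r₀, hσ, hcol, fun s => ⟨?_, (hν s).symm⟩⟩
  have hσσ : σ * σ = 1 := by rcases hσ with rfl | rfl <;> norm_num
  rw [← Complex.ofReal_mul, ← mul_assoc, hσσ, one_mul, hQs]

/-- The boundary normal derivative of a Dirichlet eigenfunction extends holomorphically to
a uniform strip (independent of `λ`), and the number of its complex zeros is at most
`C·λ`. -/
theorem dirichlet_complex_boundary_nodal_points
    (Ω : Set E2) (hΩ : IsPlaneDomain Ω) (B : BoundaryParam Ω) (hB : B.IsAnalytic) :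
    ∃ ε > (0 : ℝ), ∃ C > (0 : ℝ), ∀ lam : ℝ, 0 < lam → ∀ φ : E2 → ℝ,
      IsDirichletEigenfunction B lam φ →
      ∃ F : ℂ → ℂ,
        DifferentiableOn ℂ F {t : ℂ | |t.im| < ε} ∧
        (∀ t : ℂ, |t.im| < ε → F (t + B.len) = F t) ∧
        (∀ s : ℝ, F s = (⟪gradient φ (B.q s), B.ν s⟫ : ℂ)) ∧
        ({t : ℂ | 0 ≤ t.re ∧ t.re < B.len ∧ |t.im| ≤ ε / 2 ∧ F t = 0}).Finite ∧
        (({t : ℂ | 0 ≤ t.re ∧ t.re < B.len ∧ |t.im| ≤ ε / 2 ∧ F t = 0}).ncard : ℝ) ≤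
          C * lam := by
  obtain ⟨Q, r, b, σ, δ, r₀, hσ, hcol, hQ⟩ := B.exists_collar hΩ hB
  obtain ⟨ε, hε, C, hC, hmain⟩ := hcol.exists_nodal_bound
  refine ⟨ε, hε, C, hC, fun lam hlam φ hφ => ?_⟩
  obtain ⟨F, hF, hFp, hFs, hfin, hcard⟩ := hmain lam _ (hφ.dirichletMode hlam)
  have hσσ : (σ : ℂ) * σ = 1 := by rcases hσ with rfl | rfl <;> norm_num
  have him : ∀ t : ℂ, |((σ : ℂ) * t).im| = |t.im| := fun t => by
    rcases hσ with rfl | rfl <;> simp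
  have hre : ∀ t : ℂ, |((σ : ℂ) * t).re| = |t.re| := fun t => by
    rcases hσ with rfl | rfl <;> simp
  have hsub : {t : ℂ | 0 ≤ t.re ∧ t.re < B.len ∧ |t.im| ≤ ε / 2 ∧ F (σ * t) = 0} ⊆
      (fun t => (σ : ℂ) * t) '' {t : ℂ | |t.re| ≤ B.len ∧ |t.im| ≤ ε / 2 ∧ F t = 0} := by
    rintro t ⟨h1, h2, h3, h4⟩
    refine ⟨σ * t, ⟨?_, by rwa [him], h4⟩, ?_⟩
    · rw [hre, abs_of_nonneg h1]; exact h2.le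
    · simp only [← mul_assoc, hσσ, one_mul]
  refine ⟨fun t => F (σ * t), ?_, ?_, ?_, (hfin.image _).subset hsub, ?_⟩
  · refine hF.fun_comp (by fun_prop) fun t ht => ?_
    rw [Set.mem_ofPred_eq] at ht ⊢
    rwa [him]
  · intro t _
    rcases hσ with rfl | rfl
    · simpa using hFp t
    · have := hFp (-t - B.len)
      rw [sub_add_cancel] at this
      have e1 : ((-1 : ℝ) : ℂ) * (t + B.len) = -t - B.len := by push_cast; ring
      have e2 : ((-1 : ℝ) : ℂ) * t = -t := by push_cast; ring
      simp only [e1, e2, this]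
  · intro s
    obtain ⟨h1, h2⟩ := hQ s
    have := hFs (σ * s)
    rw [h1, h2, fderiv_comp_planeIso, planeIso.apply_symm_apply, planeIso.apply_symm_apply] at this
    simp only [← Complex.ofReal_mul]
    rw [this, gradient, InnerProductSpace.toDual_symm_apply]
  · refine le_trans ?_ hcard
    exact_mod_cast (Set.ncard_le_ncard hsub (hfin.image _)).trans (Set.ncard_image_le hfin)
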